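/- Let a and b be real numbers with b > a ≥ 1. Then for every ε > 0 there is a constant C = C(a,b,ε) such that for all positive integers n, | S_{a,b}(n) − [Γ(a+1)Γ(b+1)/Γ(a+b+2)]·[ζ(a+1)ζ(b+1)/ζ(a+b+2)]·σ_{a+b+1}(n) − [ζ(1−a)ζ(b+1)/((b+1)ζ(b−a+2))]·n^a·σ_{b−a+1}(n) | ≤ C·(n^b + n^{(a+b)/2 + 1 + ε}). -/

import Mathlib

open Finset

/-- `σ_a(n) = ∑_{d ∣ n} d^a` for real `a`. -/
noncomputable def sigmaR (a : ℝ) (n : ℕ) : ℝ := ∑ d ∈ n.divisors, (d : ℝ) ^ a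

/-- `S_{a,b}(n) = ∑_{k=1}^{n-1} σ_a(k) σ_b(n-k)`. -/
noncomputable def SR (a b : ℝ) (n : ℕ) : ℝ :=
  ∑ k ∈ Finset.Ico 1 n, sigmaR a k * sigmaR b (n - k)

/-- The Riemann zeta function at a real argument (it takes real values there). -/
noncomputable def zetaR (x : ℝ) : ℝ := (riemannZeta (x : ℂ)).re

section aux_lemmas
open Complex Set Filter Topology MeasureTheory

lemma gi_integrable (c ρ : ℝ) (hc : 0 < c) (hρ : 0 < ρ) :
    IntegrableOn (fun x : ℝ => x ^ c * Real.exp (-(ρ * x))) (Ioi 0) := by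
  have := integrableOn_rpow_mul_exp_neg_mul_rpow (p := 1) (s := c) (b := ρ) (by linarith) (by norm_num) hρ
  simpa using this

lemma gi_norm (c : ℝ) (z : ℂ) (x : ℝ) (hx : 0 < x) :
    ‖((x ^ c : ℝ) : ℂ) * cexp (-(x * z))‖ = x ^ c * Real.exp (-(z.re * x)) := by
  rw [norm_mul, Complex.norm_real, Complex.norm_exp, Real.norm_of_nonneg (by positivity)]
  simp [mul_comm]

lemma gi_meas (c : ℝ) (z : ℂ) : AEStronglyMeasurable
    (fun x : ℝ => ((x ^ c : ℝ) : ℂ) * cexp (-(x * z))) (volume.restrict (Ioi 0)) := by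
  apply Measurable.aestronglyMeasurable
  fun_prop

lemma gi_int (c : ℝ) (hc : 0 < c) (z : ℂ) (hz : 0 < z.re) :
    IntegrableOn (fun x : ℝ => ((x ^ c : ℝ) : ℂ) * cexp (-(x * z))) (Ioi 0) := by
  apply Integrable.mono' (gi_integrable c z.re hc hz) (gi_meas c z)
  filter_upwards [ae_restrict_mem measurableSet_Ioi] with x hx
  rw [gi_norm c z x hx]

lemma gi_deriv (c : ℝ) (hc : 0 < c) (z : ℂ) (hz : 0 < z.re) :
    HasDerivAt (fun z : ℂ => ∫ x in Ioi (0:ℝ), ((x ^ c : ℝ) : ℂ) * cexp (-(x * z)))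
      (∫ x in Ioi (0:ℝ), ((x ^ c : ℝ) : ℂ) * (cexp (-(x * z)) * (-(x:ℂ)))) z := by
  have hs : {w : ℂ | z.re / 2 < w.re} ∈ 𝓝 z :=
    (isOpen_lt continuous_const Complex.continuous_re).mem_nhds (by simp; linarith)
  refine (hasDerivAt_integral_of_dominated_loc_of_deriv_le (F := fun (z : ℂ) (x : ℝ) => ((x ^ c : ℝ) : ℂ) * cexp (-(x * z)))
    (F' := fun (z : ℂ) (x : ℝ) => ((x ^ c : ℝ) : ℂ) * (cexp (-(x * z)) * (-(x:ℂ))))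
    (bound := fun x => x ^ (c+1) * Real.exp (-(z.re / 2 * x))) hs ?_ (gi_int c hc z hz) ?_ ?_ ?_ ?_).2
  · exact Eventually.of_forall (fun w => gi_meas c w)
  · apply Measurable.aestronglyMeasurable
    fun_prop
  · filter_upwards [ae_restrict_mem measurableSet_Ioi] with x hx w hw
    have hx' : 0 < x := hx
    rw [← mul_assoc, norm_mul, gi_norm c w x hx, Real.rpow_add hx', Real.rpow_one]
    simp only [norm_neg, Complex.norm_real, Real.norm_of_nonneg hx'.le]
    have : Real.exp (-(w.re * x)) ≤ Real.exp (-(z.re / 2 * x)) := by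
      apply Real.exp_le_exp.mpr
      have : z.re / 2 < w.re := hw
      nlinarith
    calc _ = (x ^ c * x) * Real.exp (-(w.re * x)) := by ring
      _ ≤ _ := by gcongr
  · exact gi_integrable (c+1) (z.re/2) (by linarith) (by linarith)
  · refine Eventually.of_forall (fun x w hw => ?_)
    have h1 : HasDerivAt (fun w : ℂ => -((x:ℂ) * w)) (-(x:ℂ)) w := by
      simpa using ((hasDerivAt_id' w).const_mul (x:ℂ)).fun_neg
    exact (h1.cexp).const_mul _

lemma gi_eval (c : ℝ) (hc : 0 < c) (z : ℂ) (hz : 0 < z.re) :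
    ∫ x in Ioi (0:ℝ), ((x ^ c : ℝ) : ℂ) * cexp (-(x * z))
      = (Real.Gamma (c+1) : ℂ) * z ^ (-(c+1 : ℝ) : ℂ) := by
  have hopen : IsOpen {w : ℂ | 0 < w.re} := isOpen_lt continuous_const Complex.continuous_re
  have hf : AnalyticOnNhd ℂ (fun z : ℂ => ∫ x in Ioi (0:ℝ), ((x ^ c : ℝ) : ℂ) * cexp (-(x * z))) {w : ℂ | 0 < w.re} := by
    apply DifferentiableOn.analyticOnNhd _ hopen
    intro w hw
    exact (gi_deriv c hc w hw).differentiableAt.differentiableWithinAt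
  have hg : AnalyticOnNhd ℂ (fun z : ℂ => (Real.Gamma (c+1) : ℂ) * z ^ (-(c+1 : ℝ) : ℂ)) {w : ℂ | 0 < w.re} := by
    apply DifferentiableOn.analyticOnNhd _ hopen
    intro w hw
    apply DifferentiableAt.differentiableWithinAt
    apply DifferentiableAt.const_mul
    exact differentiableAt_id.cpow_const (Or.inl hw)
  have hreal : ∀ r : ℝ, 0 < r → ∫ x in Ioi (0:ℝ), ((x ^ c : ℝ) : ℂ) * cexp (-(x * (r:ℂ)))
      = (Real.Gamma (c+1) : ℂ) * (r:ℂ) ^ (-(c+1 : ℝ) : ℂ) := by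
    intro r hr
    have h := Real.integral_rpow_mul_exp_neg_mul_Ioi (a := c+1) (r := r) (by linarith) hr
    have e1 : ∀ x : ℝ, ((x ^ c : ℝ) : ℂ) * cexp (-(x * (r:ℂ))) = ((x ^ (c + 1 - 1) * Real.exp (-(r * x)) : ℝ) : ℂ) := by
      intro x; push_cast; rw [add_sub_cancel_right, mul_comm (x:ℂ)]
    simp_rw [e1]
    rw [integral_complex_ofReal, h, mul_comm, Complex.ofReal_mul]
    congr 1
    rw [← Complex.ofReal_neg, ← Complex.ofReal_cpow hr.le, one_div, Real.inv_rpow hr.le, Real.rpow_neg hr.le]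
  have hfr : ∃ᶠ w in 𝓝[≠] (1:ℂ), ∫ x in Ioi (0:ℝ), ((x ^ c : ℝ) : ℂ) * cexp (-(x * w))
      = (Real.Gamma (c+1) : ℂ) * w ^ (-(c+1 : ℝ) : ℂ) := by
    have ht : Tendsto (fun k : ℕ => (((1 + 1 / ((k:ℝ) + 1) : ℝ)) : ℂ)) atTop (𝓝[≠] 1) := by
      apply tendsto_nhdsWithin_of_tendsto_nhds_of_eventually_within
      · have := (tendsto_one_div_add_atTop_nhds_zero_nat (𝕜 := ℝ)).const_add 1
        rw [add_zero] at this
        exact (Complex.continuous_ofReal.tendsto 1).comp this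
      · refine Eventually.of_forall (fun k => ?_)
        simp only [mem_compl_iff, mem_singleton_iff]
        norm_cast
        have : (0:ℝ) < 1 / ((k:ℝ)+1) := by positivity
        push_cast
        linarith
    refine ht.frequently (Frequently.of_forall (fun k => ?_))
    exact hreal _ (by positivity)
  have hpre : IsPreconnected {w : ℂ | 0 < w.re} := (convex_halfSpace_re_gt 0).isPreconnected
  exact hf.eqOn_of_preconnected_of_frequently_eq hg hpre (by simp) hfr hz

/-- the function `x ↦ x₊^c e^{-sx}` -/
noncomputable def gf (c : ℝ) (s : ℂ) (x : ℝ) : ℂ := (((max x 0) ^ c : ℝ) : ℂ) * cexp (-(x * s))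

lemma gf_cont (c : ℝ) (hc : 0 < c) (s : ℂ) : Continuous (gf c s) := by
  unfold gf
  have : Continuous fun x : ℝ => (max x 0) ^ c :=
    (continuous_id.max continuous_const).rpow_const (fun x => Or.inr hc.le)
  fun_prop

lemma gf_neg (c : ℝ) (hc : 0 < c) (s : ℂ) (x : ℝ) (hx : x ≤ 0) : gf c s x = 0 := by
  simp [gf, max_eq_right hx, Real.zero_rpow hc.ne']

lemma gf_pos (c : ℝ) (s : ℂ) (x : ℝ) (hx : 0 < x) :
    gf c s x = ((x ^ c : ℝ) : ℂ) * cexp (-(x * s)) := by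
  simp [gf, max_eq_left hx.le]

lemma gf_eq_ind (c : ℝ) (hc : 0 < c) (s : ℂ) :
    gf c s = (Ioi (0:ℝ)).indicator (fun x => ((x ^ c : ℝ) : ℂ) * cexp (-(x * s))) := by
  ext x
  by_cases hx : 0 < x
  · rw [gf_pos c s x hx, indicator_of_mem (by exact hx)]
  · rw [gf_neg c hc s x (not_lt.mp hx), indicator_of_notMem (by simpa using hx)]

lemma gf_integrable (c : ℝ) (hc : 0 < c) (s : ℂ) (hs : 0 < s.re) : Integrable (gf c s) := by
  rw [gf_eq_ind c hc s, integrable_indicator_iff measurableSet_Ioi]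
  exact gi_int c hc s hs

lemma gf_fourier (c : ℝ) (hc : 0 < c) (s : ℂ) (hs : 0 < s.re) (ξ : ℝ) :
    FourierTransform.fourier (gf c s) ξ
      = (Real.Gamma (c+1) : ℂ) * (s + 2 * Real.pi * I * ξ) ^ (-(c+1 : ℝ) : ℂ) := by
  rw [← gi_eval c hc _ (by simpa using hs), Real.fourier_eq', ← integral_indicator measurableSet_Ioi]
  congr 1
  ext x
  by_cases hx : 0 < x
  · rw [gf_pos c s x hx, indicator_of_mem (by exact hx)]
    simp only [RCLike.inner_apply, conj_trivial, smul_eq_mul]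
    rw [mul_left_comm, ← Complex.exp_add]
    congr 2
    push_cast; ring
  · rw [gf_neg c hc s x (not_lt.mp hx), indicator_of_notMem (by simpa using hx), smul_zero]

lemma gf_norm_shift (s : ℂ) (ξ : ℝ) : 2 * Real.pi * |ξ| - ‖s‖ ≤ ‖s + 2 * Real.pi * I * ξ‖ := by
  have h := norm_sub_le (s + 2 * Real.pi * I * ξ) s
  rw [add_sub_cancel_left] at h
  have : ‖(2 * Real.pi * I * ξ : ℂ)‖ = 2 * Real.pi * |ξ| := by
    simp [abs_of_pos Real.pi_pos]
  linarith

lemma gf_four_bigO (c : ℝ) (hc : 0 < c) (s : ℂ) :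
    (fun ξ : ℝ => (Real.Gamma (c+1) : ℂ) * (s + 2 * Real.pi * I * ξ) ^ (-(c+1 : ℝ) : ℂ))
      =O[cocompact ℝ] fun x => |x| ^ (-(c+1)) := by
  apply Asymptotics.IsBigO.const_mul_left
  apply Asymptotics.IsBigO.of_bound 1
  have h : ∀ᶠ ξ : ℝ in cocompact ℝ, ‖s‖ + 1 ≤ ‖ξ‖ := (tendsto_norm_cocompact_atTop (E := ℝ)).eventually_ge_atTop _
  filter_upwards [h] with ξ hξ
  rw [Real.norm_eq_abs] at hξ
  rw [← Complex.ofReal_neg, norm_cpow_real, one_mul, Real.norm_of_nonneg (by positivity)]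
  have h1 := gf_norm_shift s ξ
  have h2 := Real.pi_gt_three
  have h3 := norm_nonneg s
  apply Real.rpow_le_rpow_of_nonpos (by linarith) (by nlinarith) (by linarith)

lemma gf_bigO (c : ℝ) (hc : 0 < c) (s : ℂ) (hs : 0 < s.re) :
    gf c s =O[cocompact ℝ] fun x => |x| ^ (-(c+1)) := by
  have ht := tendsto_rpow_mul_exp_neg_mul_atTop_nhds_zero (c + (c+1)) s.re hs
  have h1 : ∀ᶠ x : ℝ in atTop, x ^ (c + (c+1)) * Real.exp (-s.re * x) ≤ 1 :=
    (ht.eventually_le_const (by norm_num : (0:ℝ) < 1))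
  rw [cocompact_eq_atBot_atTop, Asymptotics.isBigO_sup]
  constructor
  · apply Asymptotics.IsBigO.of_bound 1
    filter_upwards [eventually_le_atBot (0:ℝ)] with x hx
    rw [gf_neg c hc s x hx]; simp
  · apply Asymptotics.IsBigO.of_bound 1
    filter_upwards [h1, eventually_gt_atTop (0:ℝ)] with x hx hx0
    rw [gf_pos c s x hx0, gi_norm c s x hx0, one_mul, abs_of_pos hx0, Real.norm_of_nonneg (by positivity),
      Real.rpow_neg hx0.le, ← one_div, le_div_iff₀ (by positivity)]
    rw [Real.rpow_add hx0, neg_mul] at hx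
    linarith

/-- `Λ_c(s) = ∑ d^c e^{-ds}`. -/
noncomputable def Lam (c : ℝ) (s : ℂ) : ℂ := ∑' d : ℕ+, (((d:ℝ) ^ c : ℝ) : ℂ) * cexp (-((d:ℂ) * s))

lemma four_summable (c : ℝ) (hc : 0 < c) (s : ℂ) :
    Summable fun k : ℤ => (Real.Gamma (c+1) : ℂ) * (s + 2 * Real.pi * I * k) ^ (-(c+1 : ℝ) : ℂ) := by
  have := summable_of_isBigO (Real.summable_abs_int_rpow (b := c+1) (by linarith))
    ((gf_four_bigO c hc s).comp_tendsto Int.tendsto_coe_cofinite)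
  simpa [Function.comp_def] using this

lemma lipschitz (c : ℝ) (hc : 0 < c) (s : ℂ) (hs : 0 < s.re) :
    Lam c s = ∑' k : ℤ, (Real.Gamma (c+1) : ℂ) * (s + 2 * Real.pi * I * k) ^ (-(c+1 : ℝ) : ℂ) := by
  have hF : FourierTransform.fourier (gf c s) = fun ξ : ℝ => (Real.Gamma (c+1) : ℂ) * (s + 2 * Real.pi * I * ξ) ^ (-(c+1 : ℝ) : ℂ) := by
    ext ξ; exact gf_fourier c hc s hs ξ
  have h := Real.tsum_eq_tsum_fourier_of_rpow_decay (gf_cont c hc s) (b := c+1) (by linarith)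
    (gf_bigO c hc s hs) (by rw [hF]; exact gf_four_bigO c hc s) 0
  rw [hF] at h
  simp only [zero_add, QuotientAddGroup.mk_zero, fourier_eval_zero, mul_one, Complex.ofReal_intCast] at h
  rw [← h, Lam]
  have hinj : Function.Injective (fun d : ℕ+ => ((d:ℕ):ℤ)) := fun x y hxy => by
    simpa using hxy
  rw [← hinj.tsum_eq (f := fun n : ℤ => gf c s n)]
  · apply tsum_congr
    intro d
    rw [gf_pos c s _ (by simp)]
    simp
  · intro k hk
    by_contra hcon
    apply hk
    apply gf_neg c hc
    by_contra hpos
    push Not at hpos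
    have hk0 : 0 < k := by exact_mod_cast hpos
    exact hcon ⟨⟨k.toNat, by omega⟩, by simp; omega⟩

lemma four_integrable (c : ℝ) (hc : 0 < c) (s : ℂ) (hs : 0 < s.re) :
    Integrable (fun ξ : ℝ => (Real.Gamma (c+1) : ℂ) * (s + 2 * Real.pi * I * ξ) ^ (-(c+1 : ℝ) : ℂ)) := by
  have hcont : Continuous (fun ξ : ℝ => (Real.Gamma (c+1) : ℂ) * (s + 2 * Real.pi * I * ξ) ^ (-(c+1 : ℝ) : ℂ)) := by
    apply Continuous.mul continuous_const
    apply Continuous.cpow (by fun_prop) continuous_const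
    intro x; left; simpa using hs
  have h := gf_four_bigO c hc s
  apply hcont.locallyIntegrable.integrable_of_isBigO_cocompact (g := fun x : ℝ => (1 + ‖x‖) ^ (-(c+1)))
  · refine h.trans ?_
    apply Asymptotics.IsBigO.of_bound ((2:ℝ) ^ (c+1))
    have h : ∀ᶠ ξ : ℝ in cocompact ℝ, 1 ≤ ‖ξ‖ := (tendsto_norm_cocompact_atTop (E := ℝ)).eventually_ge_atTop _
    filter_upwards [h] with x hx
    rw [Real.norm_of_nonneg (by positivity), Real.norm_of_nonneg (by positivity)]
    rw [Real.norm_eq_abs] at *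
    have : (2:ℝ) ^ (c+1) = ((2:ℝ)⁻¹) ^ (-(c+1)) := by
      rw [Real.inv_rpow (by norm_num), Real.rpow_neg (by norm_num), inv_inv]
    rw [this, ← Real.mul_rpow (by norm_num) (by positivity)]
    apply Real.rpow_le_rpow_of_nonpos (by positivity) (by linarith) (by linarith)
  · exact (integrable_one_add_norm (E := ℝ) (μ := volume) (r := c+1) (by simp; linarith)).integrableAtFilter _

lemma hankel (c : ℝ) (hc : 0 < c) (s : ℂ) (hs : 0 < s.re) (x : ℝ) (hx : 0 < x) :
    ∫ ξ : ℝ, (s + 2 * Real.pi * I * ξ) ^ (-(c+1 : ℝ) : ℂ) * cexp (x * (s + 2 * Real.pi * I * ξ))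
      = ((x ^ c / Real.Gamma (c+1) : ℝ) : ℂ) := by
  have hF : FourierTransform.fourier (gf c s) = fun ξ : ℝ => (Real.Gamma (c+1) : ℂ) * (s + 2 * Real.pi * I * ξ) ^ (-(c+1 : ℝ) : ℂ) := by
    ext ξ; exact gf_fourier c hc s hs ξ
  have h := (gf_integrable c hc s hs).fourierInv_fourier_eq (by rw [hF]; exact four_integrable c hc s hs)
    (v := x) (gf_cont c hc s).continuousAt
  rw [hF, Real.fourierInv_eq', gf_pos c s x hx] at h
  have hG : (Real.Gamma (c+1) : ℂ) ≠ 0 := by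
    exact_mod_cast (Real.Gamma_pos_of_pos (by linarith)).ne'
  have e : ∀ ξ : ℝ, (s + 2 * Real.pi * I * ξ) ^ (-(c+1 : ℝ) : ℂ) * cexp (x * (s + 2 * Real.pi * I * ξ))
      = (cexp (x * s) / Real.Gamma (c+1)) * (cexp (↑(2 * Real.pi * inner ℝ ξ x) * I) • ((Real.Gamma (c+1) : ℂ) * (s + 2 * Real.pi * I * ξ) ^ (-(c+1 : ℝ) : ℂ))) := by
    intro ξ
    rw [mul_add, Complex.exp_add]
    simp only [RCLike.inner_apply, conj_trivial, smul_eq_mul]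
    field_simp
    congr 2
    push_cast; ring
  simp_rw [e]
  rw [integral_const_mul, h]
  rw [Complex.exp_neg]
  push_cast
  field_simp

lemma lam_norm (c : ℝ) (s : ℂ) (d : ℕ+) :
    ‖(((d:ℝ) ^ c : ℝ) : ℂ) * cexp (-((d:ℂ) * s))‖ = (d:ℝ) ^ c * Real.exp (-(d * s.re)) := by
  rw [norm_mul, Complex.norm_real, Complex.norm_exp, Real.norm_of_nonneg (by positivity)]
  simp

lemma lam_summable_real (c r : ℝ) (hr : 0 < r) :
    Summable fun d : ℕ+ => (d:ℝ) ^ c * Real.exp (-(d * r)) := by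
  obtain ⟨k, hk⟩ := exists_nat_ge c
  have h := (Real.summable_pow_mul_exp_neg_nat_mul k hr).comp_injective PNat.coe_injective
  refine Summable.of_nonneg_of_le (fun d => by positivity) (fun d => ?_) h
  have h1 : (1:ℝ) ≤ (d:ℝ) := by exact_mod_cast d.one_le
  simp only [Function.comp]
  have : (d:ℝ) ^ c ≤ (d:ℝ) ^ k := by
    rw [← Real.rpow_natCast]
    exact Real.rpow_le_rpow_of_exponent_le h1 hk
  have e : -((d:ℝ) * r) = -r * ((d:ℕ):ℝ) := by ring
  rw [e]
  gcongr

lemma lam_summable (c : ℝ) (s : ℂ) (hs : 0 < s.re) :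
    Summable fun d : ℕ+ => (((d:ℝ) ^ c : ℝ) : ℂ) * cexp (-((d:ℂ) * s)) := by
  apply Summable.of_norm
  simp_rw [lam_norm]
  exact lam_summable_real c s.re hs

lemma lam_deriv (c : ℝ) (s : ℂ) (hs : 0 < s.re) :
    HasDerivAt (Lam c) (-Lam (c+1) s) s := by
  have hopen : IsOpen {w : ℂ | s.re / 2 < w.re} := isOpen_lt continuous_const Complex.continuous_re
  have hpre : IsPreconnected {w : ℂ | s.re / 2 < w.re} := (convex_halfSpace_re_gt (s.re/2)).isPreconnected
  have hmem : s ∈ {w : ℂ | s.re / 2 < w.re} := by simp; linarith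
  have key := hasDerivAt_tsum_of_isPreconnected
    (g := fun (d : ℕ+) (z : ℂ) => (((d:ℝ) ^ c : ℝ) : ℂ) * cexp (-((d:ℂ) * z)))
    (g' := fun (d : ℕ+) (z : ℂ) => (((d:ℝ) ^ c : ℝ) : ℂ) * (cexp (-((d:ℂ) * z)) * (-(d:ℂ))))
    (lam_summable_real (c+1) (s.re/2) (by linarith)) hopen hpre ?_ ?_ hmem (lam_summable c s hs) hmem
  · refine HasDerivAt.congr_deriv key ?_
    unfold Lam
    rw [← tsum_neg]
    apply tsum_congr
    intro d
    have hd : (0:ℝ) < d := by exact_mod_cast d.pos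
    rw [Real.rpow_add hd, Real.rpow_one]
    push_cast; ring
  · intro d z hz
    have h1 : HasDerivAt (fun w : ℂ => -((d:ℂ) * w)) (-(d:ℂ)) z := by
      simpa using ((hasDerivAt_id' z).const_mul (d:ℂ)).fun_neg
    exact (h1.cexp).const_mul _
  · intro d z hz
    have hd : (0:ℝ) < d := by exact_mod_cast d.pos
    rw [← mul_assoc, norm_mul, lam_norm, Real.rpow_add hd, Real.rpow_one]
    have : ‖-(d:ℂ)‖ = (d:ℝ) := by rw [norm_neg]; simp
    rw [this]
    have hz' : s.re / 2 < z.re := hz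
    have : Real.exp (-(d * z.re)) ≤ Real.exp (-(d * (s.re / 2))) := by
      apply Real.exp_le_exp.mpr; nlinarith
    calc _ = ((d:ℝ) ^ c * d) * Real.exp (-(d * z.re)) := by ring
      _ ≤ _ := by gcongr

lemma lam_bound (c r : ℝ) (hr : 0 < r) (s : ℂ) (hs : r ≤ s.re) :
    ‖Lam c s‖ ≤ Real.exp (-(s.re - r)) * ∑' d : ℕ+, (d:ℝ) ^ c * Real.exp (-(d * r)) := by
  rw [← tsum_mul_left]
  refine tsum_of_norm_bounded ((lam_summable_real c r hr).mul_left _).hasSum (fun d => ?_)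
  rw [lam_norm, mul_left_comm, ← Real.exp_add]
  have hd : (1:ℝ) ≤ d := by exact_mod_cast d.one_le
  have : -(d * s.re) ≤ -(s.re - r) + -(d * r) := by nlinarith
  gcongr

lemma norm_lin (τ : ℂ) (hτ : 0 < τ.re) (κ y : ℝ) :
    ‖y * τ + I * κ‖ ^ 2 = ‖τ‖^2 * ((y + κ * τ.im / ‖τ‖^2)^2 + (|κ| / (‖τ‖ / τ.re * ‖τ‖))^2) := by
  have h0 : 0 < ‖τ‖ := by
    apply norm_pos_iff.mpr; rintro rfl; simp at hτ
  have h1 : ‖τ‖^2 = τ.re^2 + τ.im^2 := by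
    rw [Complex.sq_norm, Complex.normSq_apply]; ring
  have h2 : ‖y * τ + I * κ‖ ^ 2 = (y * τ.re)^2 + (y * τ.im + κ)^2 := by
    rw [Complex.sq_norm, Complex.normSq_apply]; simp; ring
  rw [h2, div_pow, sq_abs]
  have e : (‖τ‖ / τ.re * ‖τ‖)^2 = (‖τ‖^2)^2 / τ.re^2 := by field_simp
  rw [e, h1]
  have : 0 < τ.re^2 + τ.im^2 := by positivity
  field_simp
  ring

lemma norm_lin_ge (τ : ℂ) (hτ : 0 < τ.re) (κ y : ℝ) :
    |κ| / (‖τ‖ / τ.re) ≤ ‖y * τ + I * κ‖ := by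
  have h0 : 0 < ‖τ‖ := by
    apply norm_pos_iff.mpr; rintro rfl; simp at hτ
  apply le_of_sq_le_sq _ (norm_nonneg _)
  rw [norm_lin τ hτ]
  have : (|κ| / (‖τ‖ / τ.re))^2 = ‖τ‖^2 * (|κ| / (‖τ‖ / τ.re * ‖τ‖))^2 := by
    field_simp
  rw [this]
  have : 0 ≤ (y + κ * τ.im / ‖τ‖^2)^2 := by positivity
  gcongr
  linarith

lemma lin_re (τ : ℂ) (κ y : ℝ) : (y * τ + I * κ).re = y * τ.re := by simp

lemma f_bound (a : ℝ) (ha : 0 < a) (τ : ℂ) (hτ : 0 < τ.re) (κ y : ℝ) (hκ : κ ≠ 0) :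
    ‖(y * τ + I * κ) ^ (-(a+1 : ℝ) : ℂ)‖ ≤ (‖τ‖ / τ.re) ^ (a+1) * |κ| ^ (-(a+1)) := by
  have h0 : 0 < ‖τ‖ := by
    apply norm_pos_iff.mpr; rintro rfl; simp at hτ
  have hk : 0 < |κ| := abs_pos.mpr hκ
  have hT : 0 < ‖τ‖ / τ.re := by positivity
  rw [← Complex.ofReal_neg, norm_cpow_real]
  calc _ ≤ (|κ| / (‖τ‖ / τ.re)) ^ (-(a+1)) :=
        Real.rpow_le_rpow_of_nonpos (by positivity) (norm_lin_ge τ hτ κ y) (by linarith)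
    _ = _ := by
        rw [Real.div_rpow hk.le hT.le, Real.rpow_neg hT.le, div_inv_eq_mul, mul_comm]

lemma f_deriv (p : ℝ) (τ : ℂ) (hτ : 0 < τ.re) (z y : ℂ) (hy : 0 < (y * τ + z).re) :
    HasDerivAt (fun y : ℂ => (y * τ + z) ^ (-(p : ℝ) : ℂ)) (-(p:ℂ) * (y * τ + z) ^ (-(p+1 : ℝ) : ℂ) * τ) y := by
  have h1 : HasDerivAt (fun y : ℂ => y * τ + z) τ y := by
    simpa using ((hasDerivAt_id' y).mul_const τ).add_const z
  have := h1.cpow_const (c := (-(p : ℝ) : ℂ)) (Or.inl hy)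
  convert this using 3
  push_cast; ring_nf

lemma f_deriv_real (p : ℝ) (τ : ℂ) (hτ : 0 < τ.re) (z : ℂ) (hz : 0 ≤ z.re) (y : ℝ) (hy : 0 < y) :
    HasDerivAt (fun y : ℝ => (y * τ + z) ^ (-(p : ℝ) : ℂ)) (-(p:ℂ) * (y * τ + z) ^ (-(p+1 : ℝ) : ℂ) * τ) y := by
  have : 0 < ((y:ℂ) * τ + z).re := by simp; positivity
  exact (f_deriv p τ hτ z y this).comp_ofReal

lemma f_var (a : ℝ) (ha : 1 ≤ a) (τ : ℂ) (hτ : 0 < τ.re) (κ : ℝ) (hκ : κ ≠ 0) :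
    ∃ W : ℝ → ℝ, Monotone W ∧
      (∀ y₁ y₂ : ℝ, 0 < y₁ → y₁ ≤ y₂ →
        ‖(y₂ * τ + I * κ) ^ (-(a+1 : ℝ) : ℂ) - (y₁ * τ + I * κ) ^ (-(a+1 : ℝ) : ℂ)‖ ≤ W y₂ - W y₁) ∧
      (∀ y₁ y₂ : ℝ, W y₂ - W y₁ ≤ (a+1) * Real.pi * ((‖τ‖ / τ.re) ^ (a+1) * |κ| ^ (-(a+1)))) := by
  have h0 : 0 < ‖τ‖ := by
    apply norm_pos_iff.mpr; rintro rfl; simp at hτ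
  have hk : 0 < |κ| := abs_pos.mpr hκ
  set T := ‖τ‖ / τ.re with hTdef
  have hT : 0 < T := by positivity
  set η := |κ| / (T * ‖τ‖) with hη
  have hηpos : 0 < η := by positivity
  set y0 := κ * τ.im / ‖τ‖^2 with hy0
  set D := (a+1) * ‖τ‖⁻¹ * (T ^ a * |κ| ^ (-a)) with hD
  have hDpos : 0 < D := by positivity
  let W : ℝ → ℝ := fun y => D * (η⁻¹ * Real.arctan ((y + y0) / η))
  have hWd : ∀ y, HasDerivAt W (D * (1 / ((y + y0)^2 + η^2))) y := by
    intro y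
    have h1 : HasDerivAt (fun y : ℝ => (y + y0) / η) (1 / η) y :=
      ((hasDerivAt_id' y).add_const y0).div_const η
    have h2 := (h1.arctan.const_mul η⁻¹).const_mul D
    refine h2.congr_deriv ?_
    have : (y + y0)^2 + η^2 ≠ 0 := by positivity
    field_simp
    ring
  have hmono : Monotone W := by
    intro x y hxy
    have : Real.arctan ((x + y0) / η) ≤ Real.arctan ((y + y0) / η) := by
      apply Real.arctan_strictMono.monotone
      gcongr
    simp only [W]
    gcongr
  refine ⟨W, hmono, ?_, ?_⟩
  · intro y₁ y₂ hy₁ hy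
    have key := image_norm_le_of_norm_deriv_right_le_deriv_boundary (a := y₁) (b := y₂)
      (f := fun y : ℝ => (y * τ + I * κ) ^ (-(a+1 : ℝ) : ℂ) - (y₁ * τ + I * κ) ^ (-(a+1 : ℝ) : ℂ))
      (f' := fun y : ℝ => (-((a+1 : ℝ):ℂ) * (y * τ + I * κ) ^ (-(a+1+1 : ℝ) : ℂ) * τ))
      (B := fun y => W y - W y₁) (B' := fun y => D * (1 / ((y + y0)^2 + η^2))) ?_ ?_ ?_ ?_ ?_
    · exact key ⟨hy, le_refl _⟩
    · intro y hyy
      have := (f_deriv_real (a+1) τ hτ (I * κ) (by simp) y (by linarith [hyy.1])).sub_const ((y₁ * τ + I * κ) ^ (-(a+1 : ℝ) : ℂ))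
      exact this.continuousAt.continuousWithinAt
    · intro y hyy
      have := (f_deriv_real (a+1) τ hτ (I * κ) (by simp) y (by linarith [hyy.1])).sub_const ((y₁ * τ + I * κ) ^ (-(a+1 : ℝ) : ℂ))
      exact this.hasDerivWithinAt
    · simp
    · intro x; exact (hWd x).sub_const _
    · intro y hyy
      have hypos : 0 < y := by linarith [hyy.1]
      have hge := norm_lin_ge τ hτ κ y
      have hnl := norm_lin τ hτ κ y
      rw [← hTdef, ← hη, ← hy0] at hnl
      rw [← hTdef] at hge
      set N := ‖(y:ℂ) * τ + I * κ‖ with hN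
      have hNpos : 0 < N := lt_of_lt_of_le (by positivity) hge
      rw [norm_mul, norm_mul, norm_neg, Complex.norm_real, Real.norm_of_nonneg (by linarith),
        ← Complex.ofReal_neg, norm_cpow_real, ← hN]
      have e1 : N ^ (-(a+1+1)) = N ^ (-a) * (N^2)⁻¹ := by
        rw [show -(a+1+1) = -a + (-2:ℝ) by ring, Real.rpow_add hNpos, Real.rpow_neg hNpos.le (2:ℝ)]
        norm_cast
      have e2 : N ^ (-a) ≤ T ^ a * |κ| ^ (-a) := by
        calc _ ≤ (|κ| / T) ^ (-a) :=
            Real.rpow_le_rpow_of_nonpos (by positivity) hge (by linarith)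
          _ = _ := by
            rw [Real.div_rpow hk.le hT.le, Real.rpow_neg hT.le, div_inv_eq_mul, mul_comm]
      rw [e1, hnl]
      have hpp : 0 < (y + y0)^2 + η^2 := by positivity
      calc (a+1) * (N ^ (-a) * (‖τ‖^2 * ((y + y0)^2 + η^2))⁻¹) * ‖τ‖
          ≤ (a+1) * ((T ^ a * |κ| ^ (-a)) * (‖τ‖^2 * ((y + y0)^2 + η^2))⁻¹) * ‖τ‖ := by gcongr
        _ = _ := by rw [hD]; field_simp
  · intro y₁ y₂
    have b1 := Real.arctan_lt_pi_div_two ((y₂ + y0) / η)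
    have b2 := Real.neg_pi_div_two_lt_arctan ((y₁ + y0) / η)
    have : W y₂ - W y₁ ≤ D * (η⁻¹ * Real.pi) := by
      simp only [W]
      rw [← mul_sub, ← mul_sub]
      gcongr
      linarith
    refine this.trans (le_of_eq ?_)
    rw [hD, hη, Real.rpow_add hT, Real.rpow_one, neg_add, Real.rpow_add hk, Real.rpow_neg_one]
    field_simp

noncomputable def gterm (a : ℝ) (τ : ℂ) (β y : ℝ) (k : ℤ) : ℂ :=
  if β + k = 0 then 0 else (y * τ + I * (2 * Real.pi * (β + k) : ℝ)) ^ (-(a+1 : ℝ) : ℂ)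

noncomputable def Gs (a : ℝ) (τ : ℂ) (β y : ℝ) : ℂ := (Real.Gamma (a+1) : ℂ) * ∑' k : ℤ, gterm a τ β y k

noncomputable def Zb (a β : ℝ) : ℝ := ∑' k : ℤ, |β + k| ^ (-(a+1))

open Classical in
noncomputable def iot (β : ℝ) : ℂ := if ∃ k : ℤ, β + k = 0 then 1 else 0

noncomputable def Hs (a : ℝ) (τ : ℂ) (β y : ℝ) : ℂ :=
  Lam (a-1) (y * τ + 2 * Real.pi * I * β) - iot β * (Real.Gamma a * (y * τ) ^ (-(a : ℝ) : ℂ))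

lemma Zb_summable (a β : ℝ) (ha : 0 < a) : Summable fun k : ℤ => |β + k| ^ (-(a+1)) := by
  have := (Real.summable_one_div_int_add_rpow β (a+1)).mpr (by linarith)
  refine this.congr (fun k => ?_)
  rw [Real.rpow_neg (abs_nonneg _), one_div, add_comm]

lemma gterm_bound (a : ℝ) (ha : 0 < a) (τ : ℂ) (hτ : 0 < τ.re) (β y : ℝ) (k : ℤ) :
    ‖gterm a τ β y k‖ ≤ (‖τ‖ / τ.re) ^ (a+1) * |β + k| ^ (-(a+1)) := by
  unfold gterm
  split_ifs with h
  · simp; positivity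
  · refine (f_bound a ha τ hτ _ y (by positivity)).trans ?_
    gcongr ?_ * ?_
    apply Real.rpow_le_rpow_of_nonpos (by positivity) _ (by linarith)
    rw [abs_mul, abs_of_pos Real.two_pi_pos]
    nlinarith [Real.pi_gt_three, abs_nonneg (β + k)]

lemma gterm_summable (a : ℝ) (ha : 0 < a) (τ : ℂ) (hτ : 0 < τ.re) (β y : ℝ) :
    Summable (gterm a τ β y) :=
  Summable.of_norm_bounded ((Zb_summable a β ha).mul_left _) (gterm_bound a ha τ hτ β y)

lemma Gs_bound (a : ℝ) (ha : 0 < a) (τ : ℂ) (hτ : 0 < τ.re) (β y : ℝ) :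
    ‖Gs a τ β y‖ ≤ Real.Gamma (a+1) * ((‖τ‖ / τ.re) ^ (a+1) * Zb a β) := by
  have hg : 0 < Real.Gamma (a+1) := Real.Gamma_pos_of_pos (by linarith)
  rw [Gs, norm_mul, Complex.norm_real, Real.norm_of_nonneg hg.le]
  gcongr
  exact tsum_of_norm_bounded ((Zb_summable a β ha).hasSum.mul_left _) (gterm_bound a ha τ hτ β y)

lemma gterm_var (a : ℝ) (ha : 1 ≤ a) (τ : ℂ) (hτ : 0 < τ.re) (β : ℝ) (k : ℤ) :
    ∃ W : ℝ → ℝ, Monotone W ∧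
      (∀ y₁ y₂ : ℝ, 0 < y₁ → y₁ ≤ y₂ →
        ‖gterm a τ β y₂ k - gterm a τ β y₁ k‖ ≤ W y₂ - W y₁) ∧
      (∀ y₁ y₂ : ℝ, W y₂ - W y₁ ≤ (a+1) * Real.pi * (‖τ‖ / τ.re) ^ (a+1) * |β + k| ^ (-(a+1))) := by
  by_cases h : β + k = 0
  · refine ⟨fun _ => 0, monotone_const, ?_, ?_⟩
    · intros; simp [gterm, h]
    · intros; simp; positivity
  · obtain ⟨W, h1, h2, h3⟩ := f_var a ha τ hτ (2 * Real.pi * (β + k)) (by positivity)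
    refine ⟨W, h1, ?_, ?_⟩
    · simpa [gterm, h] using h2
    · intro y₁ y₂
      refine (h3 y₁ y₂).trans ?_
      rw [← mul_assoc]
      gcongr ?_ * ?_
      apply Real.rpow_le_rpow_of_nonpos (by positivity) _ (by linarith)
      rw [abs_mul, abs_of_pos Real.two_pi_pos]
      nlinarith [Real.pi_gt_three, abs_nonneg (β + k)]

lemma Gs_var (a : ℝ) (ha : 1 ≤ a) (τ : ℂ) (hτ : 0 < τ.re) (β : ℝ) :
    ∃ V : ℝ → ℝ, Monotone V ∧
      (∀ y₁ y₂ : ℝ, 0 < y₁ → y₁ ≤ y₂ →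
        ‖Gs a τ β y₂ - Gs a τ β y₁‖ ≤ V y₂ - V y₁) ∧
      (∀ y₁ y₂ : ℝ, V y₂ - V y₁ ≤ Real.Gamma (a+1) * ((a+1) * Real.pi * (‖τ‖ / τ.re) ^ (a+1) * Zb a β)) := by
  have hg : 0 < Real.Gamma (a+1) := Real.Gamma_pos_of_pos (by linarith)
  choose W h1 h2 h3 using gterm_var a ha τ hτ β
  have hb : Summable fun k : ℤ => (a+1) * Real.pi * (‖τ‖ / τ.re) ^ (a+1) * |β + k| ^ (-(a+1)) :=
    (Zb_summable a β (by linarith)).mul_left _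
  have hs : ∀ y, Summable fun k => W k y - W k 0 := by
    intro y
    refine Summable.of_norm_bounded hb (fun k => ?_)
    rw [Real.norm_eq_abs, abs_le]
    have := h3 k y 0
    have := h3 k 0 y
    constructor <;> linarith
  have hd : ∀ y₁ y₂, Summable fun k => W k y₂ - W k y₁ := by
    intro y₁ y₂
    exact ((hs y₂).sub (hs y₁)).congr (fun k => by ring)
  have hVd : ∀ y₁ y₂, ∑' k, (W k y₂ - W k 0) - ∑' k, (W k y₁ - W k 0) = ∑' k, (W k y₂ - W k y₁) := by
    intro y₁ y₂
    rw [← (hs y₂).tsum_sub (hs y₁)]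
    apply tsum_congr; intro k; ring
  refine ⟨fun y => Real.Gamma (a+1) * ∑' k, (W k y - W k 0), ?_, ?_, ?_⟩
  · intro x y hxy
    dsimp only
    gcongr ?_ * ?_
    exact (hs x).tsum_le_tsum (fun k => by have := h1 k hxy; linarith) (hs y)
  · intro y₁ y₂ hy hyy
    rw [← mul_sub, hVd, Gs, Gs, ← mul_sub, norm_mul, Complex.norm_real, Real.norm_of_nonneg hg.le,
      ← (gterm_summable a (by linarith) τ hτ β y₂).tsum_sub (gterm_summable a (by linarith) τ hτ β y₁)]
    gcongr
    exact tsum_of_norm_bounded (hd y₁ y₂).hasSum (fun k => h2 k y₁ y₂ hy hyy)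
  · intro y₁ y₂
    rw [← mul_sub, hVd]
    gcongr
    rw [Zb, ← tsum_mul_left]
    exact (hd y₁ y₂).tsum_le_tsum (fun k => h3 k y₁ y₂) hb

lemma lam_G (a : ℝ) (ha : 0 < a) (τ : ℂ) (hτ : 0 < τ.re) (β y : ℝ) (hy : 0 < y) :
    Lam a (y * τ + 2 * Real.pi * I * β) =
      Gs a τ β y + iot β * (Real.Gamma (a+1) * (y * τ) ^ (-(a+1 : ℝ) : ℂ)) := by
  have hre : 0 < ((y:ℂ) * τ + 2 * Real.pi * I * β).re := by simp; positivity
  rw [lipschitz a (by linarith) _ hre, tsum_mul_left, Gs, iot]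
  have e : ∀ k : ℤ, (y:ℂ) * τ + 2 * Real.pi * I * β + 2 * Real.pi * I * k =
      y * τ + I * (2 * Real.pi * (β + k) : ℝ) := by
    intro k; push_cast; ring
  simp_rw [e]
  split_ifs with h
  · obtain ⟨k0, hk0⟩ := h
    have : ∀ k : ℤ, (y * τ + I * (2 * Real.pi * (β + k) : ℝ)) ^ (-(a+1 : ℝ) : ℂ) =
        gterm a τ β y k + (if k = k0 then (y * τ) ^ (-(a+1 : ℝ) : ℂ) else 0) := by
      intro k
      unfold gterm
      by_cases hk : k = k0
      · subst hk; simp [hk0]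
      · have : ¬ (β + k = 0) := by
          intro h'; apply hk
          have : (k:ℝ) = k0 := by linarith
          exact_mod_cast this
        simp [hk, this]
    simp_rw [this]
    rw [Summable.tsum_add (gterm_summable a ha τ hτ β y)
      (summable_of_ne_finset_zero (s := {k0}) (by intro b hb; simp at hb; simp [hb])), tsum_ite_eq]
    ring
  · simp only [zero_mul, add_zero]
    congr 1
    apply tsum_congr
    intro k
    have : ¬ (β + k = 0) := fun h' => h ⟨k, h'⟩
    simp [gterm, this]

lemma Hs_deriv (a : ℝ) (ha : 1 ≤ a) (τ : ℂ) (hτ : 0 < τ.re) (β y : ℝ) (hy : 0 < y) :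
    HasDerivAt (Hs a τ β) (-(τ * Gs a τ β y)) y := by
  have hre : 0 < ((y:ℂ) * τ + 2 * Real.pi * I * β).re := by simp; positivity
  have h0 : HasDerivAt (fun y : ℂ => y * τ + 2 * Real.pi * I * β) τ (y:ℂ) := by
    simpa using ((hasDerivAt_id' (y:ℂ)).mul_const τ).add_const (2 * Real.pi * I * β)
  have h1 := ((lam_deriv (a-1) _ hre).comp (y:ℂ) h0).comp_ofReal
  have h2 := (f_deriv_real a τ hτ 0 (by simp) y hy).const_mul (iot β * Real.Gamma a)
  have h3 := h1.sub h2
  have hG : (Real.Gamma (a+1) : ℂ) = a * Real.Gamma a := by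
    rw [Real.Gamma_add_one (by linarith)]; push_cast; rfl
  have h4 : HasDerivAt (Hs a τ β) (-Lam (a-1+1) ((y:ℂ) * τ + 2 * Real.pi * I * β) * τ -
      iot β * Real.Gamma a * (-(a:ℂ) * (y * τ + 0) ^ (-(a+1 : ℝ) : ℂ) * τ)) y := by
    refine h3.congr_of_eventuallyEq ?_
    filter_upwards with x
    simp [Hs, Function.comp, mul_assoc]
  refine h4.congr_deriv ?_
  rw [sub_add_cancel, lam_G a (by linarith) τ hτ β y hy, hG, add_zero]
  ring

lemma key_step (a : ℝ) (ha : 1 ≤ a) (τ : ℂ) (hτ : 0 < τ.re) (β y q : ℝ) (hy : 0 < y) (hq : 0 < q)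
    (D : ℝ) (hD : ∀ x ∈ Icc y (y+q), ‖Gs a τ β x - Gs a τ β y‖ ≤ D) :
    ‖q * Gs a τ β y - (Hs a τ β y - Hs a τ β (y+q)) / τ‖ ≤ q * D := by
  have h0 : τ ≠ 0 := by rintro rfl; simp at hτ
  have key := norm_image_sub_le_of_norm_deriv_le_segment' (a := y) (b := y + q)
    (f := fun x : ℝ => (x:ℂ) * Gs a τ β y + Hs a τ β x / τ)
    (f' := fun x => Gs a τ β y + (-(τ * Gs a τ β x)) / τ) (C := D) ?_ ?_ (y+q) ⟨by linarith, le_refl _⟩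
  · have e : ((y+q:ℝ):ℂ) * Gs a τ β y + Hs a τ β (y+q) / τ - (y * Gs a τ β y + Hs a τ β y / τ) =
      q * Gs a τ β y - (Hs a τ β y - Hs a τ β (y+q)) / τ := by push_cast; ring
    rw [e] at key
    refine key.trans (le_of_eq (by ring))
  · intro x hx
    have hx0 : 0 < x := by linarith [hx.1]
    have h1 : HasDerivAt (fun x : ℝ => (x:ℂ) * Gs a τ β y) (Gs a τ β y) x := by
      simpa using ((hasDerivAt_id' (x:ℂ)).mul_const (Gs a τ β y)).comp_ofReal
    exact (h1.add ((Hs_deriv a ha τ hτ β x hx0).div_const τ)).hasDerivWithinAt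
  · intro x hx
    have := hD x ⟨hx.1, hx.2.le⟩
    rw [norm_sub_rev] at this
    have e : Gs a τ β y + (-(τ * Gs a τ β x)) / τ = Gs a τ β y - Gs a τ β x := by
      field_simp; ring
    rw [e]; exact this

lemma key_start (a : ℝ) (ha : 1 ≤ a) (τ : ℂ) (hτ : 0 < τ.re) (β δ v : ℝ) (hδ : 0 < δ) (hv : δ ≤ v) :
    ‖(Hs a τ β δ - Hs a τ β v) / τ‖ ≤ v * (Real.Gamma (a+1) * ((‖τ‖ / τ.re) ^ (a+1) * Zb a β)) := by
  have h0 : τ ≠ 0 := by rintro rfl; simp at hτ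
  have key := norm_image_sub_le_of_norm_deriv_le_segment' (a := δ) (b := v)
    (f := fun x : ℝ => Hs a τ β x / τ)
    (f' := fun x => (-(τ * Gs a τ β x)) / τ)
    (C := (Real.Gamma (a+1) * ((‖τ‖ / τ.re) ^ (a+1) * Zb a β))) ?_ ?_ v ⟨hv, le_refl _⟩
  · have hC := (norm_nonneg _).trans (Gs_bound a (by linarith) τ hτ β v)
    rw [sub_div, norm_sub_rev]
    refine key.trans ?_
    nlinarith
  · intro x hx
    have hx0 : 0 < x := by linarith [hx.1]
    exact ((Hs_deriv a ha τ hτ β x hx0).div_const τ).hasDerivWithinAt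
  · intro x hx
    have e : (-(τ * Gs a τ β x)) / τ = - Gs a τ β x := by
      field_simp
    rw [e, norm_neg]; exact Gs_bound a (by linarith) τ hτ β x

lemma key_fin (a : ℝ) (ha : 1 ≤ a) (τ : ℂ) (hτ : 0 < τ.re) (β δ v q : ℝ) (hδ : 0 < δ) (hv : δ ≤ v)
    (hvq : v ≤ q) (M : ℕ) :
    ‖q * ∑ j ∈ Finset.range M, Gs a τ β (v + j * q) - (Hs a τ β δ - Hs a τ β (v + M * q)) / τ‖ ≤
      q * (Real.Gamma (a+1) * ((a+1) * Real.pi + 1) * (‖τ‖ / τ.re) ^ (a+1) * Zb a β) := by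
  have hq : 0 < q := by linarith
  have hv0 : 0 < v := by linarith
  obtain ⟨V, h1, h2, h3⟩ := Gs_var a ha τ hτ β
  have hst := key_start a ha τ hτ β δ v hδ hv
  have hC := (norm_nonneg _).trans (Gs_bound a (by linarith) τ hτ β v)
  have ind : ∀ M : ℕ, ‖q * ∑ j ∈ Finset.range M, Gs a τ β (v + j * q) - (Hs a τ β δ - Hs a τ β (v + M * q)) / τ‖ ≤
      ‖(Hs a τ β δ - Hs a τ β v) / τ‖ + q * (V (v + M * q) - V v) := by
    intro M
    induction M with
    | zero => simp
    | succ M ih =>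
      have hy : 0 < v + M * q := by positivity
      have st := key_step a ha τ hτ β (v + M * q) q hy hq (V (v + M * q + q) - V (v + M * q)) (by
        intro x hx
        refine (h2 _ _ hy hx.1).trans ?_
        have := h1 hx.2
        linarith)
      have e : v + ((M+1:ℕ):ℝ) * q = v + M * q + q := by push_cast; ring
      rw [e, Finset.sum_range_succ]
      have e2 : (q:ℂ) * (∑ j ∈ Finset.range M, Gs a τ β (v + j * q) + Gs a τ β (v + M * q)) -
          (Hs a τ β δ - Hs a τ β (v + M * q + q)) / τ =
          (q * ∑ j ∈ Finset.range M, Gs a τ β (v + j * q) - (Hs a τ β δ - Hs a τ β (v + M * q)) / τ) +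
          (q * Gs a τ β (v + M * q) - (Hs a τ β (v + M * q) - Hs a τ β (v + M * q + q)) / τ) := by ring
      rw [e2]
      refine (norm_add_le _ _).trans ?_
      linarith
  refine (ind M).trans ?_
  have := h3 v (v + M * q)
  calc _ ≤ q * (Real.Gamma (a+1) * ((‖τ‖ / τ.re) ^ (a+1) * Zb a β)) +
      q * (Real.Gamma (a+1) * ((a+1) * Real.pi * (‖τ‖ / τ.re) ^ (a+1) * Zb a β)) := by
        gcongr
        refine hst.trans ?_
        gcongr
    _ = _ := by ring

lemma lam_seq_bound (c : ℝ) (τ : ℂ) (hτ : 0 < τ.re) (β v q : ℝ) (hv : 0 < v) (hq : 0 < q) :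
    ∃ K : ℝ, ∀ j : ℕ, ‖Lam c (((v + j * q : ℝ):ℂ) * τ + 2 * Real.pi * I * β)‖ ≤ K * (Real.exp (-(q * τ.re))) ^ j := by
  refine ⟨∑' d : ℕ+, (d:ℝ) ^ c * Real.exp (-(d * (v * τ.re))), fun j => ?_⟩
  have hre : (((v + j * q : ℝ):ℂ) * τ + 2 * Real.pi * I * β).re = (v + j * q) * τ.re := by simp
  have := lam_bound c (v * τ.re) (by positivity) (((v + j * q : ℝ):ℂ) * τ + 2 * Real.pi * I * β) (by
    rw [hre]; have : 0 ≤ j * q * τ.re := by positivity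
    linarith)
  rw [hre] at this
  rw [← Real.exp_nat_mul]
  refine this.trans (le_of_eq ?_)
  rw [mul_comm]
  congr 2; ring

lemma exp_q_lt (τ : ℂ) (hτ : 0 < τ.re) (q : ℝ) (hq : 0 < q) : Real.exp (-(q * τ.re)) < 1 := by
  rw [Real.exp_lt_one_iff]; have := mul_pos hq hτ; linarith

lemma lam_seq_summable (c : ℝ) (τ : ℂ) (hτ : 0 < τ.re) (β v q : ℝ) (hv : 0 < v) (hq : 0 < q) :
    Summable fun j : ℕ => Lam c (((v + j * q : ℝ):ℂ) * τ + 2 * Real.pi * I * β) := by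
  obtain ⟨K, hK⟩ := lam_seq_bound c τ hτ β v q hv hq
  exact Summable.of_norm_bounded ((summable_geometric_of_lt_one (Real.exp_nonneg _) (exp_q_lt τ hτ q hq)).mul_left K) hK

lemma pow_seq_summable (a : ℝ) (ha : 1 ≤ a) (τ : ℂ) (hτ : 0 < τ.re) (v q : ℝ) (hv : 0 < v) (hq : 0 < q) :
    Summable fun j : ℕ => (((v + j * q : ℝ):ℂ) * τ) ^ (-(a+1 : ℝ) : ℂ) := by
  have h0 : 0 < ‖τ‖ := by
    apply norm_pos_iff.mpr; rintro rfl; simp at hτ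
  have hs := ((Real.summable_one_div_nat_rpow (p := a+1)).mpr (by linarith))
  rw [← summable_nat_add_iff 1]
  have hs' := ((summable_nat_add_iff 1).mpr hs).mul_left ((q * ‖τ‖) ^ (-(a+1)))
  refine Summable.of_norm_bounded hs' (fun j => ?_)
  rw [← Complex.ofReal_neg, norm_cpow_real, one_div, ← Real.rpow_neg (by positivity),
    ← Real.mul_rpow (by positivity) (by positivity)]
  apply Real.rpow_le_rpow_of_nonpos (by positivity) _ (by linarith)
  rw [norm_mul, Complex.norm_real, Real.norm_of_nonneg (by positivity)]
  nlinarith [mul_pos hv h0]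

lemma Hs_lim (a : ℝ) (ha : 1 ≤ a) (τ : ℂ) (hτ : 0 < τ.re) (β v q : ℝ) (hv : 0 < v) (hq : 0 < q) :
    Tendsto (fun M : ℕ => Hs a τ β (v + M * q)) atTop (𝓝 0) := by
  have h0 : 0 < ‖τ‖ := by
    apply norm_pos_iff.mpr; rintro rfl; simp at hτ
  have h1 := (lam_seq_summable (a-1) τ hτ β v q hv hq).tendsto_atTop_zero
  have h2 : Tendsto (fun M : ℕ => (((v + M * q : ℝ):ℂ) * τ) ^ (-(a : ℝ) : ℂ)) atTop (𝓝 0) := by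
    rw [tendsto_zero_iff_norm_tendsto_zero]
    have e : ∀ M : ℕ, ‖(((v + M * q : ℝ):ℂ) * τ) ^ (-(a : ℝ) : ℂ)‖ = ((v + M * q) * ‖τ‖) ^ (-a) := by
      intro M
      rw [← Complex.ofReal_neg, norm_cpow_real, norm_mul, Complex.norm_real, Real.norm_of_nonneg (by positivity)]
    simp_rw [e]
    refine (tendsto_rpow_neg_atTop (y := a) (by linarith)).comp ?_
    apply Tendsto.atTop_mul_const h0
    apply tendsto_atTop_add_const_left
    exact tendsto_natCast_atTop_atTop.atTop_mul_const hq
  have h3 := h1.sub ((h2.const_mul (Real.Gamma a : ℂ)).const_mul (iot β))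
  simpa [Hs] using h3

lemma key_inf (a : ℝ) (ha : 1 ≤ a) (τ : ℂ) (hτ : 0 < τ.re) (β δ v q : ℝ) (hδ : 0 < δ) (hv : δ ≤ v)
    (hvq : v ≤ q) :
    ‖q * (∑' j : ℕ, Lam a (((v + j * q : ℝ):ℂ) * τ + 2 * Real.pi * I * β) -
        iot β * (Real.Gamma (a+1) * ∑' j : ℕ, (((v + j * q : ℝ):ℂ) * τ) ^ (-(a+1 : ℝ) : ℂ))) - Hs a τ β δ / τ‖ ≤
      q * (Real.Gamma (a+1) * ((a+1) * Real.pi + 1) * (‖τ‖ / τ.re) ^ (a+1) * Zb a β) := by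
  have hq : 0 < q := by linarith
  have hv0 : 0 < v := by linarith
  have hs1 := (lam_seq_summable a τ hτ β v q hv0 hq).hasSum
  have hs2 := ((pow_seq_summable a ha τ hτ v q hv0 hq).hasSum.mul_left (Real.Gamma (a+1) : ℂ)).mul_left (iot β)
  have hs3 := (hs1.sub hs2).tendsto_sum_nat
  have e : ∀ j : ℕ, Lam a (((v + j * q : ℝ):ℂ) * τ + 2 * Real.pi * I * β) -
      iot β * (Real.Gamma (a+1) * (((v + j * q : ℝ):ℂ) * τ) ^ (-(a+1 : ℝ) : ℂ)) = Gs a τ β (v + j * q) := by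
    intro j
    rw [lam_G a (by linarith) τ hτ β (v + j * q) (by positivity)]; ring
  simp_rw [e] at hs3
  have hl := ((hs3.const_mul (q:ℂ)).sub (((tendsto_const_nhds (x := Hs a τ β δ)).sub (Hs_lim a ha τ hτ β v q hv0 hq)).div_const τ)).norm
  rw [sub_zero] at hl
  exact le_of_tendsto' hl (fun M => key_fin a ha τ hτ β δ v q hδ hv hvq M)

lemma real_mul_cpow (x : ℝ) (hx : 0 < x) (z : ℂ) (hz : z ≠ 0) (p : ℝ) :
    ((x:ℂ) * z) ^ (p:ℂ) = ((x ^ p : ℝ) : ℂ) * z ^ (p:ℂ) := by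
  have hx' : (x:ℂ) ≠ 0 := by exact_mod_cast hx.ne'
  rw [Complex.ofReal_cpow hx.le, Complex.cpow_def_of_ne_zero (mul_ne_zero hx' hz), Complex.cpow_def_of_ne_zero hx',
    Complex.cpow_def_of_ne_zero hz, Complex.log_ofReal_mul hx hz, ← Complex.exp_add, Complex.ofReal_log hx.le]
  ring_nf

lemma iot_zero : iot 0 = 1 := by
  unfold iot
  rw [if_pos ⟨0, by simp⟩]

lemma h_lim_gt (a : ℝ) (ha : 1 < a) (τ : ℂ) (hτ : 0 < τ.re) :
    Tendsto (fun y : ℝ => Lam (a-1) (y * τ) - Real.Gamma a * (y * τ) ^ (-(a:ℝ) : ℂ)) (𝓝[>] 0)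
      (𝓝 (riemannZeta (1 - a))) := by
  have h1 : Tendsto (fun y : ℝ => Gs (a-1) τ 0 y) (𝓝[>] 0)
      (𝓝 ((Real.Gamma (a-1+1) : ℂ) * ∑' k : ℤ, gterm (a-1) τ 0 0 k)) := by
    unfold Gs
    apply Tendsto.const_mul
    apply tendsto_tsum_of_dominated_convergence ((Zb_summable (a-1) 0 (by linarith)).mul_left _)
    · intro k
      unfold gterm
      by_cases hk : (0:ℝ) + k = 0
      · simp only [hk, if_true]; exact tendsto_const_nhds
      · simp only [hk, if_false]
        apply Tendsto.mono_left _ nhdsWithin_le_nhds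
        have hk' : (0:ℝ) + k ≠ 0 := hk
        have : ContinuousAt (fun y : ℝ => (y * τ + I * (2 * Real.pi * (0 + k) : ℝ)) ^ (-(a-1+1 : ℝ) : ℂ)) 0 := by
          refine ContinuousAt.cpow (by fun_prop) continuousAt_const ?_
          · right
            simp only [Complex.ofReal_zero, zero_mul, zero_add, Complex.mul_im, Complex.I_re, Complex.I_im,
              Complex.ofReal_re, Complex.ofReal_im, one_mul]
            have := Real.pi_pos
            have : (k:ℝ) ≠ 0 := by simpa using hk
            positivity
        exact this.tendsto
    · exact Eventually.of_forall (fun y k => gterm_bound (a-1) (by linarith) τ hτ 0 y k)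
  have h2 : (Real.Gamma (a-1+1) : ℂ) * ∑' k : ℤ, gterm (a-1) τ 0 0 k = riemannZeta (1 - a) := by
    rw [riemannZeta_one_sub, zeta_eq_tsum_one_div_nat_add_one_cpow (by simpa using ha)]
    · have hI : ∀ n : ℕ, gterm (a-1) τ 0 0 ((n:ℤ)+1) = (2 * Real.pi) ^ (-(a:ℂ)) * I ^ (-(a:ℂ)) * (1 / ((n:ℂ) + 1) ^ (a:ℂ)) := by
        intro n
        have hn : ¬ ((0:ℝ) + ((n:ℤ)+1 : ℤ) = 0) := by push_cast; positivity
        rw [gterm, if_neg hn]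
        have e : ((0:ℝ):ℂ) * τ + I * (2 * Real.pi * (0 + ((n:ℤ)+1 : ℤ)) : ℝ) = ((2 * Real.pi : ℝ):ℂ) * (((n+1:ℝ):ℂ) * I) := by
          push_cast; ring
        have e3 : (-(a - 1 + 1 : ℝ) : ℂ) = ((-a : ℝ):ℂ) := by push_cast; ring
        rw [e, e3, real_mul_cpow _ Real.two_pi_pos _ (mul_ne_zero (by exact_mod_cast (by positivity : (n:ℝ)+1 ≠ 0)) I_ne_zero),
          real_mul_cpow _ (by positivity) _ I_ne_zero, Complex.ofReal_cpow (by positivity), Complex.ofReal_cpow (by positivity)]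
        push_cast
        rw [Complex.cpow_neg (n+1:ℂ)]
        ring
      have hJ : ∀ n : ℕ, gterm (a-1) τ 0 0 (-((n:ℤ)+1)) = (2 * Real.pi) ^ (-(a:ℂ)) * (-I) ^ (-(a:ℂ)) * (1 / ((n:ℂ) + 1) ^ (a:ℂ)) := by
        intro n
        have hn : ¬ ((0:ℝ) + (-((n:ℤ)+1) : ℤ) = 0) := by
          have : (0:ℝ) < n + 1 := by positivity
          push_cast; intro h; linarith
        rw [gterm, if_neg hn]
        have e : ((0:ℝ):ℂ) * τ + I * (2 * Real.pi * (0 + (-((n:ℤ)+1) : ℤ)) : ℝ) = ((2 * Real.pi : ℝ):ℂ) * (((n+1:ℝ):ℂ) * (-I)) := by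
          push_cast; ring
        have e3 : (-(a - 1 + 1 : ℝ) : ℂ) = ((-a : ℝ):ℂ) := by push_cast; ring
        rw [e, e3, real_mul_cpow _ Real.two_pi_pos _ (mul_ne_zero (by exact_mod_cast (by positivity : (n:ℝ)+1 ≠ 0)) (neg_ne_zero.mpr I_ne_zero)),
          real_mul_cpow _ (by positivity) _ (neg_ne_zero.mpr I_ne_zero), Complex.ofReal_cpow (by positivity), Complex.ofReal_cpow (by positivity)]
        push_cast
        rw [Complex.cpow_neg (n+1:ℂ)]
        ring
      have hsum := gterm_summable (a-1) (by linarith) τ hτ 0 0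
      rw [tsum_of_add_one_of_neg_add_one]
      · simp_rw [hI, hJ]
        rw [tsum_mul_left, tsum_mul_left]
        have : gterm (a-1) τ 0 0 0 = 0 := by simp [gterm]
        rw [this, sub_add_cancel, Complex.Gamma_ofReal]
        have hc : 2 * Complex.cos (Real.pi * a / 2) = I ^ (-(a:ℂ)) + (-I) ^ (-(a:ℂ)) := by
          rw [Complex.two_cos, Complex.cpow_def_of_ne_zero I_ne_zero, Complex.cpow_def_of_ne_zero (neg_ne_zero.mpr I_ne_zero),
            Complex.log_I, Complex.log_neg_I, add_comm]
          ring_nf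
        linear_combination (-(2 * Real.pi : ℂ) ^ (-(a:ℂ)) * Real.Gamma a * (∑' n : ℕ, 1 / ((n:ℂ) + 1) ^ (a:ℂ))) * hc
      · exact hsum.comp_injective (i := fun n : ℕ => (n:ℤ)+1) (fun x y h => by simpa using h)
      · exact hsum.comp_injective (i := fun n : ℕ => -((n:ℤ)+1)) (fun x y h => by simpa using h)
    · intro n h
      have : a = -(n:ℝ) := by exact_mod_cast h
      have : (0:ℝ) ≤ n := by positivity
      linarith
    · intro h
      have : a = 1 := by exact_mod_cast h
      linarith
  rw [h2] at h1
  refine h1.congr' ?_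
  filter_upwards [self_mem_nhdsWithin] with y hy
  have := lam_G (a-1) (by linarith) τ hτ 0 y hy
  simp only [iot_zero, sub_add_cancel, one_mul, Complex.ofReal_zero, mul_zero, add_zero] at this
  rw [this]; ring

lemma lam_zero (s : ℂ) (hs : 0 < s.re) : Lam 0 s = (cexp s - 1)⁻¹ := by
  unfold Lam
  have h1 : ∀ d : ℕ+, (((d:ℝ) ^ (0:ℝ) : ℝ) : ℂ) * cexp (-((d:ℂ) * s)) = (cexp (-s)) ^ (d:ℕ) := by
    intro d
    rw [Real.rpow_zero, ← Complex.exp_nat_mul]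
    push_cast; ring_nf
  have hlt : ‖cexp (-s)‖ < 1 := by
    rw [Complex.norm_exp]; simpa using hs
  simp_rw [h1]
  rw [tsum_pnat_eq_tsum_succ (f := fun d => cexp (-s) ^ d)]
  simp_rw [pow_succ]
  rw [tsum_mul_right, tsum_geometric_of_norm_lt_one hlt]
  have hne : cexp s ≠ 0 := Complex.exp_ne_zero s
  have hne1 : cexp s - 1 ≠ 0 := by
    intro h
    have h2 : cexp s = 1 := by linear_combination h
    rw [Complex.exp_neg, h2] at hlt
    simp at hlt
  rw [Complex.exp_neg]
  have : 1 - (cexp s)⁻¹ ≠ 0 := by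
    intro h
    apply hne1
    field_simp at h
    simpa using h
  field_simp

lemma h_lim_one (τ : ℂ) (hτ : 0 < τ.re) :
    Tendsto (fun y : ℝ => Lam 0 (y * τ) - ((y * τ) : ℂ)⁻¹) (𝓝[>] 0) (𝓝 (-1/2)) := by
  have h0 : τ ≠ 0 := by rintro rfl; simp at hτ
  -- E1 s = (e^s - 1)/s -> 1 ; E2 s = (e^s-1-s)/s^2 -> 1/2
  have hE2 : Tendsto (fun s : ℂ => (cexp s - 1 - s) / s^2) (𝓝[≠] 0) (𝓝 (1/2)) := by
    rw [tendsto_iff_norm_sub_tendsto_zero]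
    have hlim : Tendsto (fun s : ℂ => ‖s‖) (𝓝[≠] 0) (𝓝 0) := by
      apply Tendsto.mono_left _ nhdsWithin_le_nhds
      simpa using (continuous_norm (E := ℂ)).tendsto 0
    refine squeeze_zero' (Eventually.of_forall fun _ => norm_nonneg _) ?_ hlim
    have hball : {s : ℂ | ‖s‖ < 1} ∈ 𝓝[≠] (0:ℂ) := by
      apply mem_nhdsWithin_of_mem_nhds
      exact (isOpen_lt continuous_norm continuous_const).mem_nhds (by simp)
    filter_upwards [self_mem_nhdsWithin, hball] with s hs hs1
    have hs' : s ≠ 0 := hs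
    have hb := Complex.exp_bound (x := s) (le_of_lt hs1) (n := 3) (by norm_num)
    have e : (cexp s - 1 - s) / s^2 - 1/2 = (cexp s - ∑ m ∈ Finset.range 3, s ^ m / (m.factorial : ℂ)) / s^2 := by
      simp [Finset.sum_range_succ, Nat.factorial]
      field_simp
      ring
    rw [e, norm_div, norm_pow]
    have hsn : 0 < ‖s‖ := norm_pos_iff.mpr hs'
    rw [div_le_iff₀ (by positivity)]
    refine hb.trans ?_
    have : ((Nat.succ 3 : ℕ):ℝ) * (((Nat.factorial 3 : ℕ):ℝ) * (3:ℕ))⁻¹ ≤ 1 := by norm_num [Nat.factorial]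
    calc _ ≤ ‖s‖^3 * 1 := by gcongr
      _ = _ := by ring
  have hE1 : Tendsto (fun s : ℂ => (cexp s - 1) / s) (𝓝[≠] 0) (𝓝 1) := by
    have := hasDerivAt_iff_tendsto_slope.mp (Complex.hasDerivAt_exp 0)
    simpa [slope_fun_def, div_eq_inv_mul] using this
  have hL : Tendsto (fun y : ℝ => (y:ℂ) * τ) (𝓝[>] 0) (𝓝[≠] 0) := by
    apply tendsto_nhdsWithin_of_tendsto_nhds_of_eventually_within
    · apply Tendsto.mono_left _ nhdsWithin_le_nhds
      have : Continuous (fun y : ℝ => (y:ℂ) * τ) := by fun_prop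
      simpa using this.tendsto 0
    · filter_upwards [self_mem_nhdsWithin] with y hy
      have : (y:ℂ) ≠ 0 := by exact_mod_cast (ne_of_gt hy)
      exact mul_ne_zero this h0
  have h3 := ((hE2.div hE1 one_ne_zero).neg).comp hL
  have e : -((1/2:ℂ)/1) = -1/2 := by norm_num
  rw [e] at h3
  refine h3.congr' ?_
  filter_upwards [self_mem_nhdsWithin] with y hy
  have hy0 : 0 < y := hy
  have hre : 0 < ((y:ℂ) * τ).re := by simp; positivity
  rw [lam_zero _ hre]
  simp only [Function.comp, Pi.div_apply]
  have hs0 : (y:ℂ) * τ ≠ 0 := by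
    intro h; rw [h] at hre; simp at hre
  have hne1 : cexp ((y:ℂ) * τ) - 1 ≠ 0 := by
    intro h
    have h2 : cexp ((y:ℂ) * τ) = 1 := by linear_combination h
    have h4 := congrArg norm h2
    rw [Complex.norm_exp, norm_one, Real.exp_eq_one_iff] at h4
    linarith
  generalize (y:ℂ) * τ = s at *
  field_simp
  ring

lemma h_lim (a : ℝ) (ha : 1 ≤ a) (τ : ℂ) (hτ : 0 < τ.re) :
    Tendsto (fun y : ℝ => Lam (a-1) (y * τ) - Real.Gamma a * (y * τ) ^ (-(a:ℝ) : ℂ)) (𝓝[>] 0)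
      (𝓝 (riemannZeta (1 - a))) := by
  rcases ha.lt_or_eq with h | h
  · exact h_lim_gt a h τ hτ
  · subst h
    have := h_lim_one τ hτ
    simp only [sub_self, Real.Gamma_one, Complex.ofReal_one, one_mul, riemannZeta_zero, Complex.cpow_neg_one]
    exact this

lemma lam_periodic (c : ℝ) (s : ℂ) (N : ℤ) : Lam c (s + 2 * Real.pi * I * N) = Lam c s := by
  unfold Lam
  apply tsum_congr
  intro d
  congr 1
  rw [Complex.exp_eq_exp_iff_exists_int]
  exact ⟨-(d * N), by push_cast; ring⟩

noncomputable def Fg (a : ℝ) (w : ℂ) : ℂ := ∑' m : ℕ, Lam a (((m:ℂ)+1) * w)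

lemma Fg_summable (a : ℝ) (w : ℂ) (hw : 0 < w.re) : Summable fun m : ℕ => Lam a (((m:ℂ)+1) * w) := by
  have := lam_seq_summable a w hw 0 1 1 one_pos one_pos
  refine this.congr (fun j => ?_)
  congr 1; push_cast; ring

lemma sum_zmod (q : ℕ) [NeZero q] (f : ℕ → ℂ) : ∑ j : ZMod q, f j.val = ∑ i ∈ Finset.range q, f i := by
  obtain ⟨n, rfl⟩ : ∃ n, q = n + 1 := Nat.exists_eq_succ_of_ne_zero (NeZero.ne q)
  exact Fin.sum_univ_eq_sum_range f (n+1)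

lemma Fg_split (a : ℝ) (τ : ℂ) (hτ : 0 < τ.re) (q : ℕ) (hq : 0 < q) (h : ℤ) :
    Fg a (τ + 2 * Real.pi * I * (h / q)) = ∑ i ∈ Finset.range q, ∑' j : ℕ,
      Lam a ((((i + 1 : ℝ) + j * q : ℝ):ℂ) * τ + 2 * Real.pi * I * ((i+1) * h / q : ℝ)) := by
  have : NeZero q := ⟨hq.ne'⟩
  have hqc : (q:ℂ) ≠ 0 := by exact_mod_cast hq.ne'
  unfold Fg
  have hre : 0 < (τ + 2 * Real.pi * I * (h / q)).re := by
    have : (2 * Real.pi * I * ((h:ℂ) / q)) = I * ((2 * Real.pi * (h / q) : ℝ)) := by push_cast; ring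
    rw [this]; simpa using hτ
  rw [Nat.sumByResidueClasses (Fg_summable a _ hre) q,
    sum_zmod q (fun i => ∑' m : ℕ, Lam a ((((i + q * m : ℕ):ℂ)+1) * (τ + 2 * Real.pi * I * (h / q))))]
  apply Finset.sum_congr rfl
  intro i _
  apply tsum_congr
  intro j
  rw [← lam_periodic a _ (-(j * h))]
  congr 1
  push_cast
  field_simp
  ring

lemma iot_val (q : ℕ) (hq : 0 < q) (h : ℤ) (hc : IsCoprime h (q:ℤ)) (i : ℕ) (hi : i < q) :
    iot ((i+1) * h / q) = if i + 1 = q then 1 else 0 := by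
  have hqr : (q:ℝ) ≠ 0 := by exact_mod_cast hq.ne'
  unfold iot
  congr 1
  apply propext
  constructor
  · rintro ⟨k, hk⟩
    have h1 : ((i:ℤ)+1) * h = q * (-k) := by
      have : ((i:ℝ)+1) * h = q * (-k) := by field_simp at hk; linarith
      exact_mod_cast this
    have h2 : (q:ℤ) ∣ ((i:ℤ)+1) * h := ⟨-k, h1⟩
    have h3 : (q:ℤ) ∣ (i:ℤ)+1 := hc.symm.dvd_of_dvd_mul_right h2
    have h4 : q ∣ i + 1 := by exact_mod_cast h3
    have := Nat.le_of_dvd (by omega) h4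
    omega
  · intro hh
    refine ⟨-h, ?_⟩
    have : (i:ℝ) + 1 = q := by exact_mod_cast hh
    rw [this]; push_cast; field_simp; ring

noncomputable def Z0 (a : ℝ) : ℝ := ∑' k : ℤ, |(k:ℝ)| ^ (-(a+1))

lemma Z0_summable (a : ℝ) (ha : 0 < a) : Summable fun k : ℤ => |(k:ℝ)| ^ (-(a+1)) := by
  have := Zb_summable a 0 ha
  simpa using this

lemma Zb_sum (a : ℝ) (ha : 0 < a) (q : ℕ) (hq : 0 < q) (h : ℤ) (hc : IsCoprime h (q:ℤ)) :
    ∑ i ∈ Finset.range q, Zb a ((i+1) * h / q) ≤ (q:ℝ) ^ (a+1) * Z0 a := by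
  have hqr : (0:ℝ) < q := by exact_mod_cast hq
  have hqz : (q:ℤ) ≠ 0 := by exact_mod_cast hq.ne'
  have e : ∀ (i : ℕ) (k : ℤ), |((i:ℝ)+1) * h / q + k| ^ (-(a+1)) =
      (q:ℝ) ^ (a+1) * |((((i:ℤ)+1) * h + q * k : ℤ):ℝ)| ^ (-(a+1)) := by
    intro i k
    have : ((i:ℝ)+1) * h / q + k = ((((i:ℤ)+1) * h + q * k : ℤ):ℝ) / q := by
      push_cast; field_simp
    rw [this, abs_div, abs_of_pos hqr, Real.div_rpow (abs_nonneg _) hqr.le, Real.rpow_neg hqr.le,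
      div_inv_eq_mul, mul_comm]
  unfold Zb
  simp_rw [e, tsum_mul_left]
  rw [← Finset.mul_sum]
  gcongr
  have hs := Z0_summable a ha
  let φ : (Finset.range q) × ℤ → ℤ := fun p => ((p.1:ℕ):ℤ) * h + h + q * p.2
  have hφ : Function.Injective φ := by
    rintro ⟨⟨i, hi⟩, k⟩ ⟨⟨j, hj⟩, l⟩ hh
    simp only [φ] at hh
    have hi' := Finset.mem_range.mp hi
    have hj' := Finset.mem_range.mp hj
    have h2 : (q:ℤ) ∣ ((i:ℤ) - j) * h := ⟨l - k, by linear_combination hh⟩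
    have h3 : (q:ℤ) ∣ (i:ℤ) - j := hc.symm.dvd_of_dvd_mul_right h2
    have h4 : (i:ℤ) - j = 0 := by
      apply Int.eq_zero_of_abs_lt_dvd h3
      rw [abs_lt]; constructor <;> omega
    have hij : i = j := by omega
    subst hij
    have : (q:ℤ) * k = q * l := by linear_combination hh
    have := mul_left_cancel₀ hqz this
    subst this; rfl
  have hsφ := hs.comp_injective hφ
  have h1 : ∑' p : (Finset.range q) × ℤ, |((φ p : ℤ):ℝ)| ^ (-(a+1)) ≤ Z0 a :=
    tsum_comp_le_tsum_of_inj hs (fun k => by positivity) hφ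
  refine le_trans (le_of_eq ?_) h1
  have h2 := hsφ.tsum_prod
  simp only [Function.comp] at h2
  rw [h2, tsum_fintype, ← Finset.sum_coe_sort]
  apply Finset.sum_congr rfl
  intro i _
  apply tsum_congr
  intro k
  simp only [φ]
  congr 4
  ring

lemma orth (q : ℕ) (hq : 0 < q) (h : ℤ) (hc : IsCoprime h (q:ℤ)) (d : ℕ) :
    ∑ i ∈ Finset.range q, cexp (-((d:ℂ) * (2 * Real.pi * I * (((i+1) * h / q : ℝ):ℂ)))) = if q ∣ d then (q:ℂ) else 0 := by
  have hqc : (q:ℂ) ≠ 0 := by exact_mod_cast hq.ne'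
  set z := cexp (-((d:ℂ) * (2 * Real.pi * I * (h / q)))) with hz
  have e : ∀ i : ℕ, cexp (-((d:ℂ) * (2 * Real.pi * I * (((i+1) * h / q : ℝ):ℂ)))) = z * z ^ i := by
    intro i
    rw [hz, ← Complex.exp_nat_mul, ← Complex.exp_add]
    congr 1; push_cast; field_simp; ring
  simp_rw [e]
  rw [← Finset.mul_sum]
  split_ifs with hd
  · obtain ⟨m, rfl⟩ := hd
    have : z = 1 := by
      rw [hz, Complex.exp_eq_one_iff]
      exact ⟨-(m * h), by push_cast; field_simp⟩
    simp [this]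
  · have hz1 : z ≠ 1 := by
      rw [hz]
      intro hh
      rw [Complex.exp_eq_one_iff] at hh
      obtain ⟨k, hk⟩ := hh
      apply hd
      have h1 : (d:ℂ) * h = q * (-k) := by
        have h2 : (2 * (Real.pi:ℂ) * I) * ((d:ℂ) * h) = (2 * Real.pi * I) * (q * (-k)) := by
          field_simp at hk
          linear_combination (-(2 * (Real.pi:ℂ) * I)) * hk
        exact mul_left_cancel₀ Complex.two_pi_I_ne_zero h2
      have h2 : (d:ℤ) * h = q * (-k) := by exact_mod_cast h1
      have h3 : (q:ℤ) ∣ d := hc.symm.dvd_of_dvd_mul_right ⟨-k, h2⟩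
      exact_mod_cast h3
    have hzq : z ^ q = 1 := by
      rw [hz, ← Complex.exp_nat_mul, Complex.exp_eq_one_iff]
      exact ⟨-(d * h), by push_cast; field_simp⟩
    rw [geom_sum_eq hz1, hzq]; simp

lemma lam_sum (c : ℝ) (s : ℂ) (hs : 0 < s.re) (q : ℕ) (hq : 0 < q) (h : ℤ) (hc : IsCoprime h (q:ℤ)) :
    ∑ i ∈ Finset.range q, Lam c (s + 2 * Real.pi * I * ((i+1) * h / q : ℝ)) =
      (((q:ℝ) ^ (c+1) : ℝ):ℂ) * Lam c (q * s) := by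
  have hqr : (0:ℝ) < q := by exact_mod_cast hq
  unfold Lam
  rw [← Summable.tsum_finsetSum]
  · have e : ∀ d : ℕ+, ∑ i ∈ Finset.range q, (((d:ℝ) ^ c : ℝ) : ℂ) * cexp (-((d:ℂ) * (s + 2 * Real.pi * I * ((i+1) * h / q : ℝ)))) =
      (((d:ℝ) ^ c : ℝ) : ℂ) * cexp (-((d:ℂ) * s)) * (if q ∣ (d:ℕ) then (q:ℂ) else 0) := by
      intro d
      rw [← orth q hq h hc d, Finset.mul_sum]
      apply Finset.sum_congr rfl
      intro i _
      rw [mul_assoc (((d:ℝ) ^ c : ℝ) : ℂ), ← Complex.exp_add]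
      congr 2; ring
    simp_rw [e]
    let qp : ℕ+ := ⟨q, hq⟩
    have hinj : Function.Injective (fun d : ℕ+ => qp * d) := mul_right_injective qp
    rw [← hinj.tsum_eq, ← tsum_mul_left]
    · apply tsum_congr
      intro d
      have hd : (0:ℝ) < d := by exact_mod_cast d.pos
      have e2 : ((qp * d : ℕ+) : ℕ) = q * d := rfl
      have e3 : ((qp * d : ℕ+) : ℂ) = q * d := by
        rw [← Nat.cast_mul, ← e2]
      have e4 : (((qp * d : ℕ+) : ℕ) : ℝ) = q * d := by
        rw [e2]; push_cast; rfl
      rw [e4, e3, Real.mul_rpow hqr.le hd.le, Real.rpow_add hqr, Real.rpow_one, e2, if_pos (dvd_mul_right _ _)]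
      push_cast
      ring_nf
    · intro d hd
      have : q ∣ (d:ℕ) := by
        by_contra hcon
        simp [hcon] at hd
      obtain ⟨m, hm⟩ := this
      have hm0 : 0 < m := by
        rcases Nat.eq_zero_or_pos m with h0 | h0
        · subst h0; have := d.pos; omega
        · exact h0
      refine ⟨⟨m, hm0⟩, ?_⟩
      apply PNat.coe_injective
      rw [hm]; rfl
  · intro i _
    apply lam_summable
    simpa using hs

lemma pow_tsum (a : ℝ) (ha : 1 ≤ a) (τ : ℂ) (hτ : 0 < τ.re) (q : ℕ) (hq : 0 < q) :
    ∑' j : ℕ, (((q + j * q : ℝ):ℂ) * τ) ^ (-(a+1 : ℝ) : ℂ) = riemannZeta (a+1) * (q * τ) ^ (-(a+1 : ℝ) : ℂ) := by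
  have hqr : (0:ℝ) < q := by exact_mod_cast hq
  have h0 : τ ≠ 0 := by rintro rfl; simp at hτ
  have hqt : (q:ℂ) * τ ≠ 0 := mul_ne_zero (by exact_mod_cast hq.ne') h0
  rw [zeta_eq_tsum_one_div_nat_add_one_cpow (by simp; linarith), ← tsum_mul_right]
  apply tsum_congr
  intro j
  have e : (((q + j * q : ℝ):ℂ) * τ) = ((j + 1 : ℝ):ℂ) * (q * τ) := by push_cast; ring
  rw [e, ← Complex.ofReal_neg, real_mul_cpow _ (by positivity) _ hqt, Complex.ofReal_cpow (by positivity)]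
  push_cast
  rw [Complex.cpow_neg (j+1:ℂ)]
  ring

lemma Hs_sum (a : ℝ) (τ : ℂ) (hτ : 0 < τ.re) (δ : ℝ) (hδ : 0 < δ) (q : ℕ) (hq : 0 < q)
    (h : ℤ) (hc : IsCoprime h (q:ℤ)) :
    ∑ i ∈ Finset.range q, Hs a τ ((i+1) * h / q) δ =
      (((q:ℝ) ^ a : ℝ):ℂ) * (Lam (a-1) (δ * (q * τ)) - Real.Gamma a * (δ * (q * τ)) ^ (-(a:ℝ) : ℂ)) := by
  have hqr : (0:ℝ) < q := by exact_mod_cast hq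
  have h0 : τ ≠ 0 := by rintro rfl; simp at hτ
  have hδc : (δ:ℂ) ≠ 0 := by exact_mod_cast hδ.ne'
  unfold Hs
  rw [Finset.sum_sub_distrib, lam_sum (a-1) (δ * τ) (by simp; positivity) q hq h hc, sub_add_cancel, mul_sub,
    ← Finset.sum_mul]
  have e1 : ∑ i ∈ Finset.range q, iot ((i+1) * h / q) = 1 := by
    rw [Finset.sum_congr rfl (fun i hi => iot_val q hq h hc i (Finset.mem_range.mp hi)),
      Finset.sum_eq_single (q-1)]
    · rw [if_pos (by omega)]
    · intro i hi hne
      rw [if_neg (by omega)]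
    · intro hh; exact absurd (Finset.mem_range.mpr (by omega)) hh
  rw [e1]
  have e2 : (q:ℂ) * (δ * τ) = δ * (q * τ) := by ring
  have e3 : ((δ:ℂ) * (q * τ)) ^ (-(a:ℝ) : ℂ) = (((q:ℝ) ^ (-a) : ℝ):ℂ) * (δ * τ) ^ (-(a:ℝ) : ℂ) := by
    rw [← e2, ← Complex.ofReal_neg, ← Complex.ofReal_natCast, real_mul_cpow _ hqr _ (mul_ne_zero hδc h0)]
  have e4 : (((q:ℝ) ^ a : ℝ):ℂ) * (((q:ℝ) ^ (-a) : ℝ):ℂ) = 1 := by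
    rw [← Complex.ofReal_mul, ← Real.rpow_add hqr]; simp
  rw [e2, e3]
  linear_combination (-(Real.Gamma a : ℂ) * (δ * τ) ^ (-(a:ℝ) : ℂ)) * e4 * (-1)

theorem key_lemma (a : ℝ) (ha : 1 ≤ a) : ∃ C : ℝ, 0 ≤ C ∧ ∀ τ : ℂ, 0 < τ.re → ∀ q : ℕ, 0 < q → ∀ h : ℤ,
    IsCoprime h (q:ℤ) →
    ‖Fg a (τ + 2 * Real.pi * I * (h / q)) - Real.Gamma (a+1) * riemannZeta (a+1) * (q * τ) ^ (-(a+1 : ℝ) : ℂ)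
      - riemannZeta (1 - a) * ((q:ℝ) ^ (a-1) : ℝ) / τ‖ ≤ C * (q * (‖τ‖ / τ.re)) ^ (a+1) := by
  have hg : 0 < Real.Gamma (a+1) := Real.Gamma_pos_of_pos (by linarith)
  have hZ : 0 ≤ Z0 a := tsum_nonneg (fun k => by positivity)
  refine ⟨Real.Gamma (a+1) * ((a+1) * Real.pi + 1) * Z0 a, by positivity, ?_⟩
  intro τ hτ q hq h hc
  have hqr : (0:ℝ) < q := by exact_mod_cast hq
  have hqc : (q:ℂ) ≠ 0 := by exact_mod_cast hq.ne'
  have h0 : τ ≠ 0 := by rintro rfl; simp at hτ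
  set T := ‖τ‖ / τ.re with hT
  have hTpos : 0 < T := by have := norm_pos_iff.mpr h0; positivity
  set X := Fg a (τ + 2 * Real.pi * I * (h / q)) - Real.Gamma (a+1) * riemannZeta (a+1) * (q * τ) ^ (-(a+1 : ℝ) : ℂ) with hX
  set K := Real.Gamma (a+1) * ((a+1) * Real.pi + 1) with hK
  have hKpos : 0 < K := by positivity
  have hfin : ∀ δ : ℝ, 0 < δ → δ ≤ 1 →
      ‖q * X - (((q:ℝ) ^ a : ℝ):ℂ) * (Lam (a-1) (δ * (q * τ)) - Real.Gamma a * (δ * (q * τ)) ^ (-(a:ℝ) : ℂ)) / τ‖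
        ≤ q * (K * T ^ (a+1) * ((q:ℝ) ^ (a+1) * Z0 a)) := by
    intro δ hδ hδ1
    rw [← Hs_sum a τ hτ δ hδ q hq h hc]
    have e : q * X - (∑ i ∈ Finset.range q, Hs a τ ((i+1) * h / q) δ) / τ = ∑ i ∈ Finset.range q,
        (q * (∑' j : ℕ, Lam a ((((i + 1 : ℝ) + j * q : ℝ):ℂ) * τ + 2 * Real.pi * I * ((i+1) * h / q : ℝ)) -
        iot ((i+1) * h / q) * (Real.Gamma (a+1) * ∑' j : ℕ, ((((i + 1 : ℝ) + j * q : ℝ):ℂ) * τ) ^ (-(a+1 : ℝ) : ℂ))) -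
          Hs a τ ((i+1) * h / q) δ / τ) := by
      rw [Finset.sum_sub_distrib, ← Finset.mul_sum, Finset.sum_sub_distrib, ← Fg_split a τ hτ q hq h, ← Finset.sum_div]
      congr 2
      rw [hX]
      congr 1
      rw [Finset.sum_congr rfl (fun i hi => by rw [iot_val q hq h hc i (Finset.mem_range.mp hi)]),
        Finset.sum_eq_single (q-1)]
      · rw [if_pos (by omega)]
        have : (((q-1 : ℕ):ℝ) + 1) = q := by
          rw [Nat.cast_sub (by omega)]; simp
        rw [this, pow_tsum a ha τ hτ q hq]
        ring
      · intro i hi hne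
        rw [if_neg (by omega), zero_mul]
      · intro hh; exact absurd (Finset.mem_range.mpr (by omega)) hh
    rw [e]
    refine (norm_sum_le _ _).trans ?_
    have hle : ∀ i ∈ Finset.range q, ‖(q * (∑' j : ℕ, Lam a ((((i + 1 : ℝ) + j * q : ℝ):ℂ) * τ + 2 * Real.pi * I * ((i+1) * h / q : ℝ)) -
        iot ((i+1) * h / q) * (Real.Gamma (a+1) * ∑' j : ℕ, ((((i + 1 : ℝ) + j * q : ℝ):ℂ) * τ) ^ (-(a+1 : ℝ) : ℂ))) -
          Hs a τ ((i+1) * h / q) δ / τ)‖ ≤ q * (K * T ^ (a+1) * Zb a ((i+1) * h / q)) := by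
      intro i hi
      have hi' : (i:ℝ) + 1 ≤ q := by exact_mod_cast Finset.mem_range.mp hi
      have hi0 : (0:ℝ) ≤ i := by positivity
      have := key_inf a ha τ hτ ((i+1) * h / q) δ (i+1) q hδ (by linarith) hi'
      simpa using this
    refine (Finset.sum_le_sum hle).trans ?_
    rw [← Finset.mul_sum, ← Finset.mul_sum]
    gcongr
    exact Zb_sum a (by linarith) q hq h hc
  have hlim := h_lim a ha (q * τ) (by simp; positivity)
  have hlim2 := ((tendsto_const_nhds (x := (q:ℂ) * X)).sub ((hlim.const_mul (((q:ℝ) ^ a : ℝ):ℂ)).div_const τ)).norm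
  have hfinal := le_of_tendsto hlim2 (by
    have : Ioc (0:ℝ) 1 ∈ 𝓝[>] (0:ℝ) := Ioc_mem_nhdsGT one_pos
    filter_upwards [this] with δ hδ
    exact hfin δ hδ.1 hδ.2)
  have e : (q:ℂ) * X - (((q:ℝ) ^ a : ℝ):ℂ) * riemannZeta (1 - a) / τ = q * (X - riemannZeta (1 - a) * ((q:ℝ) ^ (a-1) : ℝ) / τ) := by
    have : (((q:ℝ) ^ a : ℝ):ℂ) = q * ((q:ℝ) ^ (a-1) : ℝ) := by
      rw [Real.rpow_sub hqr, Real.rpow_one]; push_cast; field_simp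
    rw [this]; ring
  rw [e, norm_mul, Complex.norm_natCast] at hfinal
  have h5 := le_of_mul_le_mul_left hfinal hqr
  refine h5.trans (le_of_eq ?_)
  rw [Real.mul_rpow hqr.le hTpos.le]; ring

lemma sigmaR_zero (a : ℝ) : sigmaR a 0 = 0 := by simp [sigmaR]

lemma sigmaR_nonneg (a : ℝ) (n : ℕ) : 0 ≤ sigmaR a n := Finset.sum_nonneg (fun d _ => by positivity)

lemma sigmaR_le (a : ℝ) (ha : 0 ≤ a) (n : ℕ) : sigmaR a n ≤ (n:ℝ) ^ (a+1) := by
  rcases Nat.eq_zero_or_pos n with h | h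
  · subst h; rw [sigmaR_zero]; positivity
  have hn : (0:ℝ) < n := by exact_mod_cast h
  calc sigmaR a n ≤ ∑ d ∈ n.divisors, (n:ℝ) ^ a := by
        apply Finset.sum_le_sum
        intro d hd
        have : (d:ℝ) ≤ n := by exact_mod_cast Nat.divisor_le hd
        gcongr
    _ = (n.divisors.card : ℝ) * (n:ℝ) ^ a := by simp
    _ ≤ n * (n:ℝ) ^ a := by
        gcongr
        exact_mod_cast Nat.card_divisors_le_self n
    _ = _ := by rw [Real.rpow_add hn, Real.rpow_one]; ring

lemma sigma_summable (a : ℝ) (ha : 0 ≤ a) (r : ℝ) (hr : 0 < r) :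
    Summable fun k : ℕ+ => sigmaR a k * Real.exp (-(k * r)) := by
  refine Summable.of_nonneg_of_le (fun k => mul_nonneg (sigmaR_nonneg a k) (Real.exp_nonneg _)) (fun k => ?_)
    (lam_summable_real (a+1) r hr)
  have := sigmaR_le a ha k
  gcongr

lemma sum_antidiag {E : Type*} [AddCommMonoid E] (n : ℕ) (f : ℕ → E) :
    ∑ p : Nat.divisorsAntidiagonal n, f p.1.1 = ∑ d ∈ n.divisors, f d := by
  rw [Finset.sum_coe_sort (Nat.divisorsAntidiagonal n) (fun p => f p.1), ← Nat.map_div_right_divisors, Finset.sum_map]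
  rfl

lemma dbl_summable (a : ℝ) (ha : 0 ≤ a) (w : ℂ) (hw : 0 < w.re) :
    Summable fun p : ℕ+ × ℕ+ => (((p.1:ℝ) ^ a : ℝ) : ℂ) * cexp (-((p.1:ℂ) * (p.2 * w))) := by
  apply Summable.of_norm
  rw [← sigmaAntidiagonalEquivProd.summable_iff, summable_sigma_of_nonneg (fun p => by
    simp only [Function.comp]; exact norm_nonneg _)]
  refine ⟨fun k => (hasSum_fintype _).summable, ?_⟩
  refine (sigma_summable a ha w.re hw).congr (fun k => ?_)
  rw [tsum_fintype, sigmaR, ← sum_antidiag k (fun d => (d:ℝ) ^ a), Finset.sum_mul]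
  apply Finset.sum_congr rfl
  rintro ⟨⟨x, y⟩, hp⟩ _
  have hxy : (k:ℝ) = x * y := by
    have := (Nat.mem_divisorsAntidiagonal.mp hp).1
    rw [← this]; push_cast; rfl
  simp only [Function.comp, sigmaAntidiagonalEquivProd, divisorsAntidiagonalFactors, Equiv.coe_fn_mk, PNat.mk_coe]
  rw [norm_mul, Complex.norm_real, Complex.norm_exp, Real.norm_of_nonneg (by positivity), hxy]
  simp [mul_assoc]

lemma Fg_hasSum (a : ℝ) (ha : 0 ≤ a) (w : ℂ) (hw : 0 < w.re) :
    HasSum (fun k : ℕ => (sigmaR a k : ℂ) * cexp (-(k * w))) (Fg a w) := by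
  have hs := dbl_summable a ha w hw
  have h1 : Fg a w = ∑' p : ℕ+ × ℕ+, (((p.1:ℝ) ^ a : ℝ) : ℂ) * cexp (-((p.1:ℂ) * (p.2 * w))) := by
    have hsw := (Equiv.prodComm ℕ+ ℕ+).summable_iff.mpr hs
    have hpr := hsw.tsum_prod
    rw [← (Equiv.prodComm ℕ+ ℕ+).tsum_eq]
    simp only [Equiv.prodComm_apply, Prod.swap_prod_mk, Function.comp, Prod.fst_swap, Prod.snd_swap] at hpr ⊢
    rw [hpr]
    rw [tsum_pnat_eq_tsum_succ (f := fun m : ℕ => ∑' d : ℕ+, (((d:ℝ) ^ a : ℝ) : ℂ) * cexp (-((d:ℂ) * (m * w))))]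
    simp [Fg, Lam]
  have h2 := (sigmaAntidiagonalEquivProd.hasSum_iff.mpr hs.hasSum)
  rw [← h1] at h2
  have h3 := h2.sigma (fun k => hasSum_fintype _)
  rw [← PNat.coe_injective.hasSum_iff]
  · convert h3 using 2 with k
    simp only [Function.comp]
    rw [sigmaR, Complex.ofReal_sum, ← sum_antidiag k (fun d => (((d:ℝ) ^ a : ℝ):ℂ)), Finset.sum_mul]
    apply Finset.sum_congr rfl
    rintro ⟨⟨x, y⟩, hp⟩ _
    have hxy : (k:ℂ) = x * y := by
      have := (Nat.mem_divisorsAntidiagonal.mp hp).1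
      rw [← this]; push_cast; rfl
    simp only [sigmaAntidiagonalEquivProd, divisorsAntidiagonalFactors, Equiv.coe_fn_mk, PNat.mk_coe]
    rw [hxy, mul_assoc (x:ℂ)]
  · intro k hk
    have : k = 0 := by
      by_contra h
      exact hk ⟨⟨k, Nat.pos_of_ne_zero h⟩, rfl⟩
    rw [this, sigmaR_zero]; simp

lemma sigma_summable_nat (a : ℝ) (ha : 0 ≤ a) (r : ℝ) (hr : 0 < r) :
    Summable fun k : ℕ => sigmaR a k * Real.exp (-(k * r)) := by
  rw [← PNat.coe_injective.summable_iff]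
  · exact sigma_summable a ha r hr
  · intro k hk
    have : k = 0 := by
      by_contra h
      exact hk ⟨⟨k, Nat.pos_of_ne_zero h⟩, rfl⟩
    rw [this, sigmaR_zero]; simp

/-- the point on the circle -/
noncomputable def wpt (r x : ℝ) : ℂ := r + 2 * Real.pi * I * x

lemma wpt_re (r x : ℝ) : (wpt r x).re = r := by simp [wpt]

lemma int_exp (r c : ℝ) (N : ℤ) :
    ∫ x in Ioc c (c+1), cexp (N * wpt r x) = if N = 0 then 1 else 0 := by
  rw [← intervalIntegral.integral_of_le (by linarith)]
  split_ifs with h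
  · subst h; simp
  · have hc : (2 * Real.pi * I * N : ℂ) ≠ 0 := by
      apply mul_ne_zero Complex.two_pi_I_ne_zero; exact_mod_cast h
    have e : ∀ x : ℝ, cexp (N * wpt r x) = cexp (N * r) * cexp ((2 * Real.pi * I * N) * x) := by
      intro x
      rw [← Complex.exp_add, wpt]; ring_nf
    simp_rw [e]
    rw [intervalIntegral.integral_const_mul, integral_exp_mul_complex hc]
    have : cexp (2 * Real.pi * I * N * ((c+1:ℝ):ℂ)) = cexp (2 * Real.pi * I * N * (c:ℂ)) := by
      rw [Complex.exp_eq_exp_iff_exists_int]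
      exact ⟨N, by push_cast; ring⟩
    rw [this]; simp

lemma SR_antidiag (a b : ℝ) (n : ℕ) : SR a b n = ∑ p ∈ Finset.HasAntidiagonal.antidiagonal n, sigmaR a p.1 * sigmaR b p.2 := by
  rw [Finset.Nat.sum_antidiagonal_eq_sum_range_succ (fun i j => sigmaR a i * sigmaR b j), SR]
  apply Finset.sum_subset
  · intro k hk
    have := Finset.mem_Ico.mp hk
    exact Finset.mem_range.mpr (by omega)
  · intro k hk hk'
    have := Finset.mem_range.mp hk
    rw [Finset.mem_Ico] at hk'
    have : k = 0 ∨ k = n := by omega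
    rcases this with h | h
    · simp [h, sigmaR_zero]
    · simp [h, sigmaR_zero]

theorem SR_integral (a b : ℝ) (ha : 0 ≤ a) (hb : 0 ≤ b) (n : ℕ) (r c : ℝ) (hr : 0 < r) :
    (SR a b n : ℂ) = ∫ x in Ioc c (c+1), Fg a (wpt r x) * Fg b (wpt r x) * cexp (n * wpt r x) := by
  have hsa := sigma_summable_nat a ha r hr
  have hsb := sigma_summable_nat b hb r hr
  let F : ℕ × ℕ → ℝ → ℂ := fun p x => ((sigmaR a p.1 * sigmaR b p.2 : ℝ):ℂ) * cexp (((n:ℤ) - p.1 - p.2 : ℤ) * wpt r x)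
  have hnorm : ∀ p x, ‖F p x‖ = (sigmaR a p.1 * Real.exp (-(p.1 * r))) * (sigmaR b p.2 * Real.exp (-(p.2 * r))) * Real.exp (n * r) := by
    intro p x
    simp only [F]
    have hre : ((((n:ℤ) - p.1 - p.2 : ℤ):ℂ) * wpt r x).re = n * r + -(p.1 * r) + -(p.2 * r) := by
      rw [← Complex.ofReal_intCast, Complex.re_ofReal_mul, wpt_re]; push_cast; ring
    rw [norm_mul, Complex.norm_real, Complex.norm_exp, Real.norm_of_nonneg (mul_nonneg (sigmaR_nonneg _ _) (sigmaR_nonneg _ _)),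
      hre, Real.exp_add, Real.exp_add]
    ring
  have hsum : Summable fun p : ℕ × ℕ => (sigmaR a p.1 * Real.exp (-(p.1 * r))) * (sigmaR b p.2 * Real.exp (-(p.2 * r))) * Real.exp (n * r) := by
    apply Summable.mul_right
    exact hsa.mul_of_nonneg hsb (fun k => mul_nonneg (sigmaR_nonneg _ _) (Real.exp_nonneg _)) (fun k => mul_nonneg (sigmaR_nonneg _ _) (Real.exp_nonneg _))
  have hcont : ∀ p, Continuous (F p) := by
    intro p
    simp only [F, wpt]
    fun_prop
  have key := hasSum_integral_of_summable_integral_norm (μ := volume.restrict (Ioc c (c+1))) (F := F)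
    (fun p => ((hcont p).integrableOn_Icc.mono_set Ioc_subset_Icc_self)) (by
      simp_rw [hnorm]
      simpa using hsum)
  have e1 : ∀ x, ∑' p, F p x = Fg a (wpt r x) * Fg b (wpt r x) * cexp (n * wpt r x) := by
    intro x
    have hwre : 0 < (wpt r x).re := by rw [wpt_re]; exact hr
    have h1 := Fg_hasSum a ha _ hwre
    have h2 := Fg_hasSum b hb _ hwre
    have h3 := h1.mul h2 (by
      apply Summable.of_norm
      refine ((hsa.mul_of_nonneg hsb (fun k => mul_nonneg (sigmaR_nonneg _ _) (Real.exp_nonneg _)) (fun k => mul_nonneg (sigmaR_nonneg _ _) (Real.exp_nonneg _)))).congr ?_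
      intro p
      rw [norm_mul, norm_mul, norm_mul, Complex.norm_real, Complex.norm_real, Complex.norm_exp, Complex.norm_exp,
        Real.norm_of_nonneg (sigmaR_nonneg _ _), Real.norm_of_nonneg (sigmaR_nonneg _ _)]
      simp [wpt_re])
    rw [← (h3.mul_right (cexp (n * wpt r x))).tsum_eq]
    apply tsum_congr
    intro p
    simp only [F]
    have : (((n:ℤ) - p.1 - p.2 : ℤ):ℂ) * wpt r x = -(p.1 * wpt r x) + (-(p.2 * wpt r x)) + n * wpt r x := by
      push_cast; ring
    rw [this, Complex.exp_add, Complex.exp_add]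
    push_cast; ring
  simp_rw [e1] at key
  rw [← key.tsum_eq]
  have e2 : ∀ p : ℕ × ℕ, ∫ x in Ioc c (c+1), F p x = ((sigmaR a p.1 * sigmaR b p.2 : ℝ):ℂ) * (if (n:ℤ) - p.1 - p.2 = 0 then 1 else 0) := by
    intro p
    simp only [F]
    rw [integral_const_mul, int_exp]
  simp_rw [e2]
  rw [tsum_eq_sum (s := Finset.HasAntidiagonal.antidiagonal n), SR_antidiag]
  · push_cast
    apply Finset.sum_congr rfl
    intro p hp
    have := Finset.HasAntidiagonal.mem_antidiagonal.mp hp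
    rw [if_pos (by omega), mul_one]
  · intro p hp
    rw [Finset.HasAntidiagonal.mem_antidiagonal] at hp
    rw [if_neg (by omega), mul_zero]

def Hq (q : ℕ) : Finset ℕ := (Finset.Icc 1 q).filter (fun h => Nat.Coprime h q)

noncomputable def cq (q n : ℕ) : ℂ := ∑ h ∈ Hq q, cexp (n * (2 * Real.pi * I * (h / q)))

lemma Hq_card (q : ℕ) : (Hq q).card ≤ q := by
  refine (Finset.card_filter_le _ _).trans ?_
  simp

lemma cq_norm (q n : ℕ) : ‖cq q n‖ ≤ q := by
  have h1 : ∀ h ∈ Hq q, ‖cexp (n * (2 * Real.pi * I * ((h:ℂ) / q)))‖ ≤ 1 := by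
    intro h _
    have : (n:ℂ) * (2 * Real.pi * I * ((h:ℂ) / q)) = ((n * (2 * Real.pi * (h / q)) : ℝ):ℂ) * I := by push_cast; ring
    rw [this, Complex.norm_exp_ofReal_mul_I]
  refine (norm_sum_le_of_le _ h1).trans ?_
  simp only [Finset.sum_const, nsmul_eq_mul, mul_one]
  exact_mod_cast Hq_card q

lemma cq_sum (N n : ℕ) (hN : 0 < N) : ∑ q ∈ N.divisors, cq q n = if N ∣ n then (N:ℂ) else 0 := by
  have hc : IsCoprime (1:ℤ) (N:ℤ) := isCoprime_one_left
  have h1 : ∑ m ∈ Finset.Icc 1 N, cexp (n * (2 * Real.pi * I * (m / N))) = if N ∣ n then (N:ℂ) else 0 := by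
    have ho := orth N hN (-1) (by simpa using hc.neg_left) n
    rw [← ho, ← Finset.Ico_add_one_right_eq_Icc, Finset.sum_Ico_eq_sum_range, Nat.add_sub_cancel]
    apply Finset.sum_congr rfl
    intro m _
    push_cast; ring_nf
  rw [← h1]
  unfold cq
  rw [Finset.sum_sigma']
  refine Finset.sum_bij' (fun p _ => p.2 * (N / p.1)) (fun m _ => ⟨N / Nat.gcd m N, m / Nat.gcd m N⟩) ?_ ?_ ?_ ?_ ?_
  · rintro ⟨q, h⟩ hp
    simp only [Finset.mem_sigma, Nat.mem_divisors, Hq, Finset.mem_filter, Finset.mem_Icc] at hp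
    obtain ⟨⟨⟨k, rfl⟩, _⟩, ⟨hh1, hh2⟩, hcop⟩ := hp
    have hq0 : 0 < q := Nat.pos_of_mul_pos_right hN
    have hk0 : 0 < k := Nat.pos_of_mul_pos_left hN
    simp only [Nat.mul_div_cancel_left k hq0, Finset.mem_Icc]
    exact ⟨Nat.mul_pos hh1 hk0, Nat.mul_le_mul_right k hh2⟩
  · intro m hm
    simp only [Finset.mem_Icc] at hm
    have hg : 0 < Nat.gcd m N := Nat.gcd_pos_of_pos_right m hN
    simp only [Finset.mem_sigma, Nat.mem_divisors, Hq, Finset.mem_filter, Finset.mem_Icc]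
    refine ⟨⟨Nat.div_dvd_of_dvd (Nat.gcd_dvd_right m N), hN.ne'⟩, ⟨?_, Nat.div_le_div_right hm.2⟩, ?_⟩
    · exact Nat.div_pos (Nat.le_of_dvd (by omega) (Nat.gcd_dvd_left m N)) hg
    · exact Nat.coprime_div_gcd_div_gcd hg
  · rintro ⟨q, h⟩ hp
    simp only [Finset.mem_sigma, Nat.mem_divisors, Hq, Finset.mem_filter, Finset.mem_Icc] at hp
    obtain ⟨⟨⟨k, rfl⟩, _⟩, ⟨hh1, hh2⟩, hcop⟩ := hp
    have hq0 : 0 < q := Nat.pos_of_mul_pos_right hN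
    have hk0 : 0 < k := Nat.pos_of_mul_pos_left hN
    have : Nat.gcd (h * k) (q * k) = k := by
      rw [Nat.gcd_mul_right, hcop.gcd_eq_one, one_mul]
    simp only [Nat.mul_div_cancel_left k hq0, this, Nat.mul_div_cancel _ hk0]
  · intro m hm
    simp only [Finset.mem_Icc] at hm
    have hg : 0 < Nat.gcd m N := Nat.gcd_pos_of_pos_right m hN
    dsimp only
    rw [Nat.div_div_self (Nat.gcd_dvd_right m N) hN.ne', Nat.div_mul_cancel (Nat.gcd_dvd_left m N)]
  · rintro ⟨q, h⟩ hp
    simp only [Finset.mem_sigma, Nat.mem_divisors, Hq, Finset.mem_filter, Finset.mem_Icc] at hp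
    obtain ⟨⟨⟨k, rfl⟩, _⟩, ⟨hh1, hh2⟩, hcop⟩ := hp
    have hq0 : 0 < q := Nat.pos_of_mul_pos_right hN
    have hk0 : 0 < k := Nat.pos_of_mul_pos_left hN
    simp only [Nat.mul_div_cancel_left k hq0]
    have hqc : (q:ℂ) ≠ 0 := by exact_mod_cast hq0.ne'
    have hkc : (k:ℂ) ≠ 0 := by exact_mod_cast hk0.ne'
    push_cast
    congr 3
    field_simp

lemma pnat_rpow_summable (p : ℝ) (hp : p < -1) : Summable fun q : ℕ+ => (q:ℝ) ^ p := by
  have := (Real.summable_nat_rpow (p := p)).mpr hp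
  exact this.comp_injective PNat.coe_injective

lemma cq_bound (s : ℝ) (n : ℕ) (q : ℕ+) : ‖(((q:ℝ) ^ (-s) : ℝ):ℂ) * cq q n‖ ≤ (q:ℝ) ^ (1-s) := by
  have hq : (0:ℝ) < q := by exact_mod_cast q.pos
  rw [norm_mul, Complex.norm_real, Real.norm_of_nonneg (by positivity), sub_eq_add_neg, add_comm, Real.rpow_add hq, Real.rpow_one]
  gcongr
  exact cq_norm q n

lemma cq_summable (s : ℝ) (hs : 2 < s) (n : ℕ) : Summable fun q : ℕ+ => (((q:ℝ) ^ (-s) : ℝ):ℂ) * cq q n :=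
  Summable.of_norm_bounded (pnat_rpow_summable (1-s) (by linarith)) (cq_bound s n)

lemma zeta_pnat (s : ℝ) (hs : 1 < s) : HasSum (fun m : ℕ+ => (((m:ℝ) ^ (-s) : ℝ):ℂ)) (riemannZeta s) := by
  have h1 : Summable (fun m : ℕ+ => (((m:ℝ) ^ (-s) : ℝ):ℂ)) :=
    Complex.ofRealCLM.summable (pnat_rpow_summable (-s) (by linarith))
  convert h1.hasSum using 1
  rw [tsum_pnat_eq_tsum_succ (f := fun m : ℕ => (((m:ℝ) ^ (-s) : ℝ):ℂ)),
    zeta_eq_tsum_one_div_nat_add_one_cpow (by simpa using hs)]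
  apply tsum_congr
  intro m
  rw [Complex.ofReal_cpow (by positivity)]
  push_cast
  rw [Complex.cpow_neg, one_div]

lemma hasSum_div (f : ℕ → ℕ → ℂ) (A : ℂ) (h : HasSum (fun p : ℕ+ × ℕ+ => f p.1 p.2) A) :
    HasSum (fun N : ℕ+ => ∑ p ∈ Nat.divisorsAntidiagonal N, f p.1 p.2) A := by
  have h5 := (sigmaAntidiagonalEquivProd.hasSum_iff.mpr h).sigma (fun k => hasSum_fintype _)
  have e : (fun N : ℕ+ => ∑ p ∈ Nat.divisorsAntidiagonal N, f p.1 p.2) = fun N : ℕ+ =>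
      ∑ p : Nat.divisorsAntidiagonal N, ((fun p : ℕ+ × ℕ+ => f p.1 p.2) ∘ sigmaAntidiagonalEquivProd) ⟨N, p⟩ := by
    funext N
    rw [← Finset.sum_coe_sort]
    rfl
  rw [e]
  exact h5

lemma ram_h6 (s : ℝ) (n : ℕ) (N : ℕ+) : ∑ p ∈ Nat.divisorsAntidiagonal N, (((p.1:ℝ) ^ (-s) : ℝ):ℂ) * cq p.1 n * (((p.2:ℝ) ^ (-s) : ℝ):ℂ)
      = if (N:ℕ) ∣ n then (((N:ℝ) ^ (1-s) : ℝ):ℂ) else 0 := by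
  have hN : (0:ℝ) < N := by exact_mod_cast N.pos
  have : ∑ p ∈ Nat.divisorsAntidiagonal N, (((p.1:ℝ) ^ (-s) : ℝ):ℂ) * cq p.1 n * (((p.2:ℝ) ^ (-s) : ℝ):ℂ)
    = ∑ p ∈ Nat.divisorsAntidiagonal N, (((N:ℝ) ^ (-s) : ℝ):ℂ) * cq p.1 n := by
    apply Finset.sum_congr rfl
    rintro ⟨x, y⟩ hp
    have hxy : (N:ℝ) = x * y := by
      have := (Nat.mem_divisorsAntidiagonal.mp hp).1
      rw [← this]; push_cast; rfl
    rw [hxy, Real.mul_rpow (by positivity) (by positivity)]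
    push_cast; ring
  rw [this, ← Finset.sum_coe_sort, sum_antidiag N (fun q => (((N:ℝ) ^ (-s) : ℝ):ℂ) * cq q n), ← Finset.mul_sum, cq_sum N n N.pos]
  split_ifs
  · rw [sub_eq_add_neg, add_comm, Real.rpow_add hN, Real.rpow_one]; push_cast; rfl
  · simp

lemma ram_div (t : ℝ) (n : ℕ) (hn : 0 < n) :
    ∑' N : ℕ+, (if (N:ℕ) ∣ n then (((N:ℝ) ^ t : ℝ):ℂ) else 0) = ((sigmaR t n : ℝ):ℂ) := by
  rw [sigmaR]
  rw [tsum_pnat_eq_tsum_succ (f := fun N : ℕ => if N ∣ n then (((N:ℝ) ^ t : ℝ):ℂ) else 0), tsum_eq_sum (s := Finset.range n)]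
  · have e : n.divisors = (Finset.Ico 1 (n+1)).filter (fun d => d ∣ n) := by
      ext d
      simp only [Nat.mem_divisors, Finset.mem_filter, Finset.mem_Ico]
      constructor
      · rintro ⟨h, h'⟩
        have := Nat.le_of_dvd hn h
        have := Nat.pos_of_dvd_of_pos h hn
        exact ⟨⟨by omega, by omega⟩, h⟩
      · rintro ⟨_, h⟩; exact ⟨h, hn.ne'⟩
    rw [e, Complex.ofReal_sum, Finset.sum_filter, Finset.sum_Ico_eq_sum_range, Nat.add_sub_cancel]
    apply Finset.sum_congr rfl
    intro N _
    rw [add_comm 1 N]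
  · intro N hN
    rw [Finset.mem_range] at hN
    rw [if_neg]
    intro hd
    have := Nat.le_of_dvd hn hd
    omega

lemma ram_n2 (s : ℝ) (hs : 2 < s) : Summable fun q : ℕ+ => ‖(((q:ℝ) ^ (-s) : ℝ):ℂ)‖ := by
  refine (pnat_rpow_summable (-s) (by linarith)).congr (fun m => ?_)
  rw [Complex.norm_real, Real.norm_of_nonneg (by positivity)]

lemma ram_n1 (s : ℝ) (hs : 2 < s) (n : ℕ) : Summable fun q : ℕ+ => ‖(((q:ℝ) ^ (-s) : ℝ):ℂ) * cq q n‖ :=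
  Summable.of_nonneg_of_le (fun _ => norm_nonneg _) (cq_bound s n) (pnat_rpow_summable (1-s) (by linarith))

lemma hs_mul1 (f g : ℕ → ℂ)
    (n1 : Summable fun q : ℕ+ => ‖f q‖) (n2 : Summable fun q : ℕ+ => ‖g q‖) :
    Summable (fun p : ℕ+ × ℕ+ => f p.1 * g p.2) :=
  summable_mul_of_summable_norm (R := ℂ) (f := fun q : ℕ+ => f q) (g := fun q : ℕ+ => g q) n1 n2

lemma hs_mul2 (f g : ℕ → ℂ) (A Z : ℂ) (h1 : HasSum (fun q : ℕ+ => f q) A) (h2 : HasSum (fun q : ℕ+ => g q) Z)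
    (h : Summable (fun p : ℕ+ × ℕ+ => f p.1 * g p.2))  :
    HasSum (fun p : ℕ+ × ℕ+ => f p.1 * g p.2) (A * Z) := by
  exact HasSum.mul (α := ℂ) (f := fun q : ℕ+ => f q) (g := fun q : ℕ+ => g q) h1 h2 h

lemma hasSum_div2 (f g : ℕ → ℂ) (A Z : ℂ) (h1 : HasSum (fun q : ℕ+ => f q) A) (h2 : HasSum (fun q : ℕ+ => g q) Z)
    (n1 : Summable fun q : ℕ+ => ‖f q‖) (n2 : Summable fun q : ℕ+ => ‖g q‖) :
    HasSum (fun N : ℕ+ => ∑ p ∈ Nat.divisorsAntidiagonal N, f p.1 * g p.2) (A * Z) := by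
  have h := hs_mul2 f g A Z h1 h2 (hs_mul1 f g n1 n2)
  exact hasSum_div (fun x y => f x * g y) (A * Z) h

lemma ram_conv (s : ℝ) (hs : 2 < s) (n : ℕ) (hn : 0 < n) :
    (∑' q : ℕ+, (((q:ℝ) ^ (-s) : ℝ):ℂ) * cq q n) * riemannZeta s = ((sigmaR (1-s) n : ℝ):ℂ) := by
  have h5 := hasSum_div2 (fun q => (((q:ℝ) ^ (-s) : ℝ):ℂ) * cq q n) (fun q => (((q:ℝ) ^ (-s) : ℝ):ℂ)) _ _
    (cq_summable s hs n).hasSum (zeta_pnat s (by linarith)) (ram_n1 s hs n) (ram_n2 s hs)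
  rw [← h5.tsum_eq, ← ram_div (1-s) n hn]
  exact tsum_congr (fun N => ram_h6 s n N)

lemma sigma_flip (t : ℝ) (n : ℕ) (hn : 0 < n) : (n:ℝ) ^ t * sigmaR (-t) n = sigmaR t n := by
  unfold sigmaR
  rw [← Nat.sum_div_divisors n (fun d => (d:ℝ) ^ t), Finset.mul_sum]
  apply Finset.sum_congr rfl
  intro d hd
  have hd' := Nat.mem_divisors.mp hd
  have hd0 : (0:ℝ) < d := by exact_mod_cast Nat.pos_of_mem_divisors hd
  rw [Nat.cast_div hd'.1 hd0.ne', Real.div_rpow (by positivity) hd0.le, Real.rpow_neg hd0.le]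
  rfl

lemma ram_series (s : ℝ) (hs : 2 < s) (n : ℕ) (hn : 0 < n) :
    (((n:ℝ) ^ (s-1) : ℝ):ℂ) * (∑' q : ℕ+, (((q:ℝ) ^ (-s) : ℝ):ℂ) * cq q n) =
      ((sigmaR (s-1) n : ℝ):ℂ) / riemannZeta s := by
  have hz : riemannZeta s ≠ 0 := riemannZeta_ne_zero_of_one_lt_re (by simp; linarith)
  rw [eq_div_iff hz, mul_assoc, ram_conv s hs n hn, ← Complex.ofReal_mul, ← sigma_flip (s-1) n hn, neg_sub]

lemma exp_helper (K β1 β2 w X : ℝ)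
    (h : X ≤ K + β1 ∨ X ≤ K + β1 + w ∨ X ≤ K + β2 + w) :
    Real.exp X ≤ Real.exp K * ((Real.exp β2 + Real.exp β1) * (1 + Real.exp w)) := by
  have e1 := Real.exp_pos β1
  have e2 := Real.exp_pos β2
  have e3 := Real.exp_pos w
  have e4 := Real.exp_pos K
  have hh : Real.exp X ≤ Real.exp K * Real.exp β1 ∨ Real.exp X ≤ Real.exp K * (Real.exp β1 * Real.exp w)
    ∨ Real.exp X ≤ Real.exp K * (Real.exp β2 * Real.exp w) := by
    rcases h with h | h | h
    · left; rw [← Real.exp_add]; exact Real.exp_le_exp.mpr h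
    · right; left; rw [← Real.exp_add, ← Real.exp_add]; exact Real.exp_le_exp.mpr (by linarith)
    · right; right; rw [← Real.exp_add, ← Real.exp_add]; exact Real.exp_le_exp.mpr (by linarith)
  have p1 := mul_pos e1 e3
  have p2 := mul_pos e2 e3
  rcases hh with h | h | h <;> refine h.trans (mul_le_mul_of_nonneg_left ?_ e4.le) <;> nlinarith

lemma exp_helper2 (K β1 β2 w X : ℝ) (h : X ≤ K + β1 + w) :
    Real.exp X ≤ Real.exp K * ((Real.exp β2 + Real.exp β1) * Real.exp w) := by
  have e2 := Real.exp_pos β2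
  have e3 := Real.exp_pos w
  have : Real.exp X ≤ Real.exp K * (Real.exp β1 * Real.exp w) := by
    rw [← Real.exp_add, ← Real.exp_add]; exact Real.exp_le_exp.mpr (by linarith)
  refine this.trans ?_
  gcongr
  linarith

section pw

/-- majorant exponents -/
def x1 (a σ p t : ℝ) : ℝ := (a+1)*(2*σ-p-t)
def x2 (a σ p t : ℝ) : ℝ := (a-1)*p+2*σ-t
def x3 (a p t : ℝ) : ℝ := (a+1)*(p+t)
def xw (η σ p t : ℝ) : ℝ := 2*σ-(2+η)*p-2*t

noncomputable def RH (a b η σ p t l : ℝ) : ℝ :=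
  Real.exp ((a+b+4)*l) * ((Real.exp (2*b*σ) + Real.exp ((a+b+2+η)*σ)) * (1 + Real.exp (xw η σ p t)))

noncomputable def RT (a b η σ p t l : ℝ) : ℝ :=
  Real.exp ((a+b+4)*l) * ((Real.exp (2*b*σ) + Real.exp ((a+b+2+η)*σ)) * Real.exp (xw η σ p t))


lemma pw33 (a b η σ p t l : ℝ) (ha : 1 ≤ a) (hab : a < b) (hη : 0 < η) (hηb : η ≤ b - a) (hp : 0 ≤ p) (hps : p ≤ σ) (ht : 0 ≤ t) (hl : 0 ≤ l) (hy : p + t ≤ σ + l) : Real.exp (x3 a p t) * Real.exp (x3 b p t) ≤ RH a b η σ p t l := by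
  rw [← Real.exp_add]
  apply exp_helper; left
  unfold x3
  nlinarith [mul_le_mul_of_nonneg_left hy (by linarith : 0 ≤ a + b + 2), mul_nonneg hη.le (hp.trans hps)]

lemma pw13 (a b η σ p t l : ℝ) (ha : 1 ≤ a) (hab : a < b) (hη : 0 < η) (hηb : η ≤ b - a) (hp : 0 ≤ p) (hps : p ≤ σ) (ht : 0 ≤ t) (hl : 0 ≤ l) (hy : p + t ≤ σ + l) : Real.exp (x1 a σ p t) * Real.exp (x3 b p t) ≤ RH a b η σ p t l := by
  rw [← Real.exp_add]
  apply exp_helper; left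
  unfold x1 x3
  nlinarith [mul_le_mul_of_nonneg_left hy (by linarith : 0 ≤ b - a), mul_nonneg hη.le (hp.trans hps), mul_nonneg hl (by linarith : 0 ≤ 2 * a + 4)]

lemma pw23 (a b η σ p t l : ℝ) (ha : 1 ≤ a) (hab : a < b) (hη : 0 < η) (hηb : η ≤ b - a) (hp : 0 ≤ p) (hps : p ≤ σ) (ht : 0 ≤ t) (hl : 0 ≤ l) (hy : p + t ≤ σ + l) : Real.exp (x2 a σ p t) * Real.exp (x3 b p t) ≤ RH a b η σ p t l := by
  rw [← Real.exp_add]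
  apply exp_helper; left
  unfold x2 x3
  nlinarith [mul_le_mul_of_nonneg_left hy (by linarith : 0 ≤ a + b), mul_nonneg hη.le (hp.trans hps), mul_nonneg (by linarith : 0 ≤ a) ht]

lemma pw32 (a b η σ p t l : ℝ) (ha : 1 ≤ a) (hab : a < b) (hη : 0 < η) (hηb : η ≤ b - a) (hp : 0 ≤ p) (hps : p ≤ σ) (ht : 0 ≤ t) (hl : 0 ≤ l) (hy : p + t ≤ σ + l) : Real.exp (x3 a p t) * Real.exp (x2 b σ p t) ≤ RH a b η σ p t l := by
  rw [← Real.exp_add]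
  apply exp_helper; left
  unfold x2 x3
  nlinarith [mul_le_mul_of_nonneg_left hy (by linarith : 0 ≤ a + b), mul_nonneg hη.le (hp.trans hps), mul_nonneg (by linarith : 0 ≤ b) ht]

lemma pw31 (a b η σ p t l : ℝ) (ha : 1 ≤ a) (hab : a < b) (hη : 0 < η) (hηb : η ≤ b - a) (hp : 0 ≤ p) (hps : p ≤ σ) (ht : 0 ≤ t) (hl : 0 ≤ l) (hy : p + t ≤ σ + l) : Real.exp (x3 a p t) * Real.exp (x1 b σ p t) ≤ RH a b η σ p t l := by
  rw [← Real.exp_add]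
  apply exp_helper; right
  unfold x1 x3 xw
  rcases le_total 0 (2 - (b - a) + η) with h | h
  · left
    nlinarith [mul_le_mul_of_nonneg_left hy h, mul_nonneg hη.le ht, mul_nonneg hl (by linarith : 0 ≤ 2 + b - a + b + a)]
  · right
    nlinarith [mul_nonneg_of_nonpos_of_nonpos h (by linarith : -(p + t) ≤ 0), mul_nonneg hη.le ht, mul_nonneg hl (by linarith : 0 ≤ a + b + 4)]

lemma pw12 (a b η σ p t l : ℝ) (ha : 1 ≤ a) (hab : a < b) (hη : 0 < η) (hηb : η ≤ b - a) (hp : 0 ≤ p) (hps : p ≤ σ) (ht : 0 ≤ t) (hl : 0 ≤ l) : Real.exp (x1 a σ p t) * Real.exp (x2 b σ p t) ≤ RH a b η σ p t l := by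
  rw [← Real.exp_add]
  apply exp_helper; right; left
  unfold x1 x2 xw
  nlinarith [mul_le_mul_of_nonneg_left hps (by linarith : 0 ≤ b - a + η), mul_nonneg (by linarith : 0 ≤ a) ht, mul_nonneg hl (by linarith : 0 ≤ a + b + 4)]

lemma pw22 (a b η σ p t l : ℝ) (ha : 1 ≤ a) (hab : a < b) (hη : 0 < η) (hηb : η ≤ b - a) (hp : 0 ≤ p) (hps : p ≤ σ) (ht : 0 ≤ t) (hl : 0 ≤ l) : Real.exp (x2 a σ p t) * Real.exp (x2 b σ p t) ≤ RH a b η σ p t l := by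
  rw [← Real.exp_add]
  apply exp_helper; right; left
  unfold x2 xw
  nlinarith [mul_le_mul_of_nonneg_left hps (by linarith : 0 ≤ a + b + η), mul_nonneg hl (by linarith : 0 ≤ a + b + 4)]

/-- tails -/
lemma pw11 (a b η σ p t l : ℝ) (ha : 1 ≤ a) (hab : a < b) (hη : 0 < η) (hηb : η ≤ b - a) (hp : 0 ≤ p) (hps : p ≤ σ) (ht : 0 ≤ t) (hl : 0 ≤ l) (hy : σ ≤ p + t + l) : Real.exp (x1 a σ p t) * Real.exp (x1 b σ p t) ≤ RT a b η σ p t l := by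
  rw [← Real.exp_add]
  apply exp_helper2
  unfold x1 xw
  nlinarith [mul_le_mul_of_nonneg_left hy (by linarith : 0 ≤ a + b), mul_nonneg hη.le (sub_nonneg.mpr hps)]

lemma pw21 (a b η σ p t l : ℝ) (ha : 1 ≤ a) (hab : a < b) (hη : 0 < η) (hηb : η ≤ b - a) (hp : 0 ≤ p) (hps : p ≤ σ) (ht : 0 ≤ t) (hl : 0 ≤ l) (hy : σ ≤ p + t + l) : Real.exp (x2 a σ p t) * Real.exp (x1 b σ p t) ≤ RT a b η σ p t l := by
  rw [← Real.exp_add]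
  apply exp_helper2
  unfold x1 x2 xw
  nlinarith [mul_le_mul_of_nonneg_left hy (by linarith : 0 ≤ b), mul_nonneg (by linarith : 0 ≤ a + η) (sub_nonneg.mpr hps), mul_nonneg hl (by linarith : 0 ≤ a + 4)]

lemma pw_off (a σ p t l : ℝ) (ha : 1 ≤ a) (hp : 0 ≤ p) (hps : p ≤ σ) (ht : 0 ≤ t) (hy : σ ≤ p + t + l) (hy2 : p + t ≤ σ + l) :
    Real.exp (x1 a σ p t) ≤ Real.exp ((a+1)*l) * Real.exp ((a+1)*σ) ∧
    Real.exp (x2 a σ p t) ≤ Real.exp ((a+1)*l) * Real.exp ((a+1)*σ) ∧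
    Real.exp (x3 a p t) ≤ Real.exp ((a+1)*l) * Real.exp ((a+1)*σ) := by
  have hl : 0 ≤ l := by linarith
  simp only [← Real.exp_add, Real.exp_le_exp, x1, x2, x3]
  refine ⟨?_, ?_, ?_⟩
  · nlinarith [mul_le_mul_of_nonneg_left hy (by linarith : 0 ≤ a + 1)]
  · nlinarith [mul_nonneg (by linarith : 0 ≤ a) (sub_nonneg.mpr hps), mul_nonneg (by linarith : 0 ≤ a) hl]
  · nlinarith [mul_le_mul_of_nonneg_left hy2 (by linarith : 0 ≤ a + 1)]

lemma prod_est (D : ℝ) (hD : 0 ≤ D) (R A1 A2 A3 B1 B2 B3 : ℝ) (M1 M2 E1 N1 N2 E2 : ℂ)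
    (h1 : ‖M1‖ ≤ D * A1) (h2 : ‖M2‖ ≤ D * A2) (h3 : ‖E1‖ ≤ D * A3)
    (k1 : ‖N1‖ ≤ D * B1) (k2 : ‖N2‖ ≤ D * B2) (k3 : ‖E2‖ ≤ D * B3)
    (hA1 : 0 ≤ A1) (hA2 : 0 ≤ A2) (hA3 : 0 ≤ A3)
    (r12 : A1 * B2 ≤ R) (r13 : A1 * B3 ≤ R) (r22 : A2 * B2 ≤ R) (r23 : A2 * B3 ≤ R)
    (r31 : A3 * B1 ≤ R) (r32 : A3 * B2 ≤ R) (r33 : A3 * B3 ≤ R) :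
    ‖(M1 + M2 + E1) * (N1 + N2 + E2) - (M1 + M2) * N1‖ ≤ 7 * D^2 * R := by
  have gen : ∀ (X Y : ℂ) (A B : ℝ), ‖X‖ ≤ D * A → ‖Y‖ ≤ D * B → 0 ≤ A → A * B ≤ R → ‖X * Y‖ ≤ D^2 * R := by
    intro X Y A B hX hY hA hR
    rw [norm_mul]
    calc ‖X‖ * ‖Y‖ ≤ (D * A) * (D * B) := by gcongr
      _ = D^2 * (A * B) := by ring
      _ ≤ _ := by gcongr
  have e : (M1 + M2 + E1) * (N1 + N2 + E2) - (M1 + M2) * N1 = M1 * N2 + M1 * E2 + M2 * N2 + M2 * E2 + E1 * N1 + E1 * N2 + E1 * E2 := by ring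
  rw [e]
  have g1 := gen _ _ _ _ h1 k2 hA1 r12
  have g2 := gen _ _ _ _ h1 k3 hA1 r13
  have g3 := gen _ _ _ _ h2 k2 hA2 r22
  have g4 := gen _ _ _ _ h2 k3 hA2 r23
  have g5 := gen _ _ _ _ h3 k1 hA3 r31
  have g6 := gen _ _ _ _ h3 k2 hA3 r32
  have g7 := gen _ _ _ _ h3 k3 hA3 r33
  have := norm_add₃_le (a := M1 * N2) (b := M1 * E2) (c := M2 * N2)
  have i1 := norm_add_le (M1 * N2 + M1 * E2 + M2 * N2 + M2 * E2 + E1 * N1 + E1 * N2) (E1 * E2)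
  have i2 := norm_add_le (M1 * N2 + M1 * E2 + M2 * N2 + M2 * E2 + E1 * N1) (E1 * N2)
  have i3 := norm_add_le (M1 * N2 + M1 * E2 + M2 * N2 + M2 * E2) (E1 * N1)
  have i4 := norm_add_le (M1 * N2 + M1 * E2 + M2 * N2) (M2 * E2)
  linarith

end pw

noncomputable def M1 (a : ℝ) (q n : ℕ) (u : ℝ) : ℂ :=
  Real.Gamma (a+1) * riemannZeta (a+1) * (q * wpt (1/n) u) ^ (-(a+1:ℝ):ℂ)

noncomputable def M2 (a : ℝ) (q n : ℕ) (u : ℝ) : ℂ :=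
  riemannZeta (1-a) * ((q:ℝ)^(a-1):ℝ) / wpt (1/n) u

noncomputable def TT (n : ℕ) (u : ℝ) : ℝ := n * ‖wpt (1/n) u‖

lemma TT_eq (n : ℕ) (hn : 0 < n) (u : ℝ) : TT n u = ‖(1 + (2 * Real.pi * n * u : ℝ) * I : ℂ)‖ := by
  have hc : (n:ℂ) ≠ 0 := by exact_mod_cast hn.ne'
  have : (1 + (2 * Real.pi * n * u : ℝ) * I : ℂ) = (n:ℂ) * wpt (1/n) u := by
    unfold wpt; push_cast; field_simp
  rw [this, norm_mul, Complex.norm_natCast, TT]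

lemma TT_sq (n : ℕ) (hn : 0 < n) (u : ℝ) : TT n u ^ 2 = 1 + (2 * Real.pi * n * u)^2 := by
  rw [TT_eq n hn, Complex.sq_norm, Complex.normSq_apply]
  simp; ring

lemma TT_nonneg (n : ℕ) (u : ℝ) : 0 ≤ TT n u := by unfold TT; positivity

lemma TT_ge_one (n : ℕ) (hn : 0 < n) (u : ℝ) : 1 ≤ TT n u := by
  have := TT_sq n hn u
  nlinarith [TT_nonneg n u, sq_nonneg (2 * Real.pi * n * u)]

lemma TT_ge (n : ℕ) (hn : 0 < n) (u : ℝ) : 2 * Real.pi * n * |u| ≤ TT n u := by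
  have := TT_sq n hn u
  refine (sq_le_sq₀ (by positivity) (TT_nonneg n u)).mp ?_
  rw [this, mul_pow, mul_pow _ u, sq_abs]; linarith

lemma TT_le (n : ℕ) (hn : 0 < n) (u : ℝ) : TT n u ≤ 1 + 2 * Real.pi * n * |u| := by
  rw [TT_eq n hn]
  refine (norm_add_le _ _).trans ?_
  rw [norm_one, norm_mul, Complex.norm_I, mul_one, Complex.norm_real, Real.norm_eq_abs, abs_mul, abs_of_nonneg (by positivity : (0:ℝ) ≤ 2 * Real.pi * n)]

lemma wpt_ne (n : ℕ) (hn : 0 < n) (u : ℝ) : wpt (1/n) u ≠ 0 := by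
  intro h
  have := wpt_re (1/n) u
  rw [h, Complex.zero_re] at this
  have h2 : (0:ℝ) < 1 / n := by positivity
  linarith

lemma wpt_norm (n : ℕ) (hn : 0 < n) (u : ℝ) : ‖wpt (1/n) u‖ = Real.exp (Real.log (TT n u) - Real.log n) := by
  have hN : (0:ℝ) < n := by exact_mod_cast hn
  have := TT_ge_one n hn u
  rw [Real.exp_sub, Real.exp_log (by linarith), Real.exp_log hN, TT]
  field_simp

lemma wpt_add (n q : ℕ) (h : ℤ) (u : ℝ) : wpt (1/n) (u + h/q) = wpt (1/n) u + 2 * Real.pi * I * (h/q) := by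
  unfold wpt; push_cast; ring

lemma M1_norm (a : ℝ) (q n : ℕ) (hn : 0 < n) (hq : 0 < q) (u : ℝ) :
    ‖M1 a q n u‖ = ‖(Real.Gamma (a+1) * riemannZeta (a+1) : ℂ)‖ * Real.exp (x1 a (Real.log n / 2) (Real.log q) (Real.log (TT n u))) := by
  have hQ : (0:ℝ) < q := by exact_mod_cast hq
  rw [M1, norm_mul]
  congr 1
  rw [← Complex.ofReal_neg, Complex.norm_cpow_real, norm_mul, Complex.norm_natCast, wpt_norm n hn, 
    ← Real.exp_log hQ, ← Real.exp_add, ← Real.exp_mul, x1, Real.log_exp]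
  congr 1; ring

lemma M2_norm (a : ℝ) (q n : ℕ) (hn : 0 < n) (hq : 0 < q) (u : ℝ) :
    ‖M2 a q n u‖ = ‖(riemannZeta (1-a) : ℂ)‖ * Real.exp (x2 a (Real.log n / 2) (Real.log q) (Real.log (TT n u))) := by
  have hQ : (0:ℝ) < q := by exact_mod_cast hq
  rw [M2, norm_div, norm_mul, mul_div_assoc]
  congr 1
  rw [Complex.norm_real, Real.norm_of_nonneg (by positivity), wpt_norm n hn, 
    Real.rpow_def_of_pos hQ, ← Real.exp_sub, x2]
  congr 1; ring

lemma F_decomp (a : ℝ) (ha : 1 ≤ a) : ∃ D : ℝ, 0 ≤ D ∧ ∀ n q : ℕ, 0 < n → 0 < q → ∀ h : ℤ, IsCoprime h (q:ℤ) → ∀ u : ℝ,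
    ∃ E : ℂ, Fg a (wpt (1/n) (u + h/q)) = M1 a q n u + M2 a q n u + E ∧
    ‖M1 a q n u‖ ≤ D * Real.exp (x1 a (Real.log n / 2) (Real.log q) (Real.log (TT n u))) ∧
    ‖M2 a q n u‖ ≤ D * Real.exp (x2 a (Real.log n / 2) (Real.log q) (Real.log (TT n u))) ∧
    ‖E‖ ≤ D * Real.exp (x3 a (Real.log q) (Real.log (TT n u))) := by
  obtain ⟨C, hC, hk⟩ := key_lemma a ha
  refine ⟨‖(Real.Gamma (a+1) * riemannZeta (a+1) : ℂ)‖ + ‖(riemannZeta (1-a) : ℂ)‖ + C, by positivity, ?_⟩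
  intro n q hn hq h hc u
  have hN : (0:ℝ) < n := by exact_mod_cast hn
  have hQ : (0:ℝ) < q := by exact_mod_cast hq
  have h1 := norm_nonneg (Real.Gamma (a+1) * riemannZeta (a+1) : ℂ)
  have h2 := norm_nonneg (riemannZeta (1-a) : ℂ)
  refine ⟨Fg a (wpt (1/n) (u + h/q)) - M1 a q n u - M2 a q n u, by ring, ?_, ?_, ?_⟩
  · rw [M1_norm a q n hn hq]
    gcongr; linarith
  · rw [M2_norm a q n hn hq]
    gcongr; linarith
  · have h3 := hk (wpt (1/n) u) (by rw [wpt_re]; positivity) q hq h hc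
    rw [wpt_add]
    have e : (q * (‖wpt (1/n) u‖ / (wpt (1/n) u).re))^(a+1) = Real.exp (x3 a (Real.log q) (Real.log (TT n u))) := by
      have hT := TT_ge_one n hn u
      have : q * (‖wpt (1/n) u‖ / (wpt (1/n) u).re) = q * TT n u := by
        rw [wpt_re, TT]; field_simp
      rw [this, Real.rpow_def_of_pos (by positivity), Real.log_mul hQ.ne' (by positivity), x3, mul_comm]
    rw [e] at h3
    refine h3.trans ?_
    gcongr; linarith

noncomputable def dl (n q : ℕ) : ℝ := 1 / (2 * q * (Nat.sqrt n + 1))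

noncomputable def BB (a b ε : ℝ) (n : ℕ) : ℝ := (n:ℝ)^b + (n:ℝ)^((a+b)/2+1+ε)

noncomputable def WW (ε : ℝ) (q n : ℕ) (u : ℝ) : ℝ := n * (q:ℝ)^(-2-2*ε) * (TT n u ^ 2)⁻¹

noncomputable def GG (a b : ℝ) (n : ℕ) (x : ℝ) : ℂ := Fg a (wpt (1/n) x) * Fg b (wpt (1/n) x) * cexp (n * wpt (1/n) x)

noncomputable def MM (a b : ℝ) (q n : ℕ) (u : ℝ) : ℂ := (M1 a q n u + M2 a q n u) * M1 b q n u

lemma sqrt_facts (n : ℕ) : (Nat.sqrt n : ℝ) ≤ √n ∧ √(n:ℝ) < Nat.sqrt n + 1 ∧ √(n:ℝ)^2 = n := by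
  refine ⟨Real.nat_sqrt_le_real_sqrt, Real.real_sqrt_lt_nat_sqrt_succ, Real.sq_sqrt (by positivity)⟩

lemma geo_upper (n q : ℕ) (hn : 0 < n) (hq : 0 < q) (hqQ : q ≤ Nat.sqrt n) (u : ℝ)
    (hu : |u| ≤ 1 / ((Nat.sqrt n + 1) * q)) : 
    Real.log q + Real.log (TT n u) ≤ Real.log n / 2 + Real.log 8 := by
  have hQ : (0:ℝ) < q := by exact_mod_cast hq
  have hN : (0:ℝ) < n := by exact_mod_cast hn
  have hT := TT_ge_one n hn u
  obtain ⟨s1, s2, s3⟩ := sqrt_facts n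
  have hs : 0 < √(n:ℝ) := Real.sqrt_pos.mpr hN
  have hqs : (q:ℝ) ≤ √n := le_trans (by exact_mod_cast hqQ) s1
  rw [← Real.log_sqrt hN.le, ← Real.log_mul hQ.ne' (by positivity), ← Real.log_mul hs.ne' (by norm_num)]
  apply Real.log_le_log (by positivity)
  have h1 := TT_le n hn u
  have h2 : (q:ℝ) * (n * |u|) ≤ √n := by
    calc (q:ℝ) * (n * |u|) ≤ q * (n * (1 / ((Nat.sqrt n + 1) * q))) := by gcongr
      _ = n / (Nat.sqrt n + 1) := by field_simp
      _ ≤ √n := by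
        rw [div_le_iff₀ (by positivity)]
        nlinarith
  have h3 : 2 * Real.pi ≤ 7 := by linarith [Real.pi_lt_d2]
  calc q * TT n u ≤ q * (1 + 2 * Real.pi * n * |u|) := by gcongr
    _ = q + 2 * Real.pi * (q * (n * |u|)) := by ring
    _ ≤ √n + 7 * √n := by gcongr
    _ = _ := by ring

lemma geo_lower (n q : ℕ) (hn : 0 < n) (hq : 0 < q) (u : ℝ) (hu : dl n q ≤ |u|) : 
    Real.log n / 2 ≤ Real.log q + Real.log (TT n u) + Real.log 8 := by
  have hQ : (0:ℝ) < q := by exact_mod_cast hq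
  have hN : (0:ℝ) < n := by exact_mod_cast hn
  have hT := TT_ge_one n hn u
  obtain ⟨s1, s2, s3⟩ := sqrt_facts n
  have hs : 0 < √(n:ℝ) := Real.sqrt_pos.mpr hN
  have hs1 : 1 ≤ √(n:ℝ) := Real.one_le_sqrt.mpr (by exact_mod_cast hn)
  rw [← Real.log_sqrt hN.le, ← Real.log_mul hQ.ne' (by positivity), ← Real.log_mul (by positivity) (by norm_num)]
  apply Real.log_le_log hs
  have h1 := TT_ge n hn u
  have h3 : 3 ≤ Real.pi := by linarith [Real.pi_gt_three]
  calc √(n:ℝ) ≤ n / (Nat.sqrt n + 1) * 3 := by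
        rw [div_mul_eq_mul_div, le_div_iff₀ (by positivity)]
        nlinarith
    _ ≤ n / (Nat.sqrt n + 1) * Real.pi := by gcongr
    _ = q * (2 * Real.pi * n * dl n q) := by rw [dl]; field_simp
    _ ≤ q * (2 * Real.pi * n * |u|) := by gcongr
    _ ≤ q * TT n u := by gcongr
    _ ≤ q * TT n u * 8 := by nlinarith [mul_pos hQ (by linarith : 0 < TT n u)]

lemma WW_eq (ε : ℝ) (q n : ℕ) (hn : 0 < n) (hq : 0 < q) (u : ℝ) :
    Real.exp (xw (2*ε) (Real.log n / 2) (Real.log q) (Real.log (TT n u))) = WW ε q n u := by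
  have hQ : (0:ℝ) < q := by exact_mod_cast hq
  have hN : (0:ℝ) < n := by exact_mod_cast hn
  have hT : 0 < TT n u := by linarith [TT_ge_one n hn u]
  have e1 : (TT n u ^ 2)⁻¹ = Real.exp (-2 * Real.log (TT n u)) := by
    rw [neg_mul, Real.exp_neg, two_mul, Real.exp_add, Real.exp_log hT, sq]
  rw [WW, e1, Real.rpow_def_of_pos hQ]
  nth_rw 2 [← Real.exp_log hN]
  rw [← Real.exp_add, ← Real.exp_add, xw]
  congr 1; ring

lemma BB_eq (a b ε : ℝ) (n : ℕ) (hn : 0 < n) :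
    Real.exp (2*b*(Real.log n / 2)) + Real.exp ((a+b+2+2*ε)*(Real.log n / 2)) = BB a b ε n := by
  have hN : (0:ℝ) < n := by exact_mod_cast hn
  rw [BB, Real.rpow_def_of_pos hN, Real.rpow_def_of_pos hN]
  congr 2 <;> ring

lemma BB_pos (a b ε : ℝ) (n : ℕ) (hn : 0 < n) : 0 < BB a b ε n := by unfold BB; positivity
lemma WW_nonneg (ε : ℝ) (q n : ℕ) (u : ℝ) : 0 ≤ WW ε q n u := by unfold WW; positivity

lemma cexp_norm (n : ℕ) (hn : 0 < n) (x : ℝ) : ‖cexp (n * wpt (1/n) x)‖ = Real.exp 1 := by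
  have hN : (0:ℝ) < n := by exact_mod_cast hn
  have : ((n:ℂ) * wpt (1/n) x).re = 1 := by
    rw [← Complex.ofReal_natCast, Complex.re_ofReal_mul, wpt_re]; field_simp
  rw [Complex.norm_exp, this]

set_option maxHeartbeats 1000000 in
lemma pointwise (a b ε : ℝ) (ha : 1 ≤ a) (hab : a < b) (hε : 0 < ε) (hεb : 2*ε ≤ b - a) :
    ∃ K : ℝ, 0 ≤ K ∧ ∀ n q : ℕ, 0 < n → 0 < q → q ≤ Nat.sqrt n → ∀ h : ℤ, IsCoprime h (q:ℤ) → ∀ u : ℝ,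
      (|u| ≤ dl n q → ‖GG a b n (u + h/q) - MM a b q n u * cexp (n * wpt (1/n) (u + h/q))‖ ≤ K * BB a b ε n * (1 + WW ε q n u)) ∧
      (dl n q ≤ |u| → ‖MM a b q n u * cexp (n * wpt (1/n) (u + h/q))‖ ≤ K * BB a b ε n * WW ε q n u) ∧
      (dl n q ≤ |u| → |u| ≤ 1 / ((Nat.sqrt n + 1) * q) → ‖GG a b n (u + h/q)‖ ≤ K * BB a b ε n) := by
  obtain ⟨Da, hDa, Ha⟩ := F_decomp a ha
  obtain ⟨Db, hDb, Hb⟩ := F_decomp b (by linarith)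
  set D := Da + Db with hD
  have hD0 : 0 ≤ D := by positivity
  set l := Real.log 8 with hl
  have hl0 : 0 ≤ l := Real.log_nonneg (by norm_num)
  refine ⟨9 * D^2 * Real.exp ((a+b+4)*l) * Real.exp 1, by positivity, ?_⟩
  intro n q hn hq hqQ h hc u
  obtain ⟨E, hE, hE1, hE2, hE3⟩ := Ha n q hn hq h hc u
  obtain ⟨E', hE', hE1', hE2', hE3'⟩ := Hb n q hn hq h hc u
  have hQ : (0:ℝ) < q := by exact_mod_cast hq
  have hN : (0:ℝ) < n := by exact_mod_cast hn
  have hWe := WW_eq ε q n hn hq u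
  have hBe := BB_eq a b ε n hn
  have hgl := geo_lower n q hn hq u
  have hgu := geo_upper n q hn hq hqQ u
  have hp0 : 0 ≤ Real.log q := Real.log_nonneg (by exact_mod_cast hq)
  have hps : Real.log q ≤ Real.log n / 2 := by
    rw [← Real.log_sqrt hN.le]
    exact Real.log_le_log hQ (le_trans (by exact_mod_cast hqQ) (sqrt_facts n).1)
  have ht0 : 0 ≤ Real.log (TT n u) := Real.log_nonneg (TT_ge_one n hn u)
  have hcx := cexp_norm n hn (u + h/q)
  have hB := BB_pos a b ε n hn
  have hW := WW_nonneg ε q n u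
  rw [← hl] at hgu hgl
  generalize Real.log q = p at *
  generalize Real.log (TT n u) = t at *
  have hRH : RH a b (2*ε) (Real.log n / 2) p t l = Real.exp ((a+b+4)*l) * (BB a b ε n * (1 + WW ε q n u)) := by
    rw [RH, hBe, hWe]
  have hRT : RT a b (2*ε) (Real.log n / 2) p t l = Real.exp ((a+b+4)*l) * (BB a b ε n * WW ε q n u) := by
    rw [RT, hBe, hWe]
  have hσ : 0 ≤ Real.log n / 2 := hp0.trans hps
  have hB2 : Real.exp ((a+1) * (Real.log n / 2)) * Real.exp ((b+1) * (Real.log n / 2)) ≤ BB a b ε n := by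
    rw [← hBe, ← Real.exp_add]
    have : Real.exp ((a + 1) * (Real.log n / 2) + (b + 1) * (Real.log n / 2)) ≤ Real.exp ((a+b+2+2*ε)*(Real.log n / 2)) := by
      apply Real.exp_le_exp.mpr; nlinarith [mul_nonneg hε.le hσ]
    linarith [Real.exp_pos (2*b*(Real.log n / 2))]
  generalize Real.log n / 2 = σ at *
  have mono : ∀ (x A : ℝ), x ≤ Da * Real.exp A → x ≤ D * Real.exp A := fun x A hx => hx.trans (by gcongr; linarith)
  have mono' : ∀ (x A : ℝ), x ≤ Db * Real.exp A → x ≤ D * Real.exp A := fun x A hx => hx.trans (by gcongr; linarith)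
  replace hE1 := mono _ _ hE1
  replace hE2 := mono _ _ hE2
  replace hE3 := mono _ _ hE3
  replace hE1' := mono' _ _ hE1'
  replace hE2' := mono' _ _ hE2'
  replace hE3' := mono' _ _ hE3'
  have h2ε : 0 < 2 * ε := by linarith
  refine ⟨fun hu => ?_, fun hu => ?_, fun hu hu2 => ?_⟩
  · have hy : p + t ≤ σ + l := by
      apply hgu
      refine hu.trans ?_
      rw [dl]
      apply one_div_le_one_div_of_le (by positivity)
      nlinarith [mul_nonneg hQ.le (by positivity : (0:ℝ) ≤ Nat.sqrt n + 1)]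
    have key := prod_est D hD0 (RH a b (2*ε) σ p t l) _ _ _ _ _ _ _ _ _ _ _ _ hE1 hE2 hE3 hE1' hE2' hE3'
      (Real.exp_nonneg _) (Real.exp_nonneg _) (Real.exp_nonneg _)
      (pw12 a b (2*ε) σ p t l ha hab h2ε hεb hp0 hps ht0 hl0)
      (pw13 a b (2*ε) σ p t l ha hab h2ε hεb hp0 hps ht0 hl0 hy)
      (pw22 a b (2*ε) σ p t l ha hab h2ε hεb hp0 hps ht0 hl0)
      (pw23 a b (2*ε) σ p t l ha hab h2ε hεb hp0 hps ht0 hl0 hy)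
      (pw31 a b (2*ε) σ p t l ha hab h2ε hεb hp0 hps ht0 hl0 hy)
      (pw32 a b (2*ε) σ p t l ha hab h2ε hεb hp0 hps ht0 hl0 hy)
      (pw33 a b (2*ε) σ p t l ha hab h2ε hεb hp0 hps ht0 hl0 hy)
    rw [GG, MM, ← sub_mul, norm_mul, hcx, hE, hE']
    calc _ ≤ 7 * D^2 * RH a b (2*ε) σ p t l * Real.exp 1 := by gcongr
      _ = 7 * (D^2 * Real.exp ((a+b+4)*l) * Real.exp 1 * BB a b ε n * (1 + WW ε q n u)) := by rw [hRH]; ring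
      _ ≤ 9 * (D^2 * Real.exp ((a+b+4)*l) * Real.exp 1 * BB a b ε n * (1 + WW ε q n u)) := by
        gcongr; norm_num
      _ = _ := by ring
  · have hy := hgl hu
    have k1 := pw11 a b (2*ε) σ p t l ha hab h2ε hεb hp0 hps ht0 hl0 hy
    have k2 := pw21 a b (2*ε) σ p t l ha hab h2ε hεb hp0 hps ht0 hl0 hy
    rw [norm_mul, hcx, MM, add_mul]
    have g1 : ‖M1 a q n u * M1 b q n u‖ ≤ D^2 * RT a b (2*ε) σ p t l := by
      rw [norm_mul]
      calc _ ≤ (D * Real.exp (x1 a σ p t)) * (D * Real.exp (x1 b σ p t)) := by gcongr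
        _ = D^2 * (Real.exp (x1 a σ p t) * Real.exp (x1 b σ p t)) := by ring
        _ ≤ _ := by gcongr
    have g2 : ‖M2 a q n u * M1 b q n u‖ ≤ D^2 * RT a b (2*ε) σ p t l := by
      rw [norm_mul]
      calc _ ≤ (D * Real.exp (x2 a σ p t)) * (D * Real.exp (x1 b σ p t)) := by gcongr
        _ = D^2 * (Real.exp (x2 a σ p t) * Real.exp (x1 b σ p t)) := by ring
        _ ≤ _ := by gcongr
    calc _ ≤ (D^2 * RT a b (2*ε) σ p t l + D^2 * RT a b (2*ε) σ p t l) * Real.exp 1 := by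
          gcongr
          exact (norm_add_le _ _).trans (add_le_add g1 g2)
      _ = 2 * (D^2 * Real.exp ((a+b+4)*l) * Real.exp 1 * BB a b ε n * WW ε q n u) := by rw [hRT]; ring
      _ ≤ 9 * (D^2 * Real.exp ((a+b+4)*l) * Real.exp 1 * BB a b ε n * WW ε q n u) := by
        gcongr; norm_num
      _ = _ := by ring
  · have hy := hgl hu
    have hy2 := hgu hu2
    obtain ⟨j1, j2, j3⟩ := pw_off a σ p t l ha hp0 hps ht0 hy hy2
    obtain ⟨j1', j2', j3'⟩ := pw_off b σ p t l (by linarith) hp0 hps ht0 hy hy2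
    have f1 : ‖M1 a q n u + M2 a q n u + E‖ ≤ 3 * (D * (Real.exp ((a+1)*l) * Real.exp ((a+1)*σ))) := by
      have := norm_add₃_le (a := M1 a q n u) (b := M2 a q n u) (c := E)
      have q1 := hE1.trans (mul_le_mul_of_nonneg_left j1 hD0)
      have q2 := hE2.trans (mul_le_mul_of_nonneg_left j2 hD0)
      have q3 := hE3.trans (mul_le_mul_of_nonneg_left j3 hD0)
      linarith
    have f2 : ‖M1 b q n u + M2 b q n u + E'‖ ≤ 3 * (D * (Real.exp ((b+1)*l) * Real.exp ((b+1)*σ))) := by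
      have := norm_add₃_le (a := M1 b q n u) (b := M2 b q n u) (c := E')
      have q1 := hE1'.trans (mul_le_mul_of_nonneg_left j1' hD0)
      have q2 := hE2'.trans (mul_le_mul_of_nonneg_left j2' hD0)
      have q3 := hE3'.trans (mul_le_mul_of_nonneg_left j3' hD0)
      linarith
    rw [GG, hE, hE', norm_mul, norm_mul, hcx]
    calc _ ≤ (3 * (D * (Real.exp ((a+1)*l) * Real.exp ((a+1)*σ)))) * (3 * (D * (Real.exp ((b+1)*l) * Real.exp ((b+1)*σ)))) * Real.exp 1 := by gcongr
      _ = 9 * D^2 * (Real.exp ((a+1)*l) * Real.exp ((b+1)*l)) * Real.exp 1 * (Real.exp ((a+1)*σ) * Real.exp ((b+1)*σ)) := by ring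
      _ ≤ 9 * D^2 * Real.exp ((a+b+4)*l) * Real.exp 1 * BB a b ε n := by
        gcongr
        rw [← Real.exp_add]; apply Real.exp_le_exp.mpr; nlinarith

lemma WW_int (ε : ℝ) (q n : ℕ) (hn : 0 < n) :
    Integrable (fun u => WW ε q n u) ∧ ∫ u, WW ε q n u = (q:ℝ)^(-2-2*ε) / 2 := by
  have hN : (0:ℝ) < n := by exact_mod_cast hn
  have hc : (2 * Real.pi * n) ≠ 0 := by positivity
  have e : (fun u => WW ε q n u) = fun u => (n * (q:ℝ)^(-2-2*ε)) * (fun x : ℝ => (1 + x^2)⁻¹) ((2 * Real.pi * n) * u) := by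
    funext u
    simp only [WW, TT_sq n hn]
  rw [e]
  refine ⟨((integrable_inv_one_add_sq).comp_mul_left' hc).const_mul _, ?_⟩
  rw [integral_const_mul, Measure.integral_comp_mul_left (fun x : ℝ => (1 + x^2)⁻¹) (2 * Real.pi * n), integral_univ_inv_one_add_sq, abs_of_nonneg (by positivity)]
  simp only [smul_eq_mul]
  field_simp

lemma Fg_cont (a : ℝ) (ha : 0 ≤ a) (r : ℝ) (hr : 0 < r) : Continuous (fun x => Fg a (wpt r x)) := by
  have e : (fun x => Fg a (wpt r x)) = fun x => ∑' k : ℕ, (sigmaR a k : ℂ) * cexp (-(k * wpt r x)) := by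
    funext x
    exact (Fg_hasSum a ha _ (by rw [wpt_re]; exact hr)).tsum_eq.symm
  rw [e]
  refine continuous_tsum (fun k => ?_) (sigma_summable_nat a ha r hr) (fun k x => ?_)
  · unfold wpt; fun_prop
  · rw [norm_mul, Complex.norm_real, Complex.norm_exp, Real.norm_of_nonneg (sigmaR_nonneg _ _)]
    simp [wpt_re]

lemma GG_cont (a b : ℝ) (ha : 0 ≤ a) (hb : 0 ≤ b) (n : ℕ) (hn : 0 < n) : Continuous (GG a b n) := by
  have hN : (0:ℝ) < n := by exact_mod_cast hn
  have h1 := Fg_cont a ha (1/n) (by positivity)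
  have h2 := Fg_cont b hb (1/n) (by positivity)
  unfold GG
  have h3 : Continuous fun x => wpt (1/n) x := by unfold wpt; fun_prop
  fun_prop

lemma hank (c : ℝ) (hc : 0 < c) (n : ℕ) (hn : 0 < n) :
    Integrable (fun u : ℝ => (wpt (1/n) u) ^ (-(c+1:ℝ):ℂ) * cexp (n * wpt (1/n) u)) ∧
    ∫ u : ℝ, (wpt (1/n) u) ^ (-(c+1:ℝ):ℂ) * cexp (n * wpt (1/n) u) = (((n:ℝ) ^ c / Real.Gamma (c+1) : ℝ) : ℂ) := by
  have hN : (0:ℝ) < n := by exact_mod_cast hn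
  have hs : 0 < (((1/n:ℝ)):ℂ).re := by rw [Complex.ofReal_re]; positivity
  constructor
  · have h1 := four_integrable c hc ((1/n:ℝ):ℂ) hs
    have hG : (Real.Gamma (c+1) : ℂ) ≠ 0 := by
      exact_mod_cast (Real.Gamma_pos_of_pos (by linarith)).ne'
    have h2 : Integrable (fun u : ℝ => (wpt (1/n) u) ^ (-(c+1:ℝ):ℂ)) := by
      refine (h1.const_mul ((Real.Gamma (c+1) : ℂ)⁻¹)).congr (Filter.Eventually.of_forall fun u => ?_)
      simp only [wpt]
      rw [← mul_assoc, inv_mul_cancel₀ hG, one_mul]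
    have hcont : Continuous fun u : ℝ => cexp (n * wpt (1/n) u) := by unfold wpt; fun_prop
    refine (h2.norm.mul_const (Real.exp 1)).mono (h2.aestronglyMeasurable.mul hcont.aestronglyMeasurable) (Filter.Eventually.of_forall fun u => ?_)
    rw [norm_mul, cexp_norm n hn, norm_mul, norm_norm, Real.norm_of_nonneg (Real.exp_nonneg 1)]
  · have := hankel c hc ((1/n:ℝ):ℂ) hs n hN
    rw [← this]
    simp only [wpt, Complex.ofReal_natCast]

noncomputable def al (a b : ℝ) : ℂ := Real.Gamma (a+1) * riemannZeta (a+1) * (Real.Gamma (b+1) * riemannZeta (b+1)) / Real.Gamma (a+b+2)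
noncomputable def be (a b : ℝ) : ℂ := riemannZeta (1-a) * (Real.Gamma (b+1) * riemannZeta (b+1)) / Real.Gamma (b+2)

noncomputable def SS (a b : ℝ) (q n : ℕ) : ℂ :=
  al a b * ((n:ℝ)^(a+b+1):ℝ) * ((q:ℝ)^(-(a+b+2)):ℝ) + be a b * ((n:ℝ)^(b+1):ℝ) * ((q:ℝ)^(-(b-a+2)):ℝ)

lemma MM_eq (a b : ℝ) (q n : ℕ) (hn : 0 < n) (hq : 0 < q) (u : ℝ) : MM a b q n u =
   Real.Gamma (a+1) * riemannZeta (a+1) * (Real.Gamma (b+1) * riemannZeta (b+1)) * ((q:ℝ)^(-(a+b+2)):ℝ) * (wpt (1/n) u) ^ (-((a+b+1)+1:ℝ):ℂ)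
   + riemannZeta (1-a) * (Real.Gamma (b+1) * riemannZeta (b+1)) * ((q:ℝ)^(-(b-a+2)):ℝ) * (wpt (1/n) u) ^ (-((b+1)+1:ℝ):ℂ) := by
  have hQ : (0:ℝ) < q := by exact_mod_cast hq
  have hw := wpt_ne n hn u
  have e1 : ∀ c : ℝ, ((q:ℂ) * wpt (1/n) u) ^ (-(c+1:ℝ):ℂ) = (((q:ℝ)^(-(c+1)) : ℝ):ℂ) * wpt (1/n) u ^ (-(c+1:ℝ):ℂ) := by
    intro c
    rw [← Complex.ofReal_neg, ← real_mul_cpow q hQ _ hw]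
    simp
  have e2 : (wpt (1/n) u) ^ (-((a+b+1)+1:ℝ):ℂ) = wpt (1/n) u ^ (-(a+1:ℝ):ℂ) * wpt (1/n) u ^ (-(b+1:ℝ):ℂ) := by
    rw [← Complex.cpow_add _ _ hw]; congr 1; push_cast; ring
  have e3 : (wpt (1/n) u) ^ (-((b+1)+1:ℝ):ℂ) = (wpt (1/n) u)⁻¹ * wpt (1/n) u ^ (-(b+1:ℝ):ℂ) := by
    rw [← Complex.cpow_neg_one, ← Complex.cpow_add _ _ hw]; congr 1; push_cast; ring
  have e4 : (q:ℝ)^(-(a+b+2)) = (q:ℝ)^(-(a+1)) * (q:ℝ)^(-(b+1)) := by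
    rw [← Real.rpow_add hQ]; congr 1; ring
  have e5 : (q:ℝ)^(-(b-a+2)) = (q:ℝ)^(a-1) * (q:ℝ)^(-(b+1)) := by
    rw [← Real.rpow_add hQ]; congr 1; ring
  rw [MM, M1, M2, M1, e1, e1, e2, e3, e4, e5]
  push_cast
  ring

lemma MM_int (a b : ℝ) (ha : 1 ≤ a) (hab : a < b) (q n : ℕ) (hn : 0 < n) (hq : 0 < q) :
    Integrable (fun u => MM a b q n u * cexp (n * wpt (1/n) u)) ∧ 
    ∫ u, MM a b q n u * cexp (n * wpt (1/n) u) = SS a b q n := by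
  obtain ⟨i1, v1⟩ := hank (a+b+1) (by linarith) n hn
  obtain ⟨i2, v2⟩ := hank (b+1) (by linarith) n hn
  have e : (fun u => MM a b q n u * cexp (n * wpt (1/n) u)) = fun u => 
     (Real.Gamma (a+1) * riemannZeta (a+1) * (Real.Gamma (b+1) * riemannZeta (b+1)) * ((q:ℝ)^(-(a+b+2)):ℝ)) * ((wpt (1/n) u) ^ (-((a+b+1)+1:ℝ):ℂ) * cexp (n * wpt (1/n) u))
     + (riemannZeta (1-a) * (Real.Gamma (b+1) * riemannZeta (b+1)) * ((q:ℝ)^(-(b-a+2)):ℝ)) * ((wpt (1/n) u) ^ (-((b+1)+1:ℝ):ℂ) * cexp (n * wpt (1/n) u)) := by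
    funext u
    rw [MM_eq a b q n hn hq]; ring
  rw [e]
  refine ⟨(i1.const_mul _).add (i2.const_mul _), ?_⟩
  rw [integral_add (i1.const_mul _) (i2.const_mul _), integral_const_mul, integral_const_mul, v1, v2, SS, al, be,
    show a+b+1+1 = a+b+2 by ring, show b+1+1 = b+2 by ring]
  push_cast
  ring

lemma Phi_int (a b : ℝ) (ha : 1 ≤ a) (hab : a < b) (q n : ℕ) (hn : 0 < n) (hq : 0 < q) (h : ℤ) :
    Integrable (fun x : ℝ => MM a b q n (x - h/q) * cexp (n * wpt (1/n) x)) ∧ 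
    ∫ x : ℝ, MM a b q n (x - h/q) * cexp (n * wpt (1/n) x) = SS a b q n * cexp (n * (2 * Real.pi * I * (h/q))) := by
  obtain ⟨i1, v1⟩ := MM_int a b ha hab q n hn hq
  have e : (fun x : ℝ => MM a b q n (x - h/q) * cexp (n * wpt (1/n) x)) =
    fun x : ℝ => (fun u => MM a b q n u * cexp (n * wpt (1/n) u) * cexp (n * (2 * Real.pi * I * (h/q)))) (x - h/q) := by
    funext x
    have : wpt (1/n) x = wpt (1/n) (x - h/q) + 2 * Real.pi * I * (h/q) := by
      rw [← wpt_add]; congr 1; ring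
    simp only
    rw [this, mul_add, Complex.exp_add]; ring
  rw [e]
  refine ⟨(i1.mul_const _).comp_sub_right _, ?_⟩
  rw [integral_sub_right_eq_self (fun u => MM a b q n u * cexp (n * wpt (1/n) u) * cexp (n * (2 * Real.pi * I * (h/q)))), integral_mul_const, v1]

def arc (n q : ℕ) (h : ℤ) : Set ℝ := Icc ((h:ℝ)/q - dl n q) ((h:ℝ)/q + dl n q)

lemma arc_est (a b ε : ℝ) (ha : 1 ≤ a) (hab : a < b) (hε : 0 < ε) (hεb : 2*ε ≤ b - a) :
    ∃ K : ℝ, 0 ≤ K ∧ ∀ n q : ℕ, 0 < n → 0 < q → q ≤ Nat.sqrt n → ∀ h : ℤ, IsCoprime h (q:ℤ) → 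
      (‖(∫ x in arc n q h, GG a b n x) - SS a b q n * cexp (n * (2 * Real.pi * I * (h/q)))‖ ≤ K * BB a b ε n * (2 * dl n q + (q:ℝ)^(-2-2*ε) / 2)) ∧ 
      (∀ x : ℝ, x ∉ arc n q h → |x - h/q| ≤ 1 / ((Nat.sqrt n + 1) * q) → ‖GG a b n x‖ ≤ K * BB a b ε n) := by
  obtain ⟨K, hK, H⟩ := pointwise a b ε ha hab hε hεb
  refine ⟨K, hK, ?_⟩
  intro n q hn hq hqQ h hc
  have H' := H n q hn hq hqQ h hc
  clear H
  have hdl : 0 ≤ dl n q := by unfold dl; positivity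
  have hmem : ∀ x, x ∈ arc n q h ↔ |x - h/q| ≤ dl n q := by
    intro x
    rw [arc, Set.mem_Icc, abs_le]; constructor <;> rintro ⟨h1, h2⟩ <;> constructor <;> linarith
  constructor
  · obtain ⟨i1, v1⟩ := Phi_int a b ha hab q n hn hq h
    obtain ⟨i2, v2⟩ := WW_int ε q n hn
    have hA : MeasurableSet (arc n q h) := measurableSet_Icc
    have iG : IntegrableOn (GG a b n) (arc n q h) := (GG_cont a b (by linarith) (by linarith) n hn).integrableOn_Icc
    have i3 : Integrable (fun x : ℝ => WW ε q n (x - h/q)) := i2.comp_sub_right _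
    have v3 : ∫ x : ℝ, WW ε q n (x - h/q) = (q:ℝ)^(-2-2*ε) / 2 := by
      rw [← v2, integral_sub_right_eq_self (fun u => WW ε q n u)]
    rw [← v1, ← integral_add_compl hA i1, ← sub_sub, ← integral_sub iG i1.integrableOn]
    have i4 : IntegrableOn (fun x : ℝ => K * BB a b ε n * (1 + WW ε q n (x - h/q))) (arc n q h) := by
      apply Integrable.const_mul
      apply Integrable.add
      · exact (continuous_const.integrableOn_Icc : IntegrableOn (fun _ : ℝ => (1:ℝ)) _)
      · exact i3.integrableOn
    have b1 : ‖∫ x in arc n q h, (GG a b n x - MM a b q n (x - h/q) * cexp (n * wpt (1/n) x))‖ ≤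
        ∫ x in arc n q h, K * BB a b ε n * (1 + WW ε q n (x - h/q)) := by
      apply norm_integral_le_of_norm_le i4
      apply ae_restrict_of_forall_mem hA
      intro x hx
      have := (H' (x - h/q)).1 ((hmem x).mp hx)
      rwa [sub_add_cancel] at this
    have b2 : ‖∫ x in (arc n q h)ᶜ, MM a b q n (x - h/q) * cexp (n * wpt (1/n) x)‖ ≤
        ∫ x in (arc n q h)ᶜ, K * BB a b ε n * WW ε q n (x - h/q) := by
      apply norm_integral_le_of_norm_le ((i3.const_mul _).integrableOn)
      apply ae_restrict_of_forall_mem hA.compl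
      intro x hx
      have hx' : ¬ |x - h/q| ≤ dl n q := fun hh => hx ((hmem x).mpr hh)
      have := (H' (x - h/q)).2.1 (le_of_not_ge hx')
      rwa [sub_add_cancel] at this
    refine (norm_sub_le _ _).trans ((add_le_add b1 b2).trans (le_of_eq ?_))
    rw [integral_const_mul, integral_const_mul, integral_add (by exact (continuous_const.integrableOn_Icc : IntegrableOn (fun _ : ℝ => (1:ℝ)) _)) i3.integrableOn,
      ← mul_add, add_assoc, integral_add_compl hA i3, v3]
    congr 2
    rw [setIntegral_const, arc, measureReal_def, Real.volume_Icc, ENNReal.toReal_ofReal (by linarith)]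
    simp; ring
  · intro x hx hx2
    have hx' : ¬ |x - h/q| ≤ dl n q := fun hh => hx ((hmem x).mpr hh)
    have := (H' (x - h/q)).2.2 (le_of_not_ge hx') hx2
    rwa [sub_add_cancel] at this

lemma dl_pos (n q : ℕ) (hq : 0 < q) : 0 < dl n q := by
  have : (0:ℝ) < q := by exact_mod_cast hq
  unfold dl; positivity

lemma dl_le (n q : ℕ) (hq : 0 < q) : dl n q ≤ dl n 1 := by
  have : (1:ℝ) ≤ q := by exact_mod_cast hq
  unfold dl
  push_cast
  gcongr

lemma dl_far (n q : ℕ) (hq : 0 < q) (hqQ : q ≤ Nat.sqrt n) : dl n 1 + dl n q < 1 / q := by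
  have h1 : (0:ℝ) < q := by exact_mod_cast hq
  have h2 : (q:ℝ) ≤ Nat.sqrt n := by exact_mod_cast hqQ
  have e : 1 / (q:ℝ) - dl n 1 - dl n q = (2 * (Nat.sqrt n + 1) - q - 1) / (2 * q * (Nat.sqrt n + 1)) := by
    unfold dl; field_simp; push_cast; ring
  have : 0 < (2 * (Nat.sqrt n + 1) - q - 1) / (2 * q * ((Nat.sqrt n:ℝ) + 1)) := by
    apply div_pos _ (by positivity)
    linarith
  linarith

lemma arc_sub (n q h : ℕ) (hq : 0 < q) (hqQ : q ≤ Nat.sqrt n) (hh : h ∈ Hq q) :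
    arc n q h ⊆ Ioc (dl n 1) (dl n 1 + 1) := by
  have h1 : (0:ℝ) < q := by exact_mod_cast hq
  simp only [Hq, Finset.mem_filter, Finset.mem_Icc] at hh
  intro x hx
  simp only [arc, Set.mem_Icc] at hx
  have hf := dl_far n q hq hqQ
  have hl := dl_le n q hq
  have a1 : 1 / (q:ℝ) ≤ (h:ℝ)/q := by
    gcongr; exact_mod_cast hh.1.1
  have a2 : (h:ℝ)/q ≤ 1 := by
    rw [div_le_one h1]; exact_mod_cast hh.1.2
  push_cast at hx
  constructor <;> linarith

lemma arc_disj (n q h q' h' : ℕ) (hq : 0 < q) (hqQ : q ≤ Nat.sqrt n) (hh : h ∈ Hq q) 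
    (hq' : 0 < q') (hqQ' : q' ≤ Nat.sqrt n) (hh' : h' ∈ Hq q') (hne : ¬ (q = q' ∧ h = h')) :
    Disjoint (arc n q h) (arc n q' h') := by
  have h1 : (0:ℝ) < q := by exact_mod_cast hq
  have h1' : (0:ℝ) < q' := by exact_mod_cast hq'
  have h2 : (q:ℝ) ≤ Nat.sqrt n := by exact_mod_cast hqQ
  have h2' : (q':ℝ) ≤ Nat.sqrt n := by exact_mod_cast hqQ'
  simp only [Hq, Finset.mem_filter, Finset.mem_Icc] at hh hh'
  rw [Set.disjoint_left]
  intro x hx hx'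
  simp only [arc, Set.mem_Icc] at hx hx'
  push_cast at hx hx'
  have hcross : h * q' ≠ h' * q := by
    intro he
    have d1 : q ∣ q' := by
      have : q ∣ h * q' := by rw [he]; exact Dvd.intro_left _ rfl
      exact (Nat.Coprime.symm hh.2).dvd_of_dvd_mul_left this
    have d2 : q' ∣ q := by
      have : q' ∣ h' * q := by rw [← he]; exact Dvd.intro_left _ rfl
      exact (Nat.Coprime.symm hh'.2).dvd_of_dvd_mul_left this
    have := Nat.dvd_antisymm d1 d2
    subst this
    exact hne ⟨rfl, Nat.eq_of_mul_eq_mul_right hq he⟩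
  have habs : 1 ≤ |(h:ℝ) * q' - h' * q| := by
    have : (1:ℤ) ≤ |(h:ℤ) * q' - h' * q| := by
      apply Int.one_le_abs
      intro h0
      apply hcross
      have : (h:ℤ) * q' = h' * q := by linarith
      exact_mod_cast this
    exact_mod_cast this
  have e1 : (h:ℝ) * q' - h' * q = ((h:ℝ)/q - h'/q') * (q * q') := by field_simp
  have e2 : |(h:ℝ)/q - h'/q'| ≤ dl n q + dl n q' := by
    rw [abs_le]; constructor <;> linarith
  have e3 : (dl n q + dl n q') * (q * q') = (q + q') / (2 * (Nat.sqrt n + 1)) := by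
    unfold dl; field_simp; ring
  rw [e1, abs_mul, abs_of_pos (by positivity : (0:ℝ) < q * q')] at habs
  have e4 : |(h:ℝ)/q - h'/q'| * (q * q') ≤ (dl n q + dl n q') * (q * q') := by gcongr
  rw [e3] at e4
  have e5 : ((q:ℝ) + q') / (2 * (Nat.sqrt n + 1)) < 1 := by
    rw [div_lt_one (by positivity)]; linarith
  linarith

lemma off_arc (n : ℕ) (hn : 0 < n) (x : ℝ) (hx : x ∈ Ioc (dl n 1) (dl n 1 + 1))
    (hoff : ∀ q h : ℕ, 0 < q → q ≤ Nat.sqrt n → h ∈ Hq q → x ∉ arc n q h) :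
    ∃ q : ℕ, ∃ h : ℤ, 0 < q ∧ q ≤ Nat.sqrt n ∧ IsCoprime h (q:ℤ) ∧ x ∉ arc n q h ∧ |x - h/q| ≤ 1 / ((Nat.sqrt n + 1) * q) := by
  obtain ⟨r, hr1, hr2⟩ := Real.exists_rat_abs_sub_le_and_den_le x (Nat.sqrt_pos.mpr hn)
  have hcop : IsCoprime r.num (r.den:ℤ) := by
    rw [Int.isCoprime_iff_gcd_eq_one]
    exact r.reduced
  have hden := r.den_pos
  have hre : (r:ℝ) = r.num / r.den := by exact_mod_cast (Rat.num_div_den r).symm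
  rw [hre] at hr1
  refine ⟨r.den, r.num, hden, hr2, hcop, ?_, hr1⟩
  have hd : (0:ℝ) < r.den := by exact_mod_cast hden
  have hf := dl_far n r.den hden hr2
  have hl := dl_le n r.den hden
  rcases le_or_gt r.num 0 with h | h
  · intro hA
    simp only [arc, Set.mem_Icc] at hA
    have : (r.num:ℝ)/r.den ≤ 0 := div_nonpos_of_nonpos_of_nonneg (by exact_mod_cast h) hd.le
    linarith [hx.1]
  · rcases le_or_gt r.num r.den with h' | h'
    · have hnat : r.num = (r.num.toNat : ℤ) := (Int.toNat_of_nonneg h.le).symm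
      rw [hnat]
      apply hoff _ _ hden hr2
      simp only [Hq, Finset.mem_filter, Finset.mem_Icc]
      refine ⟨⟨by omega, by omega⟩, ?_⟩
      rw [hnat] at hcop
      exact Nat.isCoprime_iff_coprime.mp hcop
    · intro hA
      simp only [arc, Set.mem_Icc] at hA
      have : 1 + 1 / (r.den:ℝ) ≤ (r.num:ℝ)/r.den := by
        rw [le_div_iff₀ hd, add_mul, one_div, inv_mul_cancel₀ hd.ne']
        have : (r.den:ℤ) + 1 ≤ r.num := h'
        have : ((r.den:ℤ):ℝ) + 1 ≤ r.num := by exact_mod_cast this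
        push_cast at this
        linarith
      linarith [hx.2]

lemma circle (a b ε : ℝ) (ha : 1 ≤ a) (hab : a < b) (hε : 0 < ε) (hεb : 2*ε ≤ b - a) :
    ∃ K : ℝ, 0 ≤ K ∧ ∀ n : ℕ, 0 < n →
      ‖(SR a b n : ℂ) - ∑ q ∈ Finset.Icc 1 (Nat.sqrt n), SS a b q n * cq q n‖ ≤ K * BB a b ε n := by
  obtain ⟨K, hK, H⟩ := arc_est a b ε ha hab hε hεb
  set Z := ∑' q : ℕ+, (q:ℝ) ^ (-1-2*ε) with hZ
  have hZs := pnat_rpow_summable (-1-2*ε) (by linarith)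
  have hZ0 : 0 ≤ Z := tsum_nonneg (fun q => by positivity)
  refine ⟨K * (1 + Z) + K, by positivity, ?_⟩
  intro n hn
  have hN : (0:ℝ) < n := by exact_mod_cast hn
  have hB := BB_pos a b ε n hn
  have hcop : ∀ q h : ℕ, h ∈ Hq q → IsCoprime (h:ℤ) (q:ℤ) := by
    intro q h hh
    simp only [Hq, Finset.mem_filter] at hh
    exact Nat.isCoprime_iff_coprime.mpr hh.2
  set P : Finset (Σ _ : ℕ, ℕ) := (Finset.Icc 1 (Nat.sqrt n)).sigma (fun q => Hq q) with hP
  have hPm : ∀ i ∈ P, 0 < i.1 ∧ i.1 ≤ Nat.sqrt n ∧ i.2 ∈ Hq i.1 := by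
    intro i hi
    rw [hP, Finset.mem_sigma, Finset.mem_Icc] at hi
    exact ⟨hi.1.1, hi.1.2, hi.2⟩
  set s : (Σ _ : ℕ, ℕ) → Set ℝ := fun i => arc n i.1 i.2 with hs
  set U : Set ℝ := ⋃ i ∈ P, s i with hU
  set J : Set ℝ := Ioc (dl n 1) (dl n 1 + 1) with hJ
  have hms : ∀ i, MeasurableSet (s i) := fun i => measurableSet_Icc
  have hmU : MeasurableSet U := Finset.measurableSet_biUnion _ (fun i _ => hms i)
  have hUJ : U ⊆ J := by
    intro x hx
    simp only [hU, mem_iUnion] at hx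
    obtain ⟨i, hi, hx⟩ := hx
    obtain ⟨p1, p2, p3⟩ := hPm i hi
    exact arc_sub n i.1 i.2 p1 p2 p3 hx
  have hcont := GG_cont a b (by linarith) (by linarith) n hn
  have iJ : IntegrableOn (GG a b n) J := hcont.integrableOn_Icc.mono_set Ioc_subset_Icc_self
  have hSR : (SR a b n : ℂ) = ∫ x in J, GG a b n x :=
    SR_integral a b (by linarith) (by linarith) n (1/n) (dl n 1) (by positivity)
  have hUint : ∫ x in U, GG a b n x = ∑ i ∈ P, ∫ x in s i, GG a b n x := by
    apply integral_biUnion_finset P (fun i _ => hms i)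
    · intro i hi j hj hij
      obtain ⟨p1, p2, p3⟩ := hPm i hi
      obtain ⟨r1, r2, r3⟩ := hPm j hj
      apply arc_disj n i.1 i.2 j.1 j.2 p1 p2 p3 r1 r2 r3
      rintro ⟨e1, e2⟩
      apply hij
      rcases i with ⟨i1, i2⟩
      rcases j with ⟨j1, j2⟩
      simp only at e1 e2
      rw [e1, e2]
    · intro i _
      exact hcont.integrableOn_Icc
  have hsplit : ∫ x in J, GG a b n x = (∑ i ∈ P, ∫ x in s i, GG a b n x) + ∫ x in J \ U, GG a b n x := by
    rw [← hUint, ← integral_inter_add_diff hmU iJ, inter_eq_self_of_subset_right hUJ]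
  have hoffb : ‖∫ x in J \ U, GG a b n x‖ ≤ K * BB a b ε n := by
    have hvol : volume.real (J \ U) ≤ 1 := by
      refine (measureReal_mono diff_subset (by rw [hJ, Real.volume_Ioc]; exact ENNReal.ofReal_ne_top)).trans ?_
      rw [hJ, measureReal_def, Real.volume_Ioc, ENNReal.toReal_ofReal (by linarith)]; linarith
    have hfin : volume (J \ U) < ⊤ := by
      refine lt_of_le_of_lt (measure_mono diff_subset) ?_
      rw [hJ, Real.volume_Ioc]; exact ENNReal.ofReal_lt_top
    refine (norm_setIntegral_le_of_norm_le_const (C := K * BB a b ε n) hfin ?_).trans ?_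
    · intro x hx
      obtain ⟨q, h, t1, t2, t3, t4, t5⟩ := off_arc n hn x hx.1 (by
        intro q h hq hqQ hh hxA
        apply hx.2
        simp only [hU, mem_iUnion]
        exact ⟨⟨q, h⟩, by rw [hP, Finset.mem_sigma, Finset.mem_Icc]; exact ⟨⟨hq, hqQ⟩, hh⟩, hxA⟩)
      exact (H n q hn t1 t2 h t3).2 x t4 t5
    · exact mul_le_of_le_one_right (by positivity) hvol
  have hsum : ∑ q ∈ Finset.Icc 1 (Nat.sqrt n), SS a b q n * cq q n = ∑ i ∈ P, SS a b i.1 n * cexp (n * (2 * Real.pi * I * ((i.2:ℤ)/i.1))) := by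
    rw [hP, Finset.sum_sigma]
    apply Finset.sum_congr rfl
    intro q _
    rw [cq, Finset.mul_sum]
    simp
  have hmain : ‖∑ i ∈ P, ((∫ x in s i, GG a b n x) - SS a b i.1 n * cexp (n * (2 * Real.pi * I * ((i.2:ℤ)/i.1))))‖ ≤ K * BB a b ε n * (1 + Z) := by
    have g1 : ∀ i ∈ P, ‖(∫ x in s i, GG a b n x) - SS a b i.1 n * cexp (n * (2 * Real.pi * I * ((i.2:ℤ)/i.1)))‖ ≤
        K * BB a b ε n * (2 * dl n i.1 + (i.1:ℝ)^(-2-2*ε) / 2) := by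
      intro i hi
      obtain ⟨p1, p2, p3⟩ := hPm i hi
      exact (H n i.1 hn p1 p2 i.2 (hcop _ _ p3)).1
    refine (norm_sum_le_of_le _ g1).trans ?_
    rw [← Finset.mul_sum]
    apply mul_le_mul_of_nonneg_left _ (by positivity)
    rw [hP, Finset.sum_sigma]
    simp only [Finset.sum_const, nsmul_eq_mul]
    have g2 : ∀ q ∈ Finset.Icc 1 (Nat.sqrt n), ((Hq q).card : ℝ) * (2 * dl n q + (q:ℝ)^(-2-2*ε) / 2) ≤ 1 / (Nat.sqrt n + 1) + (q:ℝ)^(-1-2*ε) := by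
      intro q hq
      have hq1 := (Finset.mem_Icc.mp hq).1
      have hQ : (0:ℝ) < q := by exact_mod_cast hq1
      have hd := dl_pos n q hq1
      have hcard : ((Hq q).card : ℝ) ≤ q := by exact_mod_cast Hq_card q
      calc _ ≤ (q:ℝ) * (2 * dl n q + (q:ℝ)^(-2-2*ε) / 2) := by gcongr
        _ = 1 / (Nat.sqrt n + 1) + (q * (q:ℝ)^(-2-2*ε)) / 2 := by
          rw [dl]; field_simp
        _ = 1 / (Nat.sqrt n + 1) + (q:ℝ)^(-1-2*ε) / 2 := by
          have : (q:ℝ)^(-1-2*ε) = q * (q:ℝ)^(-2-2*ε) := by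
            rw [show -1-2*ε = 1 + (-2-2*ε) by ring, Real.rpow_add hQ, Real.rpow_one]
          rw [this]
        _ ≤ _ := by
          have : 0 < (q:ℝ)^(-1-2*ε) := by positivity
          linarith
    refine (Finset.sum_le_sum g2).trans ?_
    rw [Finset.sum_add_distrib]
    apply add_le_add
    · simp only [Finset.sum_const, Nat.card_Icc, nsmul_eq_mul, Nat.add_sub_cancel]
      rw [mul_one_div, div_le_one (by positivity)]
      linarith
    · rw [hZ, tsum_pnat_eq_tsum_succ (f := fun q : ℕ => (q:ℝ)^(-1-2*ε))]
      rw [← Finset.Ico_add_one_right_eq_Icc, Finset.sum_Ico_eq_sum_range, Nat.add_sub_cancel]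
      have hs2 : Summable fun k : ℕ => ((k+1:ℕ):ℝ)^(-1-2*ε) := by
        exact (summable_nat_add_iff 1).mpr ((Real.summable_nat_rpow (p := -1-2*ε)).mpr (by linarith))
      have := hs2.sum_le_tsum (Finset.range (Nat.sqrt n)) (fun k _ => by positivity)
      simpa only [add_comm 1] using this
  rw [hSR, hsplit, hsum, add_sub_right_comm, ← Finset.sum_sub_distrib]
  refine (norm_add_le _ _).trans ((add_le_add hmain hoffb).trans (le_of_eq ?_))
  ring

lemma zeta_real_gt (s : ℝ) (hs : 1 < s) : riemannZeta s = (zetaR s : ℂ) := by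
  apply Complex.ext
  · simp [zetaR]
  · simp [riemannZeta_im_eq_zero_of_one_lt hs]

lemma zeta_real_one_sub (a : ℝ) (ha : 1 ≤ a) : riemannZeta (1 - a) = (zetaR (1 - a) : ℂ) := by
  have him : (riemannZeta (1 - (a:ℂ))).im = 0 := by
    rcases ha.eq_or_lt with h | h
    · rw [← h]; norm_num [riemannZeta_zero]
    · rw [riemannZeta_one_sub (s := (a:ℂ)) (by
        intro n hn
        have := congrArg Complex.re hn
        simp at this
        have : (0:ℝ) ≤ n := by positivity
        linarith) (by
        intro hn
        have := congrArg Complex.re hn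
        simp at this
        linarith), zeta_real_gt a h]
      have e : (2 * (2 * (Real.pi:ℂ)) ^ (-(a:ℂ)) * Complex.Gamma a * Complex.cos (Real.pi * a / 2) * (zetaR a : ℂ)) =
          ((2 * (2 * Real.pi) ^ (-a) * Real.Gamma a * Real.cos (Real.pi * a / 2) * zetaR a : ℝ):ℂ) := by
        push_cast
        rw [Complex.ofReal_cpow (by positivity), Complex.Gamma_ofReal]
        push_cast; rfl
      rw [e, Complex.ofReal_im]
  apply Complex.ext
  · simp [zetaR]
  · simp [him]

lemma tail_est (ε : ℝ) (hε : 0 < ε) (f : ℕ → ℂ) (D : ℝ) (Q : ℕ) (hf : Summable fun q : ℕ+ => f q)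
    (hb : ∀ q : ℕ, Q < q → ‖f q‖ ≤ D * (q:ℝ)^(-1-2*ε)) (hD : 0 ≤ D) :
    ‖∑ q ∈ Finset.Icc 1 Q, f q - ∑' q : ℕ+, f q‖ ≤ D * ∑' q : ℕ+, (q:ℝ)^(-1-2*ε) := by
  have hf' : Summable fun k : ℕ => f (k+1) := by
    exact (summable_pnat_iff_summable_succ (f := f)).mp hf
  have hs2 : Summable fun k : ℕ => ((k+1:ℕ):ℝ)^(-1-2*ε) := by
    exact (summable_nat_add_iff 1).mpr ((Real.summable_nat_rpow (p := -1-2*ε)).mpr (by linarith))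
  rw [tsum_pnat_eq_tsum_succ (f := fun q : ℕ => (q:ℝ)^(-1-2*ε)), tsum_pnat_eq_tsum_succ (f := f)]
  rw [← Finset.Ico_add_one_right_eq_Icc, Finset.sum_Ico_eq_sum_range, Nat.add_sub_cancel]
  simp only [add_comm 1]
  rw [← hf'.sum_add_tsum_nat_add Q, ← hs2.sum_add_tsum_nat_add Q, sub_add_cancel_left, norm_neg]
  have h1 : Summable fun k : ℕ => ((k+Q+1:ℕ):ℝ)^(-1-2*ε) := (summable_nat_add_iff Q).mpr hs2
  refine (tsum_of_norm_bounded (h1.hasSum.mul_left D) (fun k => hb (k+Q+1) (by omega))).trans ?_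
  apply mul_le_mul_of_nonneg_left _ hD
  have : 0 ≤ ∑ k ∈ Finset.range Q, ((k+1:ℕ):ℝ)^(-1-2*ε) := Finset.sum_nonneg (fun k _ => by positivity)
  linarith

lemma SS_bound (a b ε : ℝ) (ha : 1 ≤ a) (hab : a < b) (hεb : 2*ε ≤ b - a) (n q : ℕ) (hn : 0 < n) (hq : Nat.sqrt n < q) :
    ‖SS a b q n * cq q n‖ ≤ ((‖al a b‖ + ‖be a b‖) * BB a b ε n) * (q:ℝ)^(-1-2*ε) := by
  have hN : (0:ℝ) < n := by exact_mod_cast hn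
  have hQ : (0:ℝ) < q := by exact_mod_cast (by omega : 0 < q)
  have hsq : √(n:ℝ) ≤ q := (sqrt_facts n).2.1.le.trans (by exact_mod_cast hq)
  have hp : Real.log n / 2 ≤ Real.log q := by
    rw [← Real.log_sqrt hN.le]
    exact Real.log_le_log (Real.sqrt_pos.mpr hN) hsq
  have hX : ((n:ℝ)^((a+b)/2+1+ε)) ≤ BB a b ε n := by
    rw [BB]; have : 0 < (n:ℝ)^b := by positivity
    linarith
  have gen : ∀ c d : ℝ, c * Real.log n + (1 - d) * Real.log q ≤ ((a+b)/2+1+ε) * Real.log n + (-1-2*ε) * Real.log q →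
      (n:ℝ)^c * (q:ℝ)^(-d) * q ≤ BB a b ε n * (q:ℝ)^(-1-2*ε) := by
    intro c d h
    refine le_trans ?_ (mul_le_mul_of_nonneg_right hX (by positivity))
    have e : (n:ℝ)^c * (q:ℝ)^(-d) * q = (n:ℝ)^c * (q:ℝ)^(1-d) := by
      rw [mul_assoc, show 1 - d = -d + 1 by ring, Real.rpow_add hQ, Real.rpow_one]
    rw [e, Real.rpow_def_of_pos hN, Real.rpow_def_of_pos hN, Real.rpow_def_of_pos hQ, Real.rpow_def_of_pos hQ, ← Real.exp_add, ← Real.exp_add]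
    apply Real.exp_le_exp.mpr
    linarith
  have g1 := gen (a+b+1) (a+b+2) (by nlinarith [mul_nonneg (by linarith : 0 ≤ a + b - 2*ε) (sub_nonneg.mpr hp)])
  have g2 := gen (b+1) (b-a+2) (by nlinarith [mul_nonneg (by linarith : 0 ≤ b - a - 2*ε) (sub_nonneg.mpr hp)])
  have hS : ‖SS a b q n‖ ≤ ‖al a b‖ * ((n:ℝ)^(a+b+1) * (q:ℝ)^(-(a+b+2))) + ‖be a b‖ * ((n:ℝ)^(b+1) * (q:ℝ)^(-(b-a+2))) := by
    rw [SS]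
    refine (norm_add_le _ _).trans (le_of_eq ?_)
    rw [norm_mul, norm_mul, norm_mul, norm_mul, Complex.norm_real, Complex.norm_real, Complex.norm_real, Complex.norm_real,
      Real.norm_of_nonneg (by positivity), Real.norm_of_nonneg (by positivity), Real.norm_of_nonneg (by positivity), Real.norm_of_nonneg (by positivity)]
    ring
  rw [norm_mul]
  calc _ ≤ (‖al a b‖ * ((n:ℝ)^(a+b+1) * (q:ℝ)^(-(a+b+2))) + ‖be a b‖ * ((n:ℝ)^(b+1) * (q:ℝ)^(-(b-a+2)))) * q := by
        gcongr
        exact cq_norm q n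
    _ = ‖al a b‖ * ((n:ℝ)^(a+b+1) * (q:ℝ)^(-(a+b+2)) * q) + ‖be a b‖ * ((n:ℝ)^(b+1) * (q:ℝ)^(-(b-a+2)) * q) := by ring
    _ ≤ ‖al a b‖ * (BB a b ε n * (q:ℝ)^(-1-2*ε)) + ‖be a b‖ * (BB a b ε n * (q:ℝ)^(-1-2*ε)) := by gcongr
    _ = _ := by ring

lemma SS_tsum (a b : ℝ) (ha : 1 ≤ a) (hab : a < b) (n : ℕ) (hn : 0 < n) :
    (Summable fun q : ℕ+ => SS a b q n * cq q n) ∧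
    ∑' q : ℕ+, SS a b q n * cq q n = ((Real.Gamma (a + 1) * Real.Gamma (b + 1) / Real.Gamma (a + b + 2))
            * (zetaR (a + 1) * zetaR (b + 1) / zetaR (a + b + 2)) * sigmaR (a + b + 1) n
        + zetaR (1 - a) * zetaR (b + 1) / ((b + 1) * zetaR (b - a + 2))
            * (n : ℝ) ^ a * sigmaR (b - a + 1) n : ℝ) := by
  have hN : (0:ℝ) < n := by exact_mod_cast hn
  have s1 := (cq_summable (a+b+2) (by linarith) n)
  have s2 := (cq_summable (b-a+2) (by linarith) n)
  have r1 := ram_series (a+b+2) (by linarith) n hn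
  have r2 := ram_series (b-a+2) (by linarith) n hn
  have e : (fun q : ℕ+ => SS a b q n * cq q n) = fun q : ℕ+ =>
      (al a b * ((n:ℝ)^(a+b+1):ℝ)) * ((((q:ℝ) ^ (-(a+b+2)) : ℝ):ℂ) * cq q n) + (be a b * ((n:ℝ)^(b+1):ℝ)) * ((((q:ℝ) ^ (-(b-a+2)) : ℝ):ℂ) * cq q n) := by
    funext q
    rw [SS]; push_cast; ring
  rw [e]
  refine ⟨(s1.mul_left _).add (s2.mul_left _), ?_⟩
  rw [(s1.mul_left _).tsum_add (s2.mul_left _), tsum_mul_left, tsum_mul_left]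
  rw [show a+b+2-1 = a+b+1 by ring] at r1
  rw [show b-a+2-1 = b-a+1 by ring] at r2
  have hb1 : (n:ℝ)^(b+1) = (n:ℝ)^a * (n:ℝ)^(b-a+1) := by rw [← Real.rpow_add hN]; congr 1; ring
  rw [mul_assoc (al a b), r1, hb1, Complex.ofReal_mul, mul_assoc (be a b), mul_assoc (((n:ℝ)^a:ℝ):ℂ), r2]
  have z1 := zeta_real_gt (a+1) (by linarith)
  have z2 := zeta_real_gt (b+1) (by linarith)
  have z3 := zeta_real_gt (a+b+2) (by linarith)
  have z4 := zeta_real_gt (b-a+2) (by linarith)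
  have z5 := zeta_real_one_sub a ha
  have hG : Real.Gamma (b+2) = (b+1) * Real.Gamma (b+1) := by
    rw [show b + 2 = (b+1)+1 by ring, Real.Gamma_add_one (by linarith)]
  have hG1 : (Real.Gamma (b+1):ℂ) ≠ 0 := by exact_mod_cast (Real.Gamma_pos_of_pos (by linarith)).ne'
  rw [al, be, hG, z3, z4, z5]
  push_cast at z1 z2 ⊢
  rw [z1, z2]
  have : ((b:ℂ)+1) ≠ 0 := by
    have : (b+1:ℝ) ≠ 0 := by linarith
    exact_mod_cast this
  congr 1
  · ring
  · rw [show (zetaR (1-a):ℂ) * (Real.Gamma (b+1) * zetaR (b+1)) / ((b+1) * Real.Gamma (b+1)) = zetaR (1-a) * zetaR (b+1) / (b+1) by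
      field_simp]
    rw [← div_div]
    ring

theorem final_aux (a b ε : ℝ) (ha : 1 ≤ a) (hab : a < b) (hε : 0 < ε) (hεb : 2*ε ≤ b - a) : ∃ C : ℝ, 0 ≤ C ∧ ∀ n : ℕ, 0 < n →
      |SR a b n
        - (Real.Gamma (a + 1) * Real.Gamma (b + 1) / Real.Gamma (a + b + 2))
            * (zetaR (a + 1) * zetaR (b + 1) / zetaR (a + b + 2)) * sigmaR (a + b + 1) n
        - zetaR (1 - a) * zetaR (b + 1) / ((b + 1) * zetaR (b - a + 2))
            * (n : ℝ) ^ a * sigmaR (b - a + 1) n|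
      ≤ C * BB a b ε n := by
  obtain ⟨K, hK, H⟩ := circle a b ε ha hab hε hεb
  have hZ : 0 ≤ ∑' q : ℕ+, (q:ℝ)^(-1-2*ε) := tsum_nonneg (fun q => by positivity)
  refine ⟨K + (‖al a b‖ + ‖be a b‖) * ∑' q : ℕ+, (q:ℝ)^(-1-2*ε), by positivity, ?_⟩
  intro n hn
  have hB := BB_pos a b ε n hn
  obtain ⟨s1, s2⟩ := SS_tsum a b ha hab n hn
  have h1 := H n hn
  have h2 := tail_est ε hε (fun q => SS a b q n * cq q n) _ (Nat.sqrt n) s1 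
    (fun q hq => SS_bound a b ε ha hab hεb n q hn hq) (by positivity)
  rw [s2] at h2
  rw [sub_sub, ← Real.norm_eq_abs, ← Complex.norm_real, Complex.ofReal_sub]
  refine (norm_sub_le_norm_sub_add_norm_sub _ (∑ q ∈ Finset.Icc 1 (Nat.sqrt n), SS a b q n * cq q n) _).trans ((add_le_add h1 h2).trans (le_of_eq ?_))
  ring

theorem final' (a b : ℝ) (ha : 1 ≤ a) (hab : a < b) :
    ∀ ε > 0, ∃ C : ℝ, ∀ n : ℕ, 0 < n →
      |SR a b n
        - (Real.Gamma (a + 1) * Real.Gamma (b + 1) / Real.Gamma (a + b + 2))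
            * (zetaR (a + 1) * zetaR (b + 1) / zetaR (a + b + 2)) * sigmaR (a + b + 1) n
        - zetaR (1 - a) * zetaR (b + 1) / ((b + 1) * zetaR (b - a + 2))
            * (n : ℝ) ^ a * sigmaR (b - a + 1) n|
      ≤ C * ((n : ℝ) ^ b + (n : ℝ) ^ ((a + b) / 2 + 1 + ε)) := by
  intro ε hε
  obtain ⟨C, hC, H⟩ := final_aux a b (min ε ((b-a)/2)) ha hab (lt_min hε (by linarith)) (by linarith [min_le_right ε ((b-a)/2)])
  refine ⟨C, fun n hn => (H n hn).trans ?_⟩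
  have : (1:ℝ) ≤ n := by exact_mod_cast hn
  unfold BB
  gcongr
  exact min_le_left _ _

end aux_lemmas

theorem stmt0 (a b : ℝ) (ha : 1 ≤ a) (hab : a < b) :
    ∀ ε > 0, ∃ C : ℝ, ∀ n : ℕ, 0 < n →
      |SR a b n
        - (Real.Gamma (a + 1) * Real.Gamma (b + 1) / Real.Gamma (a + b + 2))
            * (zetaR (a + 1) * zetaR (b + 1) / zetaR (a + b + 2)) * sigmaR (a + b + 1) n
        - zetaR (1 - a) * zetaR (b + 1) / ((b + 1) * zetaR (b - a + 2))
            * (n : ℝ) ^ a * sigmaR (b - a + 1) n|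
      ≤ C * ((n : ℝ) ^ b + (n : ℝ) ^ ((a + b) / 2 + 1 + ε)) := by
  exact final' a b ha hab
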